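/- Let R be a complete Noetherian local domain of mixed characteristic p whose residue field is F-finite, and let x_1, …, x_n be part of a system of parameters of R. Then there exists a positive integer N_0 such that for every integer N ≥ N_0, the colon ideal (x_1, …, x_{n−1}, p^N)R^+ :_{R^+} x_n is contained in the epf closure ((x_1, …, x_{n−1}, p^{N−N_0})R^+)^epf computed in R^+. (This is the p-colon-capturing property of the epf closure.) -/

import Mathlib

open IsLocalRing TensorProduct
set_option synthInstance.maxHeartbeats 1000000
set_option maxHeartbeats 1000000

/-- The absolute integral closure `R⁺` of a domain `R`: the integral closure of `R`
in an algebraic closure of its fraction field. -/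
noncomputable abbrev RPlus (R : Type) [CommRing R] [IsDomain R] : Type :=
  ↥(integralClosure R (AlgebraicClosure (FractionRing R)))

/-- The epf closure of an ideal `J` of `R⁺`, computed in `R⁺`: `u` is in the closure iff
there is `c ≠ 0` in `R⁺` such that `d * u ∈ J + p^N R⁺` for all `N ≥ 1` and all
`n`-th roots `d` of `c` (`n ≥ 1`). -/
def epfPlus (p : ℕ) (R : Type) [CommRing R] [IsDomain R] (J : Ideal (RPlus R)) :
    Set (RPlus R) :=
  {u | ∃ c : RPlus R, c ≠ 0 ∧ ∀ n N : ℕ, 0 < n → 0 < N →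
    ∀ d : RPlus R, d ^ n = c → d * u ∈ J ⊔ Ideal.span {(p : RPlus R) ^ N}}

/-- A field `k` of characteristic `p` is F-finite if it is a finite module over
its subfield `k^p` of `p`-th powers. -/
def FFinite (p : ℕ) (k : Type) [Field k] : Prop :=
  ∃ (m : ℕ) (s : Fin m → k), ∀ a : k, ∃ c : Fin m → k, a = ∑ i, (c i) ^ p * s i

/-- A system of parameters of a local ring: `d` elements generating an ideal whose
radical is the maximal ideal, where `d` is the Krull dimension. -/
def IsSOP (R : Type) [CommRing R] [IsLocalRing R] {d : ℕ} (x : Fin d → R) : Prop :=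
  ringKrullDim R = d ∧ (Ideal.span (Set.range x)).radical = maximalIdeal R

/-- Part of a system of parameters: a sequence extendable to a full system of parameters. -/
def IsPartialSOP (R : Type) [CommRing R] [IsLocalRing R] {n : ℕ} (x : Fin n → R) : Prop :=
  ∃ (d : ℕ) (hd : n ≤ d) (y : Fin d → R), IsSOP R y ∧ ∀ i : Fin n, y (Fin.castLE hd i) = x i

set_option linter.unusedSectionVars false

/-- Flatness criterion by equations modulo `a`. -/
def EqFlat {A B : Type} [CommRing A] [CommRing B] (f : A →+* B) (a : A) : Prop :=
  ∀ (ι : Type) [Fintype ι] (x : ι → A) (y : ι → B), f a ∣ ∑ i, f (x i) * y i →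
    ∃ (κ : Type) (_ : Fintype κ) (b : κ → ι → A) (w : κ → B),
      (∀ j, a ∣ ∑ i, x i * b j i) ∧ ∀ i, y i = ∑ j, w j * f (b j i)

theorem EqFlat.comp {A B C : Type} [CommRing A] [CommRing B] [CommRing C] {f : A →+* B}
    {g : B →+* C} {a : A} (hf : EqFlat f a) (hg : EqFlat g (f a)) : EqFlat (g.comp f) a := by
  intro ι _ x y h
  obtain ⟨κ, _, b, w, hb, hy⟩ := hg ι (fun i => f (x i)) y h
  choose κ' F' b' w' hb' hy' using fun j => hf ι x (b j) (hb j)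
  let _ := F'
  refine ⟨Σ j, κ' j, inferInstance, fun s => b' s.1 s.2, fun s => w s.1 * g (w' s.1 s.2),
    fun s => hb' s.1 s.2, fun i => ?_⟩
  rw [hy i, Fintype.sum_sigma]
  refine Finset.sum_congr rfl fun j _ => ?_
  rw [hy' j i, map_sum, Finset.mul_sum]
  refine Finset.sum_congr rfl fun k _ => ?_
  simp [mul_assoc]

theorem isTrivialRelation_aux (A B : Type) [CommRing A] [CommRing B] [Algebra A B] (ι : Type)
    [Fintype ι] [Module.Flat A B] (X : ι → A) (Y : ι → B)
    (h0 : ∑ i, algebraMap A B (X i) * Y i = 0) :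
    ∃ (n : ℕ) (c : ι → Fin n → A) (z : Fin n → B),
      (∀ i, Y i = ∑ j, algebraMap A B (c i j) * z j) ∧ ∀ j, ∑ i, X i * c i j = 0 := by
  obtain ⟨n, c, z, h1, h2⟩ := Module.Flat.isTrivialRelation_of_sum_smul_eq_zero
    (R := A) (M := B) (f := X) (x := Y) (by simpa only [Algebra.smul_def] using h0)
  exact ⟨n, c, z, by simpa only [Algebra.smul_def] using h1, h2⟩

theorem EqFlat.of_flat' (A B : Type) [CommRing A] [CommRing B] [Algebra A B]
    [Module.Flat A B] (a : A) : EqFlat (algebraMap A B) a := by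
  intro ι _ x y ⟨t, ht⟩
  obtain ⟨X, hX0, hX⟩ : ∃ X : Option ι → A, X none = a ∧ ∀ i, X (some i) = x i :=
    ⟨fun i => i.elim a x, rfl, fun _ => rfl⟩
  obtain ⟨Y, hY0, hY⟩ : ∃ Y : Option ι → B, Y none = -t ∧ ∀ i, Y (some i) = y i :=
    ⟨fun i => i.elim (-t) y, rfl, fun _ => rfl⟩
  obtain ⟨κ, c, z, h1, h2⟩ := isTrivialRelation_aux A B (Option ι) X Y (by
    rw [Fintype.sum_option]
    simp only [hX0, hY0, hX, hY, ht]
    ring)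
  refine ⟨Fin κ, inferInstance, fun j i => c (some i) j, z, fun j => ?_, fun i => ?_⟩
  · have := h2 j
    rw [Fintype.sum_option] at this
    simp only [hX0, hX] at this
    exact ⟨-c none j, by linear_combination this⟩
  · rw [← hY, h1 (some i)]
    exact Finset.sum_congr rfl fun j _ => mul_comm _ _

theorem EqFlat.of_flat {A B : Type} [CommRing A] [CommRing B] {f : A →+* B} (hf : f.Flat)
    (a : A) : EqFlat f a :=
  @EqFlat.of_flat' A B _ _ f.toAlgebra hf a

theorem EqFlat.pow {A B : Type} [CommRing A] [CommRing B] {f : A →+* B} {a : A}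
    (hf : EqFlat f a) (ha : ∀ b, f a * b = 0 → b = 0) (N : ℕ) : EqFlat f (a ^ N) := by
  have hN : ∀ N b, f a ^ N * b = 0 → b = 0 := by
    intro N
    induction N with
    | zero => intro b; simp
    | succ N ih => intro b hb; exact ha _ (ih _ (by rw [← hb]; ring))
  induction N with
  | zero =>
    intro ι _ x y _
    classical
    refine ⟨ι, inferInstance, fun j i => if i = j then 1 else 0, y, fun j => by simp, fun i => ?_⟩
    simp [apply_ite f]
  | succ N ih =>
    intro ι _ x y h
    obtain ⟨κ, _, b, w, hb, hy⟩ := ih ι x y (dvd_trans (map_dvd f (pow_dvd_pow a N.le_succ)) h)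
    choose c hc using hb
    obtain ⟨t, ht⟩ := h
    have h1 : f a ∣ ∑ j, f (c j) * w j := by
      refine ⟨t, ?_⟩
      rw [← sub_eq_zero]
      apply hN N
      have : ∑ i, f (x i) * y i = f a ^ N * ∑ j, f (c j) * w j := by
        simp_rw [hy, Finset.mul_sum]
        rw [Finset.sum_comm]
        refine Finset.sum_congr rfl fun j _ => ?_
        have := congrArg f (hc j)
        simp only [map_sum, map_mul, map_pow] at this
        rw [← mul_assoc, ← this, Finset.sum_mul]
        exact Finset.sum_congr rfl fun i _ => by ring
      rw [mul_sub, ← this, ht, map_pow]; ring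
    obtain ⟨κ', _, e, v, he, hw⟩ := hf κ c w h1
    refine ⟨κ', inferInstance, fun k i => ∑ j, e k j * b j i, v, fun k => ?_, fun i => ?_⟩
    · have : ∑ i, x i * ∑ j, e k j * b j i = a ^ N * ∑ j, c j * e k j := by
        simp_rw [Finset.mul_sum]
        rw [Finset.sum_comm]
        refine Finset.sum_congr rfl fun j _ => ?_
        rw [← mul_assoc, ← hc j, Finset.sum_mul]
        exact Finset.sum_congr rfl fun i _ => by ring
      rw [this, pow_succ]
      exact mul_dvd_mul_left _ (he k)
    · rw [hy i]
      simp_rw [hw, map_sum, Finset.mul_sum, Finset.sum_mul]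
      rw [Finset.sum_comm]
      refine Finset.sum_congr rfl fun k _ => Finset.sum_congr rfl fun j _ => ?_
      simp [mul_assoc]

theorem EqFlat.lift {A B A' B' : Type} [CommRing A] [CommRing B] [CommRing A'] [CommRing B']
    {f : A →+* B} {f' : A' →+* B'} {α : A →+* A'} {β : B →+* B'} {a : A}
    (hα : Function.Surjective α) (hβ : Function.Surjective β)
    (kα : ∀ x, α x = 0 → a ∣ x) (kβ : ∀ x, β x = 0 → f a ∣ x) (kβ' : β (f a) = 0)
    (hc : ∀ x, f' (α x) = β (f x)) (h : EqFlat f' 0) : EqFlat f a := by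
  intro ι _ x y hxy
  have h1 : f' 0 ∣ ∑ i, f' (α (x i)) * β (y i) := by
    rw [map_zero, zero_dvd_iff]
    obtain ⟨t, ht⟩ := hxy
    have := congrArg β ht
    simpa [map_sum, hc, kβ'] using this
  obtain ⟨κ, _, b', w', hb', hy'⟩ := h ι _ _ h1
  choose b hb using fun j i => hα (b' j i)
  choose w hw using fun j => hβ (w' j)
  have h2 : ∀ i, f a ∣ y i - ∑ j, w j * f (b j i) := by
    intro i
    apply kβ
    simp [map_sub, map_sum, ← hc, hb, hw, hy' i]
  choose t ht using h2
  classical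
  refine ⟨κ ⊕ ι, inferInstance, Sum.elim b fun j i => if i = j then a else 0, Sum.elim w t, ?_, ?_⟩
  · rintro (j | j)
    · apply kα
      have := hb' j
      rw [zero_dvd_iff] at this
      simpa [map_sum, hb] using this
    · simp
  · intro i
    rw [Fintype.sum_sum_type]
    simp only [Sum.elim_inl, Sum.elim_inr, apply_ite f, map_zero, mul_ite, mul_zero,
      Finset.sum_ite_eq, Finset.mem_univ, if_true]
    linear_combination ht i

theorem EqFlat.descend {A B A' B' : Type} [CommRing A] [CommRing B] [CommRing A'] [CommRing B']
    {f : A →+* B} {f' : A' →+* B'} {α : A →+* A'} {β : B →+* B'} {a : A}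
    (hα : Function.Surjective α) (hβ : Function.Surjective β)
    (kα' : α a = 0) (kβ : ∀ x, β x = 0 → f a ∣ x)
    (hc : ∀ x, f' (α x) = β (f x)) (h : EqFlat f a) : EqFlat f' 0 := by
  intro ι _ x' y' hxy
  rw [map_zero, zero_dvd_iff] at hxy
  choose x hx using fun i => hα (x' i)
  choose y hy using fun i => hβ (y' i)
  obtain ⟨κ, _, b, w, hb, hyb⟩ := h ι x y (kβ _ (by simpa [map_sum, ← hc, hx, hy] using hxy))
  refine ⟨κ, inferInstance, fun j i => α (b j i), fun j => β (w j), fun j => ?_, fun i => ?_⟩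
  · rw [zero_dvd_iff]
    obtain ⟨t, ht⟩ := hb j
    have := congrArg α ht
    simpa [map_sum, hx, kα'] using this
  · rw [← hy, hyb]
    simp [map_sum, hc]

theorem EqFlat.colon {A B : Type} [CommRing A] [CommRing B] {f : A →+* B} {a : A}
    (hf : EqFlat f a) {s : A} {I J : Ideal A} (hIfg : I.FG)
    (hIJ : ∀ t, s * t ∈ I ⊔ Ideal.span {a} → t ∈ J) {v : B}
    (hv : f s * v ∈ I.map f ⊔ Ideal.span {f a}) : v ∈ J.map f := by
  classical
  obtain ⟨S, rfl⟩ := hIfg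
  rw [Submodule.mem_sup] at hv
  obtain ⟨u, hu, t, ht, hut⟩ := hv
  have hu' : ∃ c : S → B, u = ∑ i : S, f i.1 * c i := by
    have : Ideal.map f (Ideal.span (S : Set A)) = Ideal.span (Set.range fun i : S => f i.1) := by
      rw [Ideal.map_span]; congr 1; ext; simp
    change u ∈ Ideal.map f (Ideal.span (S : Set A)) at hu
    rw [this, Ideal.mem_span_range_iff_exists_fun] at hu
    obtain ⟨c, hc⟩ := hu
    exact ⟨c, by rw [← hc]; exact Finset.sum_congr rfl fun i _ => mul_comm _ _⟩
  obtain ⟨c, rfl⟩ := hu'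
  rw [Ideal.mem_span_singleton] at ht
  obtain ⟨κ, _, b, w, hb, hy⟩ := hf (Option S) (fun i => i.elim s (fun i => i.1))
    (fun i => i.elim v (fun i => - c i)) (by
      rw [Fintype.sum_option]
      simp only [Option.elim, mul_neg, Finset.sum_neg_distrib]
      rw [← hut]; simpa using ht)
  have := hy none
  simp only [Option.elim] at this
  rw [this]
  refine Ideal.sum_mem _ fun j _ => Ideal.mul_mem_left _ _ (Ideal.mem_map_of_mem _ (hIJ _ ?_))
  obtain ⟨t', ht'⟩ := hb j
  rw [Fintype.sum_option] at ht'
  simp only [Option.elim] at ht'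
  have h3 : s * b j none = -(∑ i : S, i.1 * b j (some i)) + a * t' := by linear_combination ht'
  rw [h3]
  refine Submodule.add_mem_sup ?_ (Ideal.mul_mem_right _ _ (Ideal.mem_span_singleton_self a))
  refine neg_mem (Ideal.sum_mem _ fun i _ => Ideal.mul_mem_right _ _ (Ideal.subset_span i.2))

section BQ
variable (p : ℕ) [Fact p.Prime]

/-- The untilt `W(Q)/(p-[π])`. -/
def BQ (Q : Type) [CommRing Q] (π : Q) : Type :=
  WittVector p Q ⧸ Ideal.span {(p : WittVector p Q) - WittVector.teichmuller p π}

noncomputable instance BQ.instCommRing (Q : Type) [CommRing Q] (π : Q) : CommRing (BQ p Q π) :=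
  Ideal.Quotient.commRing _

/-- The projection. -/
noncomputable def BQ.mk (Q : Type) [CommRing Q] (π : Q) : WittVector p Q →+* BQ p Q π :=
  Ideal.Quotient.mk _

variable {Q : Type} [CommRing Q] {π : Q}

theorem BQ.mk_surj : Function.Surjective (BQ.mk p Q π) := Ideal.Quotient.mk_surjective

theorem BQ.mk_eq_zero {x : WittVector p Q} :
    BQ.mk p Q π x = 0 ↔ ((p : WittVector p Q) - WittVector.teichmuller p π) ∣ x := by
  rw [← Ideal.mem_span_singleton]
  exact Ideal.Quotient.eq_zero_iff_mem

theorem BQ.mk_p : BQ.mk p Q π (WittVector.teichmuller p π) = p := by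
  have : BQ.mk p Q π ((p : WittVector p Q) - WittVector.teichmuller p π) = 0 :=
    (BQ.mk_eq_zero p).2 dvd_rfl
  rw [map_sub, map_natCast, sub_eq_zero] at this
  exact this.symm

/-- Lifting homs. -/
noncomputable def BQ.lift {T : Type} [CommRing T] (g : WittVector p Q →+* T)
    (hg : g (WittVector.teichmuller p π) = p) : BQ p Q π →+* T :=
  Ideal.Quotient.lift _ g (by
    intro a ha
    obtain ⟨s, rfl⟩ := Ideal.mem_span_singleton.1 ha
    rw [map_mul, map_sub, hg, map_natCast, sub_self, zero_mul])

theorem BQ.lift_mk {T : Type} [CommRing T] (g : WittVector p Q →+* T)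
    (hg : g (WittVector.teichmuller p π) = p) (x) : BQ.lift p g hg (BQ.mk p Q π x) = g x := rfl

/-- Functoriality. -/
noncomputable def BQ.map {Q' : Type} [CommRing Q'] {π' : Q'} (g : Q →+* Q') (hg : g π = π') :
    BQ p Q π →+* BQ p Q' π' :=
  BQ.lift p ((BQ.mk p Q' π').comp (WittVector.map g)) (by
    rw [RingHom.comp_apply, WittVector.map_teichmuller, hg, BQ.mk_p])

theorem BQ.map_mk {Q' : Type} [CommRing Q'] {π' : Q'} (g : Q →+* Q') (hg : g π = π') (x) :
    BQ.map p g hg (BQ.mk p Q π x) = BQ.mk p Q' π' (WittVector.map g x) := rfl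

variable [CharP Q p]

/-- Reduction mod `p`. -/
noncomputable def BQ.modp : BQ p Q π →+* Q ⧸ Ideal.span {π} :=
  BQ.lift p ((Ideal.Quotient.mk _).comp WittVector.constantCoeff) (by
    have : ((p : ℕ) : Q ⧸ Ideal.span {π}) = Ideal.Quotient.mk (Ideal.span {π}) ((p : ℕ) : Q) :=
      (map_natCast _ _).symm
    rw [this, CharP.cast_eq_zero]
    simp)

theorem BQ.modp_mk (x : WittVector p Q) :
    BQ.modp p (BQ.mk p Q π x) = Ideal.Quotient.mk (Ideal.span {π}) (x.coeff 0) := rfl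

theorem BQ.modp_surj : Function.Surjective (BQ.modp p (Q := Q) (π := π)) := by
  intro y
  obtain ⟨y, rfl⟩ := Ideal.Quotient.mk_surjective y
  exact ⟨BQ.mk p Q π (WittVector.teichmuller p y), by
    rw [BQ.modp_mk, WittVector.teichmuller_coeff_zero]⟩

variable [PerfectRing Q p]

theorem BQ.witt_dvd {x y : WittVector p Q} (h : x.coeff 0 = y.coeff 0) :
    ∃ s, x = y + p * s := by
  have h1 : (x - y).coeff 0 = 0 := by
    have := map_sub (WittVector.constantCoeff (p := p) (R := Q)) x y
    simp only [WittVector.constantCoeff_apply] at this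
    rw [this, h, sub_self]
  rw [← WittVector.mem_span_p_iff_coeff_zero_eq_zero, Ideal.mem_span_singleton] at h1
  obtain ⟨s, hs⟩ := h1
  exact ⟨s, by rw [← hs]; ring⟩

theorem BQ.dvd_of_coeff {a : Q} {x : WittVector p Q} (h : a ∣ x.coeff 0) (ha : a ∣ π) :
    BQ.mk p Q π (WittVector.teichmuller p a) ∣ BQ.mk p Q π x := by
  obtain ⟨s, hs⟩ := h
  obtain ⟨b, hb⟩ := ha
  obtain ⟨t, ht⟩ := BQ.witt_dvd p (x := x) (y := WittVector.teichmuller p (a * s)) (by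
    rw [WittVector.teichmuller_coeff_zero, hs])
  rw [ht, map_add, map_mul, map_mul, map_mul, map_natCast, ← BQ.mk_p, hb, map_mul, map_mul]
  exact dvd_add (Dvd.intro _ rfl) (Dvd.intro _ (by rw [mul_assoc]))

theorem BQ.dvd_of_modp {x : BQ p Q π} (h : BQ.modp p x = 0) : (p : BQ p Q π) ∣ x := by
  obtain ⟨x, rfl⟩ := BQ.mk_surj p x
  rw [BQ.modp_mk, Ideal.Quotient.eq_zero_iff_mem, Ideal.mem_span_singleton] at h
  rw [← BQ.mk_p]
  exact BQ.dvd_of_coeff p h dvd_rfl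

theorem BQ.p_nzd (hπ : ∀ b : Q, π * b = 0 → b = 0) {x : BQ p Q π} (h : (p : BQ p Q π) * x = 0) :
    x = 0 := by
  obtain ⟨x, rfl⟩ := BQ.mk_surj p x
  rw [← map_natCast (BQ.mk p Q π), ← map_mul, BQ.mk_eq_zero] at h
  obtain ⟨s, hs⟩ := h
  have h1 : s.coeff 0 = 0 := by
    apply hπ
    have := congrArg WittVector.constantCoeff hs
    simp only [map_mul, map_sub, map_natCast, CharP.cast_eq_zero, zero_mul, zero_sub] at this
    simpa [eq_comm] using this
  obtain ⟨t, ht⟩ := BQ.witt_dvd p (x := s) (y := 0) (by simpa using h1)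
  rw [BQ.mk_eq_zero]
  refine ⟨t, ?_⟩
  rw [← sub_eq_zero]
  apply WittVector.eq_zero_of_p_mul_eq_zero
  rw [ht] at hs
  linear_combination hs

theorem BQ.p_pow_nzd (hπ : ∀ b : Q, π * b = 0 → b = 0) (n : ℕ) {x : BQ p Q π}
    (h : (p : BQ p Q π) ^ n * x = 0) : x = 0 := by
  induction n with
  | zero => simpa using h
  | succ n ih => exact ih (BQ.p_nzd p hπ (by rw [← h]; ring))

theorem BQ.root_closed (hπ : ∀ b : Q, π * b = 0 → b = 0) (m : ℕ) {v : BQ p Q π}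
    (h : (p : BQ p Q π) ^ m ∣ v ^ p) :
    BQ.mk p Q π (WittVector.teichmuller p ((frobeniusEquiv Q p).symm π)) ^ m ∣ v := by
  have hϖ : BQ.mk p Q π (WittVector.teichmuller p ((frobeniusEquiv Q p).symm π)) ^ p = p := by
    rw [← map_pow, ← map_pow, ← frobenius_def, ← frobeniusEquiv_apply, RingEquiv.apply_symm_apply,
      BQ.mk_p]
  induction m generalizing v with
  | zero => simp
  | succ m ih =>
    have h1 : BQ.mk p Q π (WittVector.teichmuller p ((frobeniusEquiv Q p).symm π)) ∣ v := by
      obtain ⟨v, rfl⟩ := BQ.mk_surj p v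
      apply BQ.dvd_of_coeff
      · obtain ⟨t, ht⟩ := h
        have := congrArg (BQ.modp p) ht
        rw [← map_pow, BQ.modp_mk, map_mul, map_pow, ← BQ.mk_p, BQ.modp_mk,
          WittVector.teichmuller_coeff_zero, Ideal.Quotient.eq_zero_iff_mem.2
          (Ideal.mem_span_singleton_self π), zero_pow (Nat.succ_ne_zero m), zero_mul,
          Ideal.Quotient.eq_zero_iff_mem, Ideal.mem_span_singleton] at this
        have h2 := map_dvd (frobeniusEquiv Q p).symm this
        rwa [← WittVector.constantCoeff_apply, map_pow, WittVector.constantCoeff_apply,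
          ← frobenius_def, ← frobeniusEquiv_apply, RingEquiv.symm_apply_apply] at h2
      · refine ⟨(frobeniusEquiv Q p).symm π ^ (p - 1), ?_⟩
        rw [← pow_succ', Nat.sub_add_cancel (Fact.out : p.Prime).one_le, ← frobenius_def,
          ← frobeniusEquiv_apply, RingEquiv.apply_symm_apply]
    obtain ⟨w, rfl⟩ := h1
    rw [pow_succ']
    apply mul_dvd_mul_left
    apply ih
    obtain ⟨t, ht⟩ := h
    refine ⟨t, ?_⟩
    rw [← sub_eq_zero]
    apply BQ.p_nzd p hπ
    rw [mul_pow, hϖ] at ht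
    linear_combination ht

theorem BQ.nilp (hπ : ∀ b : Q, π * b = 0 → b = 0) {v : BQ p Q π} {k : ℕ} (h : v ^ k = 0) (M : ℕ) :
    (p : BQ p Q π) ^ M ∣ v := by
  have hϖ : BQ.mk p Q π (WittVector.teichmuller p ((frobeniusEquiv Q p).symm π)) ^ p = p := by
    rw [← map_pow, ← map_pow, ← frobenius_def, ← frobeniusEquiv_apply, RingEquiv.apply_symm_apply,
      BQ.mk_p]
  have key : ∀ j, ∀ v : BQ p Q π, (∀ M, (p : BQ p Q π) ^ M ∣ v ^ p ^ j) →
      ∀ M, (p : BQ p Q π) ^ M ∣ v := by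
    intro j
    induction j with
    | zero => intro v h; simpa using h
    | succ j ih =>
      intro v h
      apply ih
      intro M
      have := BQ.root_closed p hπ (p * M) (v := v ^ p ^ j) (by rw [← pow_mul, ← pow_succ]; exact h _)
      rwa [pow_mul, hϖ] at this
  refine key k v (fun M => ?_) M
  rw [pow_eq_zero_of_le (Nat.lt_pow_self (Fact.out : p.Prime).one_lt).le h]
  exact dvd_zero _

theorem BQ.eqFlat_map {Q' : Type} [CommRing Q'] [CharP Q' p] [PerfectRing Q' p] {π' : Q'}
    (g : Q →+* Q') (hg : g π = π') (h : EqFlat g π) : EqFlat (BQ.map p g hg) (p : BQ p Q π) := by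
  subst hg
  let g' : Q ⧸ Ideal.span {π} →+* Q' ⧸ Ideal.span {g π} :=
    Ideal.quotientMap _ g (by
      rw [Ideal.span_singleton_le_iff_mem]; exact Ideal.mem_span_singleton_self _)
  have h1 : EqFlat g' 0 := EqFlat.descend (α := Ideal.Quotient.mk _) (β := Ideal.Quotient.mk _)
    Ideal.Quotient.mk_surjective Ideal.Quotient.mk_surjective
    (Ideal.Quotient.eq_zero_iff_mem.2 (Ideal.mem_span_singleton_self π))
    (fun x hx => Ideal.mem_span_singleton.1 (Ideal.Quotient.eq_zero_iff_mem.1 hx))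
    (fun x => rfl) h
  refine EqFlat.lift (α := BQ.modp p) (β := BQ.modp p) (BQ.modp_surj p) (BQ.modp_surj p)
    (fun x hx => BQ.dvd_of_modp p hx) (fun x hx => ?_) ?_ (fun x => ?_) h1
  · rw [map_natCast]; exact BQ.dvd_of_modp p hx
  · rw [map_natCast, ← BQ.mk_p, BQ.modp_mk, WittVector.teichmuller_coeff_zero]
    exact Ideal.Quotient.eq_zero_iff_mem.2 (Ideal.mem_span_singleton_self _)
  · obtain ⟨x, rfl⟩ := BQ.mk_surj p x
    rw [BQ.map_mk, BQ.modp_mk, BQ.modp_mk, WittVector.map_coeff]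
    rfl

end BQ

section
attribute [local instance] MvPolynomial.algebraMvPolynomial

theorem flat_mvMap' (R S : Type) [CommRing R] [CommRing S] [Algebra R S] [Module.Flat R S] :
    (MvPolynomial.map (σ := ℕ) (algebraMap R S)).Flat := by
  have : Module.Flat (MvPolynomial ℕ R) (MvPolynomial ℕ S) :=
    Module.Flat.isBaseChange R (MvPolynomial ℕ R) S (MvPolynomial ℕ S)
      (Algebra.IsPushout.out (R := R) (S := MvPolynomial ℕ R) (R' := S) (S' := MvPolynomial ℕ S))
  exact RingHom.flat_algebraMap_iff.2 this

end

theorem flat_mvMap {R S : Type} [CommRing R] [CommRing S] {f : R →+* S} (hf : f.Flat) :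
    (MvPolynomial.map (σ := ℕ) f).Flat :=
  @flat_mvMap' R S _ _ f.toAlgebra hf

theorem flat_polyEval {C : Type} [CommRing C] (F : Polynomial C) (hF : F.Monic)
    (hd : 0 < F.natDegree) :
    (Polynomial.eval₂RingHom (Polynomial.C : C →+* Polynomial C) F).Flat := by
  set g : Polynomial (Polynomial C) := F.map Polynomial.C - Polynomial.C Polynomial.X with hg
  have hgm : g.Monic := by
    rcases subsingleton_or_nontrivial C with h | h
    · exact Subsingleton.elim _ _
    refine (hF.map Polynomial.C).sub_of_left ?_
    refine lt_of_le_of_lt Polynomial.degree_C_le ?_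
    rw [hF.degree_map, ← Polynomial.natDegree_pos_iff_degree_pos]
    exact hd
  have := hgm.free_adjoinRoot
  have h1 : (AdjoinRoot.of g).Flat := RingHom.flat_algebraMap_iff.2 inferInstance
  let φ : AdjoinRoot g →+* Polynomial C := AdjoinRoot.lift
    (Polynomial.eval₂RingHom (Polynomial.C : C →+* Polynomial C) F) Polynomial.X (by
      simp [hg, Polynomial.eval₂_map])
  let ψ : Polynomial C →+* AdjoinRoot g := Polynomial.eval₂RingHom
    ((AdjoinRoot.of g).comp Polynomial.C) (AdjoinRoot.root g)
  have hφψ : φ.comp ψ = RingHom.id _ := by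
    apply Polynomial.ringHom_ext <;> simp [φ, ψ]
  have hFr : F.eval₂ ((AdjoinRoot.of g).comp Polynomial.C) (AdjoinRoot.root g) =
      AdjoinRoot.of g Polynomial.X := by
    have := AdjoinRoot.eval₂_root g
    rw [hg, Polynomial.eval₂_sub, Polynomial.eval₂_map, sub_eq_zero, Polynomial.eval₂_C] at this
    exact this
  have hψφ : ψ.comp φ = RingHom.id _ := by
    apply AdjoinRoot.ringHom_ext
    · apply Polynomial.ringHom_ext
      · intro a; simp [φ, ψ]
      · simp [φ, ψ, hFr]
    · simp [φ, ψ]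
  have hb : Function.Bijective φ := ⟨fun x y h => by
      have := congrArg ψ h
      rwa [← RingHom.comp_apply, ← RingHom.comp_apply, hψφ] at this,
    fun y => ⟨ψ y, by rw [← RingHom.comp_apply, hφψ]; rfl⟩⟩
  have := RingHom.Flat.comp h1 (RingHom.Flat.of_bijective hb)
  convert this
  apply Polynomial.ringHom_ext <;> simp [φ]

theorem EqFlat.of_dual {A B : Type} [CommRing A] [CommRing B] (f : A →+* B) {ρ : Type}
    (e : ρ → B) (E : ρ → B →+ A) (hE : ∀ r a b, E r (f a * b) = a * E r b)
    (hy : ∀ y, ∃ s : Finset ρ, ∀ s', s ⊆ s' → y = ∑ r ∈ s', e r * f (E r y)) (a : A) :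
    EqFlat f a := by
  classical
  intro ι _ x y ⟨t, ht⟩
  choose s hs using hy
  refine ⟨(Finset.univ.biUnion fun i => s (y i) : Finset ρ), inferInstance,
    fun r i => E r.1 (y i), fun r => e r.1, fun r => ⟨E r.1 t, ?_⟩, fun i => ?_⟩
  · have := congrArg (E r.1) ht
    simpa [map_sum, hE] using this
  · rw [Finset.sum_coe_sort (Finset.univ.biUnion fun i => s (y i))
      (fun r => e r * f (E r (y i)))]
    exact hs _ _ (Finset.subset_biUnion_of_mem (fun i => s (y i)) (Finset.mem_univ i))


/-- Extraction of coefficients in a residue class. -/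
noncomputable def expandE (D : Type) [CommRing D] (p : ℕ) (hp : 0 < p) (r : ℕ →₀ ℕ) :
    MvPolynomial ℕ D →+ MvPolynomial ℕ D :=
  AddMonoidHom.mk' (fun y => (AddMonoidAlgebra.ofCoeff <| Finsupp.comapDomain
    (fun m : ℕ →₀ ℕ => p • m + r) (AddMonoidAlgebra.coeff y)
    (fun m _ m' _ h => by
      have h1 : p • m = p • m' := add_right_cancel h
      ext i
      have := DFunLike.congr_fun h1 i
      simpa [hp.ne'] using this) : MvPolynomial ℕ D)) (fun a b => by
    ext m; rfl)

theorem coeff_expandE (D : Type) [CommRing D] (p : ℕ) (hp : 0 < p) (r : ℕ →₀ ℕ)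
    (y : MvPolynomial ℕ D) (m : ℕ →₀ ℕ) :
    (expandE D p hp r y).coeff m = y.coeff (p • m + r) := rfl

theorem eqFlat_expand (D : Type) [CommRing D] (p : ℕ) (hp : 0 < p) (a : MvPolynomial ℕ D) :
    EqFlat (MvPolynomial.expand p : MvPolynomial ℕ D →ₐ[D] MvPolynomial ℕ D).toRingHom a := by
  classical
  refine EqFlat.of_dual _ (ρ := {r : ℕ →₀ ℕ // ∀ i, r i < p})
    (fun r => MvPolynomial.monomial r.1 1) (fun r => expandE D p hp r.1) ?_ ?_ a
  · rintro ⟨r, hr⟩ a b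
    change expandE D p hp r (MvPolynomial.expand p a * b) = a * expandE D p hp r b
    induction a using MvPolynomial.induction_on' with
    | monomial n c =>
      ext m
      rw [coeff_expandE, MvPolynomial.expand_monomial, MvPolynomial.coeff_monomial_mul',
        MvPolynomial.coeff_monomial_mul', coeff_expandE]
      have h1 : p • n ≤ p • m + r ↔ n ≤ m := by
        constructor
        · intro h i
          have := h i
          simp only [Finsupp.smul_apply, Finsupp.add_apply, smul_eq_mul] at this
          have h2 : p * n i < p * (m i + 1) := by have := hr i; rw [mul_add]; omega
          have := Nat.lt_of_mul_lt_mul_left h2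
          omega
        · intro h i
          simp only [Finsupp.smul_apply, Finsupp.add_apply, smul_eq_mul]
          exact le_trans (Nat.mul_le_mul_left p (h i)) (Nat.le_add_right _ _)
      simp only [h1]
      split_ifs with h
      · congr 2
        ext i
        have h2 := Nat.mul_le_mul_left p (h i)
        simp only [Finsupp.smul_apply, Finsupp.add_apply, smul_eq_mul, Finsupp.tsub_apply,
          Nat.mul_sub]
        omega
      · rfl
    | add a b ha hb => rw [map_add, add_mul, map_add, ha, hb, add_mul]
  · intro y
    change ∃ s : Finset {r : ℕ →₀ ℕ // ∀ i, r i < p}, ∀ s', s ⊆ s' →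
      y = ∑ r ∈ s', MvPolynomial.monomial r.1 1 * MvPolynomial.expand p (expandE D p hp r.1 y)
    induction y using MvPolynomial.induction_on' with
    | monomial n c =>
      let r0 : {r : ℕ →₀ ℕ // ∀ i, r i < p} :=
        ⟨n.mapRange (fun t => t % p) (by simp), fun i => Nat.mod_lt (n i) hp⟩
      let q0 : ℕ →₀ ℕ := n.mapRange (fun t => t / p) (by simp)
      have hn : p • q0 + r0.1 = n := by
        ext i
        exact Nat.div_add_mod _ _
      have hu : ∀ (r : {r : ℕ →₀ ℕ // ∀ i, r i < p}) m, n = p • m + r.1 → r = r0 ∧ m = q0 := by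
        rintro ⟨r, hr⟩ m h
        constructor
        · apply Subtype.ext
          ext i
          change r i = n i % p
          rw [h, Finsupp.add_apply, Finsupp.smul_apply, smul_eq_mul, Nat.mul_add_mod,
            Nat.mod_eq_of_lt (hr i)]
        · ext i
          change m i = n i / p
          rw [h, Finsupp.add_apply, Finsupp.smul_apply, smul_eq_mul, Nat.mul_add_div hp, Nat.div_eq_of_lt (hr i), add_zero]
      refine ⟨{r0}, fun s' hs' => ?_⟩
      rw [Finset.sum_eq_single_of_mem r0 (hs' (Finset.mem_singleton_self _))]
      · have : expandE D p hp r0.1 (MvPolynomial.monomial n c) = MvPolynomial.monomial q0 c := by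
          ext m
          rw [coeff_expandE, MvPolynomial.coeff_monomial, MvPolynomial.coeff_monomial]
          by_cases h : n = p • m + r0.1
          · rw [if_pos h, if_pos (hu _ _ h).2.symm]
          · rw [if_neg h, if_neg]
            rintro rfl
            exact h hn.symm
        rw [this, MvPolynomial.expand_monomial, MvPolynomial.monomial_mul, add_comm, hn, one_mul]
      · intro r _ hr
        have : expandE D p hp r.1 (MvPolynomial.monomial n c) = 0 := by
          ext m
          rw [coeff_expandE, MvPolynomial.coeff_monomial, if_neg, MvPolynomial.coeff_zero]
          exact fun h => hr (hu _ _ h).1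
        rw [this, map_zero, mul_zero]
    | add a b ha hb =>
      obtain ⟨s, hs⟩ := ha
      obtain ⟨t, ht⟩ := hb
      refine ⟨s ∪ t, fun s' hs' => ?_⟩
      simp only [map_add, mul_add, Finset.sum_add_distrib]
      rw [← hs s' (Finset.union_subset_left hs'), ← ht s' (Finset.union_subset_right hs')]

section Rel
variable (p : ℕ) [Fact p.Prime] {Q : Type} [CommRing Q]

/-- Structure map. -/
noncomputable def jP (Q : Type) [CommRing Q] : Q →+* MvPolynomial ℕ (Polynomial Q) :=
  MvPolynomial.C.comp Polynomial.C

/-- Value of a polynomial at `[T]`. -/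
noncomputable def FT (F : Polynomial (WittVector p Q)) :
    WittVector p (MvPolynomial ℕ (Polynomial Q)) :=
  F.eval₂ (WittVector.map (jP Q)) (WittVector.teichmuller p (MvPolynomial.C Polynomial.X))

/-- Generic Witt vector. -/
noncomputable def zzW (Q : Type) [CommRing Q] : WittVector p (MvPolynomial ℕ (Polynomial Q)) :=
  WittVector.mk p MvPolynomial.X

/-- Relations. -/
noncomputable def relW (π : Q) (F : Polynomial (WittVector p Q)) (i : ℕ) :
    MvPolynomial ℕ (Polynomial Q) :=
  (FT p F + WittVector.teichmuller p (jP Q π) * zzW p Q).coeff i - (zzW p Q * p).coeff i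

/-- Relations, indexed by options. -/
noncomputable def relO (π : Q) (F : Polynomial (WittVector p Q)) (o : Option ℕ) :
    MvPolynomial ℕ (Polynomial Q) := o.elim (relW p π F 0) fun i => relW p π F (i + 1)

/-- The map whose special fibre is the quotient. -/
noncomputable def PhiW (π : Q) (F : Polynomial (WittVector p Q)) :
    MvPolynomial (Option ℕ) Q →+* MvPolynomial ℕ (Polynomial Q) :=
  MvPolynomial.eval₂Hom (jP Q) (relO p π F)

theorem eqFlat_PhiW_aux [CharP Q p] (π : Q) (F : Polynomial (WittVector p Q)) (hF : F.Monic)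
    (hd : 0 < F.natDegree) {C : Type} [CommRing C] (mk : Q →+* C)
    (hmk : Function.Surjective mk) (hmkπ : mk π = 0) (hker : RingHom.ker mk = Ideal.span {π}) :
    EqFlat (PhiW p π F) (MvPolynomial.C π) := by
  let β : MvPolynomial ℕ (Polynomial Q) →+* MvPolynomial ℕ (Polynomial C) :=
    MvPolynomial.map (Polynomial.mapRingHom mk)
  let a : WittVector p (Polynomial C) := F.eval₂ (WittVector.map (Polynomial.C.comp mk))
    (WittVector.teichmuller p Polynomial.X)
  have hβj : β.comp (jP Q) = (MvPolynomial.C.comp Polynomial.C).comp mk := by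
    ext x; simp [β, jP]
  have hFT : WittVector.map β (FT p F) = WittVector.map MvPolynomial.C a := by
    simp only [FT, a, Polynomial.hom_eval₂]
    congr 1
    · ext x i
      simp [WittVector.map_coeff, β, jP]
    · simp [WittVector.map_teichmuller, β]
  have hrel : ∀ i, β (relW p π F i) = MvPolynomial.C (a.coeff i) -
      β ((zzW p Q * p).coeff i) := by
    intro i
    have hb : ∀ x : WittVector p (MvPolynomial ℕ (Polynomial Q)),
        β (x.coeff i) = (WittVector.map β x).coeff i := fun _ => rfl
    rw [relW, map_sub, hb, map_add, map_mul, WittVector.map_teichmuller, hFT]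
    have : β (jP Q π) = 0 := by
      rw [← RingHom.comp_apply, hβj]; simp [hmkπ]
    rw [this, WittVector.teichmuller_zero, zero_mul, add_zero, WittVector.map_coeff]
  have hrel0 : β (relW p π F 0) = MvPolynomial.C (a.coeff 0) := by
    rw [hrel, WittVector.mul_charP_coeff_zero]; simp
  have hrel1 : ∀ i, β (relW p π F (i + 1)) =
      MvPolynomial.C (a.coeff (i + 1)) - MvPolynomial.X i ^ p := by
    intro i
    rw [hrel, WittVector.mul_charP_coeff_succ, map_pow]
    simp [zzW, β]
  have ha0 : a.coeff 0 = (F.map WittVector.constantCoeff).map mk := by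
    rw [← WittVector.constantCoeff_apply]
    simp only [a, Polynomial.hom_eval₂, WittVector.constantCoeff_apply,
      WittVector.teichmuller_coeff_zero]
    rw [Polynomial.map_map, ← Polynomial.eval₂_C_X (p := F.map _), Polynomial.eval₂_map]
    congr 1
  let θ : MvPolynomial ℕ (Polynomial C) →ₐ[Polynomial C] MvPolynomial ℕ (Polynomial C) :=
    MvPolynomial.aeval fun i => MvPolynomial.C (a.coeff (i + 1)) - MvPolynomial.X i
  have hθθ : θ.comp θ = AlgHom.id _ _ := by
    ext i; simp [θ]
  have hθ : Function.Bijective θ.toRingHom := by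
    have : ∀ x, θ (θ x) = x := fun x => DFunLike.congr_fun hθθ x
    exact (Function.Involutive.bijective this)
  have hd' : Subsingleton C ∨ 0 < ((F.map WittVector.constantCoeff).map mk).natDegree := by
    rcases subsingleton_or_nontrivial C with h | h
    · exact Or.inl h
    · right
      rw [Polynomial.map_map, hF.natDegree_map]; exact hd
  have hψ : (Polynomial.eval₂RingHom (Polynomial.C : C →+* Polynomial C) (a.coeff 0)).Flat := by
    rcases hd' with h | h
    · exact RingHom.Flat.of_bijective ⟨fun x y _ => Subsingleton.elim _ _,
        fun y => ⟨0, Subsingleton.elim _ _⟩⟩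
    · rw [ha0]
      exact flat_polyEval _ ((hF.map _).map _) h
  let Φ' : MvPolynomial (Option ℕ) C →+* MvPolynomial ℕ (Polynomial C) :=
    (MvPolynomial.expand p : _ →ₐ[Polynomial C] _).toRingHom.comp (θ.toRingHom.comp
      ((MvPolynomial.map (Polynomial.eval₂RingHom (Polynomial.C : C →+* Polynomial C)
        (a.coeff 0))).comp (MvPolynomial.optionEquivRight C ℕ).toRingEquiv.toRingHom))
  have hΦ' : EqFlat Φ' (0 : MvPolynomial (Option ℕ) C) := by
    refine EqFlat.comp ?_ (eqFlat_expand _ p (Fact.out : p.Prime).pos _)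
    apply EqFlat.of_flat
    refine RingHom.Flat.comp (RingHom.Flat.comp (RingHom.Flat.of_bijective
      (MvPolynomial.optionEquivRight C ℕ).bijective) (flat_mvMap hψ))
      (RingHom.Flat.of_bijective hθ)
  have hc : Φ'.comp (MvPolynomial.map mk) = β.comp (PhiW p π F) := by
    apply MvPolynomial.ringHom_ext
    · intro x
      simp [Φ', PhiW, β, jP, MvPolynomial.optionEquivRight_C]
    · rintro (_ | i)
      · simp [Φ', PhiW, relO, hrel0, MvPolynomial.optionEquivRight_X_none]
      · simp [Φ', PhiW, relO, hrel1, MvPolynomial.optionEquivRight_X_some, θ]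
  have hPhiC : PhiW p π F (MvPolynomial.C π) = MvPolynomial.C (Polynomial.C π) := by
    simp [PhiW, jP]
  refine EqFlat.lift (α := MvPolynomial.map mk) (β := β) (MvPolynomial.map_surjective _ hmk)
    (MvPolynomial.map_surjective _ (Polynomial.map_surjective _ hmk)) ?_ ?_ ?_
    (fun x => RingHom.congr_fun hc x) hΦ'
  · intro x hx
    rw [← RingHom.mem_ker, MvPolynomial.ker_map, hker, Ideal.map_span,
      Set.image_singleton, Ideal.mem_span_singleton] at hx
    exact hx
  · intro x hx
    rw [hPhiC]
    rw [← RingHom.mem_ker, MvPolynomial.ker_map, Polynomial.ker_mapRingHom, hker,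
      Ideal.map_span, Set.image_singleton, Ideal.map_span, Set.image_singleton,
      Ideal.mem_span_singleton] at hx
    exact hx
  · rw [hPhiC]; simp [β, hmkπ]

theorem eqFlat_PhiW [CharP Q p] (π : Q) (F : Polynomial (WittVector p Q)) (hF : F.Monic)
    (hd : 0 < F.natDegree) : EqFlat (PhiW p π F) (MvPolynomial.C π) :=
  eqFlat_PhiW_aux p π F hF hd (Ideal.Quotient.mk (Ideal.span {π})) Ideal.Quotient.mk_surjective
    (Ideal.Quotient.eq_zero_iff_mem.2 (Ideal.mem_span_singleton_self _)) Ideal.mk_ker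

end Rel

theorem perf_inj (p : ℕ) [Fact p.Prime] {Q : Type} [CommRing Q] [CharP Q p] [PerfectRing Q p]
    (n : ℕ) {a b : Q} (h : a ^ p ^ n = b ^ p ^ n) : a = b := by
  rw [← iterateFrobenius_def, ← iterateFrobenius_def] at h
  exact (bijective_iterateFrobenius Q p n).injective h

theorem perf_surj (p : ℕ) [Fact p.Prime] {Q : Type} [CommRing Q] [CharP Q p] [PerfectRing Q p]
    (n : ℕ) (a : Q) : ∃ b : Q, b ^ p ^ n = a := by
  obtain ⟨b, hb⟩ := (bijective_iterateFrobenius Q p n).surjective a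
  exact ⟨b, by rw [← hb, iterateFrobenius_def]⟩

theorem nzd_pow {A : Type} [CommRing A] {a : A} (ha : ∀ b, a * b = 0 → b = 0) (N : ℕ) :
    ∀ b, a ^ N * b = 0 → b = 0 := by
  induction N with
  | zero => intro b; simp
  | succ N ih => intro b hb; exact ha _ (ih _ (by rw [← hb]; ring))

theorem pow_level (p : ℕ) {Q2 Q' : Type} [CommRing Q2] [CommRing Q'] (h : Q2 →+* Q') {x : Q'} {n m : ℕ} {y : Q2} (hnm : n ≤ m) (hy : h y = x ^ p ^ n) :
    h (y ^ p ^ (m - n)) = x ^ p ^ m := by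
  rw [map_pow, hy, ← pow_mul, ← pow_add]
  congr 2; omega

theorem ker_level (p : ℕ) {Q2 Q' : Type} [CommRing Q2] [CommRing Q'] (h : Q2 →+* Q')
    [IsPRadical h p] {y : Q2} (hy : h y = 0) : ∃ n, y ^ p ^ n = 0 :=
  (mem_pNilradical).1 (IsPRadical.ker_le h p ((RingHom.mem_ker).2 hy))

theorem nzd_perf (p : ℕ) [Fact p.Prime] {Q Q2 Q' : Type} [CommRing Q] [CharP Q p] [PerfectRing Q p]
    [CommRing Q2] [CharP Q2 p] [CommRing Q'] [CharP Q' p] [PerfectRing Q' p]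
    (g : Q →+* Q2) (h : Q2 →+* Q') [IsPRadical h p] {π : Q} (hπ : ∀ b, g π * b = 0 → b = 0) (b : Q') (hb : h (g π) * b = 0) : b = 0 := by
  obtain ⟨n, y, hy⟩ := IsPRadical.pow_mem h p b
  have h1 : h (g π ^ p ^ n * y) = 0 := by
    rw [map_mul, map_pow, hy, ← mul_pow, hb, zero_pow (pow_ne_zero _ (Fact.out : p.Prime).ne_zero)]
  obtain ⟨k, hk⟩ := ker_level p h h1
  rw [mul_pow, ← pow_mul] at hk
  have h2 := nzd_pow hπ _ _ hk
  have h3 : b ^ p ^ (n + k) = 0 := by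
    rw [pow_add, pow_mul, ← hy, ← map_pow, h2, map_zero]
  exact perf_inj p (n + k) (by rw [h3, zero_pow (pow_ne_zero _ (Fact.out : p.Prime).ne_zero)])

theorem common_level (p : ℕ) {Q2 Q' : Type} [CommRing Q2] [CommRing Q'] (h : Q2 →+* Q')
    [IsPRadical h p] {ι : Type} [Fintype ι] (y : ι → Q') :
    ∃ n0, ∀ n, n0 ≤ n → ∃ z : ι → Q2, ∀ i, h (z i) = y i ^ p ^ n := by
  choose m z hz using fun i => IsPRadical.pow_mem h p (y i)
  refine ⟨Finset.univ.sup m, fun n hn => ⟨fun i => z i ^ p ^ (n - m i), fun i => ?_⟩⟩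
  exact pow_level p h ((Finset.le_sup (Finset.mem_univ i)).trans hn) (hz i)

theorem eqFlat_perf (p : ℕ) [Fact p.Prime] {Q Q2 Q' : Type} [CommRing Q] [CharP Q p] [PerfectRing Q p]
    [CommRing Q2] [CharP Q2 p] [CommRing Q'] [CharP Q' p] [PerfectRing Q' p]
    (g : Q →+* Q2) (h : Q2 →+* Q') [IsPRadical h p] {π : Q} (hπ : ∀ b, g π * b = 0 → b = 0) (hg : EqFlat g π) :
    EqFlat (h.comp g) π := by
  intro ι _ x y hxy
  obtain ⟨t, ht⟩ := hxy
  obtain ⟨n0, hn0⟩ := common_level p h (fun o : Option ι => o.elim t y)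
  obtain ⟨z, hz⟩ := hn0 n0 le_rfl
  have hz1 : ∀ i, h (z (some i)) = y i ^ p ^ n0 := fun i => hz (some i)
  have hz0 : h (z none) = t ^ p ^ n0 := hz none
  have h1 : h (∑ i, g (x i ^ p ^ n0) * z (some i) - g (π ^ p ^ n0) * z none) = 0 := by
    have : (∑ i, h.comp g (x i) * y i) ^ p ^ n0 = ∑ i, (h.comp g (x i) * y i) ^ p ^ n0 := by
      rw [sum_pow_char_pow]
    rw [map_sub, map_sum, sub_eq_zero, map_mul, hz0]
    simp only [map_mul, hz1, map_pow]
    rw [← mul_pow, show h (g π) = h.comp g π from rfl, ← ht, this]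
    simp only [mul_pow]; rfl
  obtain ⟨k, hk⟩ := ker_level p h h1
  rw [sub_pow_char_pow, sub_eq_zero, sum_pow_char_pow] at hk
  obtain ⟨κ, hκ, b, w, hb, hw⟩ := hg.pow hπ (p ^ (n0 + k)) ι (fun i => x i ^ p ^ (n0 + k))
    (fun i => z (some i) ^ p ^ k) ⟨z none ^ p ^ k, by
      simp only [mul_pow, ← map_pow, ← pow_mul, ← pow_add] at hk ⊢
      exact hk⟩
  choose b' hb' using fun j i => perf_surj p (n0 + k) (b j i)
  choose w' hw' using fun j => perf_surj p (n0 + k) (h (w j))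
  refine ⟨κ, hκ, b', w', fun j => ?_, fun i => ?_⟩
  · obtain ⟨c, hc⟩ := hb j
    obtain ⟨c', hc'⟩ := perf_surj p (n0 + k) c
    refine ⟨c', perf_inj p (n0 + k) ?_⟩
    rw [sum_pow_char_pow, mul_pow, hc', ← hc]
    exact Finset.sum_congr rfl fun i _ => by rw [mul_pow, hb']
  · apply perf_inj p (n0 + k)
    rw [sum_pow_char_pow, pow_add, pow_mul, ← hz1, ← map_pow, hw i, map_sum]
    refine Finset.sum_congr rfl fun j _ => ?_
    rw [← pow_add, mul_pow, hw', ← map_pow, hb', map_mul]; rfl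


section Q2
variable (p : ℕ) [Fact p.Prime] {Q : Type} [CommRing Q]

/-- The extension ring before perfection. -/
def Q2 (π : Q) (F : Polynomial (WittVector p Q)) : Type :=
  MvPolynomial ℕ (Polynomial Q) ⧸ Ideal.span (Set.range (relO p π F))

noncomputable instance (π : Q) (F : Polynomial (WittVector p Q)) : CommRing (Q2 p π F) :=
  inferInstanceAs (CommRing (MvPolynomial ℕ (Polynomial Q) ⧸ Ideal.span (Set.range (relO p π F))))

/-- The projection. -/
noncomputable def Q2.mk (π : Q) (F : Polynomial (WittVector p Q)) :
    MvPolynomial ℕ (Polynomial Q) →+* Q2 p π F :=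
  Ideal.Quotient.mk (Ideal.span (Set.range (relO p π F)))

theorem Q2.mk_surj (π : Q) (F : Polynomial (WittVector p Q)) :
    Function.Surjective (Q2.mk p π F) := Ideal.Quotient.mk_surjective

theorem Q2.ker (π : Q) (F : Polynomial (WittVector p Q)) (x) :
    Q2.mk p π F x = 0 ↔ x ∈ Ideal.span (Set.range (relO p π F)) :=
  Ideal.Quotient.eq_zero_iff_mem

theorem Q2.mk_Phi (π : Q) (F : Polynomial (WittVector p Q)) (x) :
    Q2.mk p π F (PhiW p π F x) = Q2.mk p π F (jP Q (MvPolynomial.constantCoeff x)) := by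
  have : (Q2.mk p π F).comp (PhiW p π F) =
      ((Q2.mk p π F).comp (jP Q)).comp MvPolynomial.constantCoeff := by
    apply MvPolynomial.ringHom_ext
    · intro r; simp [PhiW]
    · intro i
      simp only [RingHom.comp_apply, PhiW, MvPolynomial.constantCoeff_X, map_zero]
      rw [Q2.ker]; simp only [MvPolynomial.coe_eval₂Hom, MvPolynomial.eval₂_X]
      exact Ideal.subset_span ⟨i, rfl⟩
  exact RingHom.congr_fun this x

/-- Lift. -/
noncomputable def Q2.lift (π : Q) (F : Polynomial (WittVector p Q)) {L : Type} [CommRing L]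
    (g : MvPolynomial ℕ (Polynomial Q) →+* L) (hg : ∀ o, g (relO p π F o) = 0) :
    Q2 p π F →+* L :=
  Ideal.Quotient.lift _ g (by
    intro a ha
    have : Ideal.span (Set.range (relO p π F)) ≤ RingHom.ker g := by
      rw [Ideal.span_le]; rintro _ ⟨o, rfl⟩; exact hg o
    exact this ha)

theorem Q2.lift_mk (π : Q) (F : Polynomial (WittVector p Q)) {L : Type} [CommRing L]
    (g : MvPolynomial ℕ (Polynomial Q) →+* L) (hg : ∀ o, g (relO p π F o) = 0) (x) :
    Q2.lift p π F g hg (Q2.mk p π F x) = g x := rfl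

/-- expression of span membership as a finite sum -/
theorem mem_span_range_sum {A : Type} [CommRing A] {ι : Type} (r : ι → A) {x : A}
    (hx : x ∈ Ideal.span (Set.range r)) :
    ∃ (s : Finset ι) (m : s → A), x = ∑ i : s, r i * m i := by
  obtain ⟨c, hc⟩ := (Finsupp.mem_ideal_span_range_iff_exists_finsupp).1 hx
  refine ⟨c.support, fun i => c i, ?_⟩
  rw [← hc, Finsupp.sum, ← Finset.sum_coe_sort c.support (fun i => c i * r i)]
  exact Finset.sum_congr rfl fun i _ => mul_comm _ _

variable [CharP Q p]

theorem Q2.nzd (π : Q) (hπ : ∀ b, π * b = 0 → b = 0) (F : Polynomial (WittVector p Q))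
    (hF : F.Monic) (hd : 0 < F.natDegree) (b : Q2 p π F)
    (hb : Q2.mk p π F (jP Q π) * b = 0) : b = 0 := by
  obtain ⟨x, rfl⟩ := Q2.mk_surj p π F b
  rw [← map_mul, Q2.ker] at hb
  obtain ⟨s, m, hm⟩ := mem_span_range_sum _ hb
  have hPhi : ∀ o, PhiW p π F (MvPolynomial.X o) = relO p π F o := by
    intro o; simp [PhiW]
  have hPhiC : PhiW p π F (MvPolynomial.C π) = jP Q π := by simp [PhiW]
  have hP : ∀ b, jP Q π * b = 0 → b = 0 := by
    intro b hb
    ext i j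
    have := congrArg (fun c => (MvPolynomial.coeff i c).coeff j) hb
    simp only [jP, RingHom.comp_apply, MvPolynomial.coeff_C_mul, Polynomial.coeff_C_mul] at this
    exact hπ _ (by simpa using this)
  obtain ⟨κ, hκ, c, w, hc, hw⟩ := eqFlat_PhiW p π F hF hd s (fun i => MvPolynomial.X i) m
    ⟨x, by simp only [hPhi, hPhiC]; exact hm.symm⟩
  choose e he using hc
  have hx : x = ∑ j, w j * PhiW p π F (e j) := by
    have : jP Q π * (x - ∑ j, w j * PhiW p π F (e j)) = 0 := by
      rw [mul_sub, sub_eq_zero, hm]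
      simp only [hw, Finset.mul_sum]
      rw [Finset.sum_comm]
      refine Finset.sum_congr rfl fun j _ => ?_
      rw [mul_left_comm, ← hPhiC, ← map_mul, ← he, map_sum, Finset.mul_sum]
      refine Finset.sum_congr rfl fun i _ => ?_
      rw [map_mul, hPhi]; ring
    exact sub_eq_zero.1 (hP _ this)
  rw [hx, map_sum]
  refine Finset.sum_eq_zero fun j _ => ?_
  rw [map_mul, Q2.mk_Phi]
  have : π * MvPolynomial.constantCoeff (e j) = 0 := by
    have h2 := congrArg MvPolynomial.constantCoeff (he j)
    simp only [map_sum, map_mul, MvPolynomial.constantCoeff_X, zero_mul,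
      Finset.sum_const_zero, MvPolynomial.constantCoeff_C] at h2
    exact h2.symm
  rw [hπ _ this]; simp

theorem Q2.eqFlat (π : Q) (F : Polynomial (WittVector p Q))
    (hF : F.Monic) (hd : 0 < F.natDegree) : EqFlat ((Q2.mk p π F).comp (jP Q)) π := by
  intro ι _ x y hxy
  obtain ⟨t, ht⟩ := hxy
  choose y' hy' using fun i => Q2.mk_surj p π F (y i)
  obtain ⟨t', rfl⟩ := Q2.mk_surj p π F t
  have h1 : Q2.mk p π F (jP Q π * t' - ∑ i, jP Q (x i) * y' i) = 0 := by
    rw [map_sub, map_mul, map_sum, sub_eq_zero]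
    simp only [map_mul, hy']; exact ht.symm
  rw [Q2.ker] at h1
  obtain ⟨s, m, hm⟩ := mem_span_range_sum _ h1
  have hPhi : ∀ o, PhiW p π F (MvPolynomial.X o) = relO p π F o := by
    intro o; simp [PhiW]
  have hPhiC : ∀ a, PhiW p π F (MvPolynomial.C a) = jP Q a := by intro a; simp [PhiW]
  obtain ⟨κ, hκ, c, w, hc, hw⟩ := eqFlat_PhiW p π F hF hd (ι ⊕ s)
    (Sum.elim (fun i => MvPolynomial.C (x i)) (fun i => MvPolynomial.X i)) (Sum.elim y' m)
    ⟨t', by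
      simp only [Fintype.sum_sum_type, Sum.elim_inl, Sum.elim_inr, hPhi, hPhiC]
      rw [← hm]; ring⟩
  refine ⟨κ, hκ, fun j i => MvPolynomial.constantCoeff (c j (Sum.inl i)),
    fun j => Q2.mk p π F (w j), fun j => ?_, fun i => ?_⟩
  · obtain ⟨e, he⟩ := hc j
    refine ⟨MvPolynomial.constantCoeff e, ?_⟩
    have h2 := congrArg MvPolynomial.constantCoeff he
    simpa [Fintype.sum_sum_type] using h2
  · have := hw (Sum.inl i)
    rw [← hy']
    simp only [Sum.elim_inl] at this
    rw [this, map_sum]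
    refine Finset.sum_congr rfl fun j _ => ?_
    rw [map_mul, Q2.mk_Phi]; rfl

end Q2

/-- The basic setup: `O` is root closed, `S` its `p`-adic completion. -/
structure PS (p : ℕ) {O S : Type} [CommRing O] [CommRing S] (i : O →+* S) (ϖ : ℕ → O) : Prop where
  hroot : ∀ x : O, ∃ y, y ^ p = x
  hnorm : ∀ (a b : O) (n : ℕ), 0 < n → a ^ n ∣ b ^ n → a ∣ b
  hp0 : (p : O) ≠ 0
  hinj : ∀ M x, (p : S) ^ M ∣ i x → (p : O) ^ M ∣ x
  hdense : ∀ (M : ℕ) (s : S), ∃ x t, s = i x + p ^ M * t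
  h0 : ϖ 0 = p
  h1 : ∀ n, ϖ (n + 1) ^ p = ϖ n

theorem haus_p {S : Type} [CommRing S] (p : ℕ) [IsAdicComplete (Ideal.span {(p : S)}) S] {s : S}
    (h : ∀ M : ℕ, (p : S) ^ M ∣ s) : s = 0 := by
  apply IsHausdorff.haus (I := Ideal.span {(p : S)}) inferInstance
  intro n
  rw [SModEq.zero, smul_eq_mul, Ideal.mul_top, Ideal.span_singleton_pow, Ideal.mem_span_singleton]
  exact h n

theorem prec_p {S : Type} [CommRing S] (p : ℕ) [IsAdicComplete (Ideal.span {(p : S)}) S]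
    (y : ℕ → S) : ∃ s : S, ∀ M : ℕ, (p : S) ^ M ∣ s - ∑ i ∈ Finset.range M, p ^ i * y i := by
  obtain ⟨L, hL⟩ := IsPrecomplete.prec' (I := Ideal.span {(p : S)})
    (fun M => ∑ i ∈ Finset.range M, (p : S) ^ i * y i) (by
      intro m n hmn
      rw [SModEq.sub_mem, smul_eq_mul, Ideal.mul_top, Ideal.span_singleton_pow,
        Ideal.mem_span_singleton]
      rw [← Finset.sum_range_add_sum_Ico _ hmn, sub_add_cancel_left, dvd_neg]
      refine Finset.dvd_sum fun k hk => ?_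
      exact (pow_dvd_pow _ (Finset.mem_Ico.1 hk).1).mul_right _)
  refine ⟨L, fun M => ?_⟩
  have := hL M
  rw [SModEq.sub_mem, smul_eq_mul, Ideal.mul_top, Ideal.span_singleton_pow,
        Ideal.mem_span_singleton] at this
  rwa [dvd_sub_comm]

section tilt
variable {p : ℕ} [Fact p.Prime] {O S : Type} [CommRing O] [IsDomain O] [CommRing S]
  [Fact ¬IsUnit (p : S)] [IsAdicComplete (Ideal.span {(p : S)}) S]
  {i : O →+* S} {ϖ : ℕ → O}

theorem PS.nzd (hS : PS p i ϖ) (s : S) (hs : (p : S) * s = 0) : s = 0 := by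
  apply haus_p p
  intro M
  obtain ⟨x, t, rfl⟩ := hS.hdense M s
  have h1 : (p : S) ^ (M + 1) ∣ i (p * x) := ⟨-t, by
    rw [map_mul, map_natCast]; linear_combination hs⟩
  have h2 := hS.hinj _ _ h1
  rw [pow_succ', mul_dvd_mul_iff_left hS.hp0] at h2
  exact dvd_add (by simpa using map_dvd i h2) (dvd_mul_right _ _)

/-- Elements of the tilt from approximately compatible sequences. -/
def tlt (a : ℕ → S) (ha : ∀ n, (p : S) ∣ a (n + 1) ^ p - a n) : PreTilt S p :=
  ⟨fun n => Ideal.Quotient.mk (Ideal.span {(p : S)}) (a n), fun n => by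
    rw [← map_pow]
    exact (Ideal.Quotient.eq).2 (Ideal.mem_span_singleton.2 (ha n))⟩

theorem coeff_tlt (a : ℕ → S) (ha : ∀ n, (p : S) ∣ a (n + 1) ^ p - a n) (n : ℕ) :
    PreTilt.coeff n (tlt a ha) = Ideal.Quotient.mk (Ideal.span {(p : S)}) (a n) := rfl

theorem tilt_ext {x y : PreTilt S p} (h : ∀ n, PreTilt.coeff n x = PreTilt.coeff n y) : x = y :=
  Perfection.ext h

theorem untilt_eq (x : PreTilt S p) (a : ℕ → S) (ha : ∀ n, a (n + 1) ^ p = a n)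
    (hx : ∀ n, PreTilt.coeff n x = Ideal.Quotient.mk (Ideal.span {(p : S)}) (a n)) :
    x.untilt = a 0 := by
  rw [← sub_eq_zero]
  apply haus_p p
  intro n
  have h0 : a n ^ p ^ n = a 0 := by
    induction n with
    | zero => simp
    | succ n ih => rw [pow_succ', pow_mul, ha, ih]
  rw [← PreTilt.untilt_iterate_frobeniusEquiv_symm_pow x n, ← h0]
  refine (pow_dvd_pow _ (Nat.le_succ n)).trans (dvd_sub_pow_of_dvd_sub ?_ n)
  rw [← Ideal.mem_span_singleton, ← Ideal.Quotient.eq, PreTilt.mk_untilt_eq_coeff_zero,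
    PreTilt.coeff_iterate_frobeniusEquiv_symm, zero_add, hx]

theorem PS.exists_tilt (hS : PS p i ϖ) (a : O) : ∃ (x : PreTilt S p) (r : ℕ → O), r 0 = a ∧
    (∀ n, r (n + 1) ^ p = r n) ∧
    ∀ n, PreTilt.untilt (((frobeniusEquiv (PreTilt S p) p).symm^[n]) x) = i (r n) := by
  choose r hr using hS.hroot
  let b : ℕ → O := fun n => r^[n] a
  have hb : ∀ n, b (n + 1) ^ p = b n := fun n => by
    simp only [b, Function.iterate_succ_apply', hr]
  refine ⟨tlt (fun n => i (b n)) (fun n => by rw [← map_pow, hb, sub_self]; exact dvd_zero _),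
    b, rfl, hb, fun k => ?_⟩
  rw [untilt_eq _ (fun n => i (b (n + k))) (fun n => by rw [← map_pow, add_right_comm, hb])
    (fun n => by rw [PreTilt.coeff_iterate_frobeniusEquiv_symm, coeff_tlt]), zero_add]

/-- The tilt of `p`. -/
def PS.pf (hS : PS p i ϖ) : PreTilt S p := tlt (fun n => i (ϖ n))
  (fun n => by rw [← map_pow, hS.h1, sub_self]; exact dvd_zero _)

theorem PS.untilt_pf (hS : PS p i ϖ) : hS.pf.untilt = p := by
  rw [untilt_eq hS.pf (fun n => i (ϖ n)) (fun n => by rw [← map_pow, hS.h1])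
    (fun n => coeff_tlt _ _ n), hS.h0, map_natCast]

theorem PS.pi_pow (hS : PS p i ϖ) (n : ℕ) : ϖ n ^ p ^ n = p := by
  induction n with
  | zero => simp [hS.h0]
  | succ n ih => rw [pow_succ', pow_mul, hS.h1, ih]

theorem PS.pi_ne (hS : PS p i ϖ) (n : ℕ) : ϖ n ≠ 0 := by
  intro h
  apply hS.hp0
  rw [← hS.pi_pow n, h, zero_pow (pow_ne_zero _ (Fact.out : p.Prime).ne_zero)]

theorem PS.lifts (hS : PS p i ϖ) (y : PreTilt S p) (n : ℕ) :
    ∃ a : O, PreTilt.coeff n y = Ideal.Quotient.mk (Ideal.span {(p : S)}) (i a) := by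
  obtain ⟨s, hs⟩ := Ideal.Quotient.mk_surjective (PreTilt.coeff n y)
  obtain ⟨x, t, rfl⟩ := hS.hdense 1 s
  refine ⟨x, ?_⟩
  rw [← hs, Ideal.Quotient.eq, Ideal.mem_span_singleton]
  exact ⟨t, by ring⟩

theorem PS.hmk (hS : PS p i ϖ) (a b : O) : Ideal.Quotient.mk (Ideal.span {(p : S)}) (i a) =
      Ideal.Quotient.mk (Ideal.span {(p : S)}) (i b) ↔ (p : O) ∣ a - b := by
  rw [Ideal.Quotient.eq, Ideal.mem_span_singleton]
  constructor
  · intro h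
    have := hS.hinj 1 (a - b) (by simpa using h)
    simpa using this
  · intro h
    simpa using map_dvd i h

theorem PS.pf_dvd' (hS : PS p i ϖ) (y : PreTilt S p) (hy : PreTilt.coeff 0 y = 0) (Y : ℕ → O)
    (hY : ∀ n, PreTilt.coeff n y = Ideal.Quotient.mk (Ideal.span {(p : S)}) (i (Y n))) :
    ∃ y', y = hS.pf * y' ∧ ∀ n, ∃ z, ϖ (n + 1) * z = Y (n + 1) ∧
      PreTilt.coeff n y' = Ideal.Quotient.mk (Ideal.span {(p : S)}) (i (z ^ p)) := by
  have h2 : 2 ≤ p := (Fact.out : p.Prime).two_le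
  have hmk := hS.hmk
  have hstep : ∀ n, (p : O) ∣ Y (n + 1) ^ p - Y n := by
    intro n
    rw [← hmk, map_pow, map_pow, ← hY, ← hY, PreTilt.coeff_pow_p]
  have h0 : (p : O) ∣ Y 0 := by
    rw [hY 0, ← map_zero (Ideal.Quotient.mk _), ← map_zero i, hmk, sub_zero] at hy
    exact hy
  have hpow : ∀ n, (p : O) ∣ Y n ^ p ^ n := by
    intro n
    induction n with
    | zero => simpa using h0
    | succ n ih =>
      have : Y (n + 1) ^ p ^ (n + 1) = (Y (n + 1) ^ p) ^ p ^ n := by rw [pow_succ', pow_mul]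
      rw [this]
      have h3 := (sub_dvd_pow_sub_pow (Y (n + 1) ^ p) (Y n) (p ^ n))
      have h4 := dvd_add ((hstep n).trans h3) ih
      simpa using h4
  have hz : ∀ n, ϖ n ∣ Y n := fun n => hS.hnorm _ _ (p ^ n) (pow_pos (by omega) _) (by
    rw [hS.pi_pow]; exact hpow n)
  choose z hz using hz
  have hzz : ∀ n, (p : O) ∣ (z (n + 2) ^ p) ^ p - z (n + 1) ^ p := by
    intro n
    obtain ⟨t, ht⟩ := hstep (n + 1)
    rw [hz, hz, mul_pow, hS.h1] at ht
    have hpos : 1 ≤ p ^ (n + 1) := Nat.one_le_iff_ne_zero.2 (pow_ne_zero _ (by omega))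
    have h5 : z (n + 2) ^ p = z (n + 1) + ϖ (n + 1) ^ (p ^ (n + 1) - 1) * t := by
      apply mul_left_cancel₀ (hS.pi_ne (n + 1))
      have h6 : ϖ (n + 1) * ϖ (n + 1) ^ (p ^ (n + 1) - 1) = p := by
        rw [← pow_succ', Nat.sub_add_cancel hpos, hS.pi_pow]
      rw [mul_add, ← mul_assoc, h6]
      linear_combination ht
    obtain ⟨r, hr⟩ := exists_add_pow_prime_eq (Fact.out : p.Prime) (z (n + 1))
      (ϖ (n + 1) ^ (p ^ (n + 1) - 1) * t)
    rw [h5, hr]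
    have h7 : (p : O) ∣ (ϖ (n + 1) ^ (p ^ (n + 1) - 1) * t) ^ p := by
      rw [mul_pow, ← pow_mul]
      refine Dvd.dvd.mul_right ?_ _
      conv_lhs => rw [← hS.pi_pow (n + 1)]
      apply pow_dvd_pow
      have h8 : p ≤ p ^ (n + 1) := Nat.le_self_pow (by omega) p
      obtain ⟨e, he⟩ : ∃ e, p ^ (n + 1) = e + 2 := ⟨p ^ (n + 1) - 2, by omega⟩
      rw [he, show e + 2 - 1 = e + 1 by omega]
      nlinarith
    have h9 := dvd_add h7 (dvd_mul_right (p : O) (z (n + 1) *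
      (ϖ (n + 1) ^ (p ^ (n + 1) - 1) * t) * r))
    convert h9 using 1
    ring
  refine ⟨tlt (fun n => i (z (n + 1) ^ p)) (fun n => ?_), tilt_ext fun n => ?_,
    fun n => ⟨z (n + 1), (hz _).symm, by rw [coeff_tlt]⟩⟩
  · have := map_dvd i (hzz n)
    simpa using this
  · rw [map_mul, PS.pf, coeff_tlt, coeff_tlt, ← PreTilt.coeff_pow_p, hY, hz, ← map_pow, ← map_pow,
      mul_pow, hS.h1, map_mul, map_mul]

theorem PS.pf_dvd (hS : PS p i ϖ) (y : PreTilt S p) (hy : PreTilt.coeff 0 y = 0) :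
    hS.pf ∣ y := by
  choose Y hY using hS.lifts y
  obtain ⟨y', h, -⟩ := hS.pf_dvd' y hy Y hY
  exact ⟨y', h⟩

theorem PS.pf_nzd (hS : PS p i ϖ) (y : PreTilt S p) (hy : hS.pf * y = 0) : y = 0 := by
  choose Y hY using hS.lifts y
  refine tilt_ext fun n => ?_
  have h1 := congrArg (PreTilt.coeff (n + 1)) hy
  rw [map_mul, PS.pf, coeff_tlt, hY, ← map_mul, ← map_mul, map_zero,
    ← map_zero (Ideal.Quotient.mk _), ← map_zero i, hS.hmk, sub_zero] at h1
  obtain ⟨t, ht⟩ := h1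
  rw [map_zero, ← PreTilt.coeff_pow_p, hY, ← map_pow, ← map_pow, ← map_zero (Ideal.Quotient.mk _),
    ← map_zero i, hS.hmk, sub_zero]
  obtain ⟨c, hc⟩ : ϖ n ∣ (p : O) := by
    conv_rhs => rw [← hS.pi_pow n]
    exact dvd_pow_self _ (pow_ne_zero _ (Fact.out : p.Prime).ne_zero)
  have h3 : ϖ n * Y (n + 1) ^ p = ϖ n * (p ^ (p - 1) * (c * t ^ p)) := by
    have h4 : (p : O) ^ p = p ^ (p - 1) * p := by
      rw [← pow_succ, Nat.sub_add_cancel (Fact.out : p.Prime).one_le]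
    have h5 := congrArg (fun z => z ^ p) ht
    simp only [mul_pow, hS.h1] at h5
    rw [h5, h4]
    linear_combination (p : O) ^ (p - 1) * t ^ p * hc
  rw [mul_left_cancel₀ (hS.pi_ne n) h3]
  exact (dvd_pow_self _ (by have := (Fact.out : p.Prime).two_le; omega)).mul_right _

theorem theta_ker (hS : PS p i ϖ) {Q : Type} [CommRing Q] [CharP Q p] [PerfectRing Q p]
    (f : Q →+* PreTilt S p) {π : Q} (hπ : f π = hS.pf)
    (hdiv : ∀ x, PreTilt.coeff 0 (f x) = 0 → π ∣ x) (x : WittVector p Q)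
    (hx : WittVector.fontaineTheta S p (WittVector.map f x) = 0) :
    ((p : WittVector p Q) - WittVector.teichmuller p π) ∣ x := by
  have step : ∀ x : WittVector p Q, WittVector.fontaineTheta S p (WittVector.map f x) = 0 → ∃ y x',
      x = ((p : WittVector p Q) - WittVector.teichmuller p π) * y + p * x' ∧
      WittVector.fontaineTheta S p (WittVector.map f x') = 0 := by
    intro x hx
    have h1 := WittVector.mk_fontaineTheta (R := S) (p := p) (WittVector.map f x)
    rw [hx, map_zero, WittVector.map_coeff] at h1
    obtain ⟨y, hy⟩ := hdiv _ h1.symm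
    obtain ⟨s, hs⟩ := BQ.witt_dvd p (x := x) (y := WittVector.teichmuller p (π * y)) (by
      rw [WittVector.teichmuller_coeff_zero, hy])
    have h2 : x = ((p : WittVector p Q) - WittVector.teichmuller p π) *
        (-WittVector.teichmuller p y) + p * (s + WittVector.teichmuller p y) := by
      rw [hs, map_mul]; ring
    refine ⟨_, _, h2, ?_⟩
    apply hS.nzd
    have h3 := congrArg (fun w => WittVector.fontaineTheta S p (WittVector.map f w)) h2
    simp only [hx, map_add, map_mul, map_sub, map_natCast, WittVector.map_teichmuller, hπ,
      WittVector.fontaineTheta_teichmuller, hS.untilt_pf, sub_self, zero_mul, zero_add] at h3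
    rw [map_add, map_add, WittVector.map_teichmuller, WittVector.fontaineTheta_teichmuller]
    exact h3.symm
  choose! Y X hYX hX using step
  let xs : ℕ → WittVector p Q := fun n => X^[n] x
  have hxs : ∀ n, WittVector.fontaineTheta S p (WittVector.map f (xs n)) = 0 := by
    intro n
    induction n with
    | zero => exact hx
    | succ n ih =>
      simp only [xs, Function.iterate_succ_apply']
      exact hX _ ih
  have hsum : ∀ n, x = ((p : WittVector p Q) - WittVector.teichmuller p π) *
      (∑ k ∈ Finset.range n, p ^ k * Y (xs k)) + p ^ n * xs n := by
    intro n
    induction n with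
    | zero => simp [xs]
    | succ n ih =>
      rw [Finset.sum_range_succ]
      have h4 := hYX _ (hxs n)
      have h5 : xs (n + 1) = X (xs n) := by simp only [xs, Function.iterate_succ_apply']
      rw [h5, pow_succ]
      linear_combination ih + p ^ n * h4
  obtain ⟨y, hy⟩ := prec_p p fun k => Y (xs k)
  refine ⟨y, ?_⟩
  rw [← sub_eq_zero]
  apply haus_p p
  intro M
  obtain ⟨t, ht⟩ := hy M
  refine ⟨xs M - ((p : WittVector p Q) - WittVector.teichmuller p π) * t, ?_⟩
  linear_combination hsum M - ((p : WittVector p Q) - WittVector.teichmuller p π) * ht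

end tilt

section ext
variable {p : ℕ} [Fact p.Prime] {O S : Type} [CommRing O] [IsDomain O] [CommRing S]
  [Fact ¬IsUnit (p : S)] [IsAdicComplete (Ideal.span {(p : S)}) S]
  {i : O →+* S} {ϖ : ℕ → O}

/-- A stage: a perfect ring over the tilt. -/
structure Stg (hS : PS p i ϖ) : Type 1 where
  Q : Type
  [ring : CommRing Q]
  [char : CharP Q p]
  [perf : PerfectRing Q p]
  π : Q
  nzd : ∀ b, π * b = 0 → b = 0
  f : Q →+* PreTilt S p
  hf : f π = hS.pf

attribute [instance] Stg.ring Stg.char Stg.perf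

/-- The untilt of a stage. -/
abbrev Stg.B {hS : PS p i ϖ} (X : Stg hS) : Type := BQ p X.Q X.π

/-- The map to `S`. -/
noncomputable def Stg.χ {hS : PS p i ϖ} (X : Stg hS) : X.B →+* S :=
  BQ.lift p ((WittVector.fontaineTheta S p).comp (WittVector.map X.f)) (by
    rw [RingHom.comp_apply, WittVector.map_teichmuller, X.hf, WittVector.fontaineTheta_teichmuller,
      hS.untilt_pf])

theorem Stg.χ_mk {hS : PS p i ϖ} (X : Stg hS) (x) :
    X.χ (BQ.mk p X.Q X.π x) = WittVector.fontaineTheta S p (WittVector.map X.f x) := rfl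

theorem Stg.χ_teich {hS : PS p i ϖ} (X : Stg hS) (x) :
    X.χ (BQ.mk p X.Q X.π (WittVector.teichmuller p x)) = (X.f x).untilt := by
  rw [Stg.χ_mk, WittVector.map_teichmuller, WittVector.fontaineTheta_teichmuller]

theorem charP_between (p : ℕ) {A B C : Type} [CommRing A] [CommRing B] [CommRing C] [CharP A p]
    [CharP C p] (f : A →+* B) (g : B →+* C) : CharP B p := by
  refine ⟨fun n => ⟨fun hn => ?_, fun hn => ?_⟩⟩
  · rw [← CharP.cast_eq_zero_iff C p, ← map_natCast g, hn, map_zero]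
  · rw [← map_natCast f, (CharP.cast_eq_zero_iff A p n).2 hn, map_zero]

theorem ext_root (p : ℕ) [Fact p.Prime] {Q Q' : Type} [CommRing Q] [CommRing Q'] (π : Q)
    (F : Polynomial (WittVector p Q)) (h : Q2 p π F →+* Q') :
    F.eval₂ ((BQ.mk p Q' (h (Q2.mk p π F (jP Q π)))).comp
      (WittVector.map (h.comp ((Q2.mk p π F).comp (jP Q)))))
        (BQ.mk p Q' (h (Q2.mk p π F (jP Q π)))
          (WittVector.teichmuller p (h (Q2.mk p π F (MvPolynomial.C Polynomial.X))))) = 0 := by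
  let m := h.comp (Q2.mk p π F)
  have h1 : WittVector.map m (FT p F) = F.eval₂
      (WittVector.map (h.comp ((Q2.mk p π F).comp (jP Q))))
      (WittVector.teichmuller p (h (Q2.mk p π F (MvPolynomial.C Polynomial.X)))) := by
    rw [FT, Polynomial.hom_eval₂, WittVector.map_teichmuller]
    rfl
  rw [← Polynomial.hom_eval₂, ← h1, BQ.mk_eq_zero]
  refine ⟨WittVector.map m (zzW p Q), ?_⟩
  have h2 : WittVector.map (Q2.mk p π F)
      (FT p F + WittVector.teichmuller p (jP Q π) * zzW p Q) =
      WittVector.map (Q2.mk p π F) (zzW p Q * (p : WittVector p (MvPolynomial ℕ (Polynomial Q)))) := by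
    ext n
    rw [WittVector.map_coeff, WittVector.map_coeff, ← sub_eq_zero, ← map_sub, Q2.ker]
    apply Ideal.subset_span
    cases n with
    | zero => exact ⟨none, rfl⟩
    | succ n => exact ⟨some n, rfl⟩
  have h3 : ∀ x : WittVector p (MvPolynomial ℕ (Polynomial Q)), WittVector.map m x = WittVector.map h (WittVector.map (Q2.mk p π F) x) :=
    fun x => rfl
  have h4 := congrArg (WittVector.map h) h2
  rw [← h3, ← h3, map_add, map_mul, map_mul, map_natCast, WittVector.map_teichmuller] at h4
  change _ = ((p : WittVector p Q') - WittVector.teichmuller p (m (jP Q π))) * _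
  linear_combination h4

theorem stage_ext_aux {hS : PS p i ϖ} (X : Stg hS) (F : Polynomial (WittVector p X.Q))
    (hF : F.Monic) (hd : 0 < F.natDegree) (αf : PreTilt S p)
    (hα : F.eval₂ ((WittVector.fontaineTheta S p).comp (WittVector.map X.f)) αf.untilt = 0) :
    ∃ (Y : Stg hS) (g : X.Q →+* Y.Q) (_ : g X.π = Y.π) (T : Y.Q),
      EqFlat g X.π ∧ Y.f.comp g = X.f ∧ Y.f T = αf ∧
      F.eval₂ ((BQ.mk p Y.Q Y.π).comp (WittVector.map g))
        (BQ.mk p Y.Q Y.π (WittVector.teichmuller p T)) = 0 := by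
  have hdvd : ((p : WittVector p (PreTilt S p)) - WittVector.teichmuller p hS.pf) ∣
      F.eval₂ (WittVector.map X.f) (WittVector.teichmuller p αf) := by
    refine theta_ker hS (RingHom.id _) rfl (fun x hx => hS.pf_dvd x hx) _ ?_
    have hid : WittVector.map (p := p) (RingHom.id (PreTilt S p)) = RingHom.id _ := by
      ext x n; rfl
    rw [hid, RingHom.id_apply, Polynomial.hom_eval₂, WittVector.fontaineTheta_teichmuller]
    exact hα
  obtain ⟨ζ, hζ⟩ := hdvd
  let G : MvPolynomial ℕ (Polynomial X.Q) →+* PreTilt S p :=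
    MvPolynomial.eval₂Hom (Polynomial.eval₂RingHom X.f αf) (fun n => ζ.coeff n)
  have hGj : G.comp (jP X.Q) = X.f := by
    ext x; simp [G, jP]
  have hGz : WittVector.map G (zzW p X.Q) = ζ := by
    ext n; simp [G, zzW, WittVector.map_coeff]
  have hGF : WittVector.map G (FT p F) =
      F.eval₂ (WittVector.map X.f) (WittVector.teichmuller p αf) := by
    have e1 : (WittVector.map G).comp (WittVector.map (jP X.Q)) = WittVector.map (p := p) X.f := by
      rw [← hGj]; rfl
    have e2 : G (MvPolynomial.C Polynomial.X) = αf := by simp [G]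
    rw [FT, Polynomial.hom_eval₂, WittVector.map_teichmuller, e1, e2]
  have hrelW : ∀ n, G (relW p X.π F n) = 0 := by
    intro n
    have hb : ∀ x : WittVector p (MvPolynomial ℕ (Polynomial X.Q)),
        G (x.coeff n) = (WittVector.map G x).coeff n := fun _ => rfl
    have hGp : G (jP X.Q X.π) = hS.pf := by rw [← RingHom.comp_apply, hGj, X.hf]
    rw [relW, map_sub, hb, hb, map_add, map_mul, map_mul, WittVector.map_teichmuller, hGF, hGz,
      map_natCast, hζ, hGp, sub_eq_zero]
    have e3 : ((p : WittVector p (PreTilt S p)) - WittVector.teichmuller p hS.pf) * ζ +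
        WittVector.teichmuller p hS.pf * ζ = ζ * p := by ring
    rw [e3]
  have hrel : ∀ o, G (relO p X.π F o) = 0 := by
    rintro (_ | n)
    · exact hrelW 0
    · exact hrelW (n + 1)
  let G2 : Q2 p X.π F →+* PreTilt S p := Q2.lift p X.π F G hrel
  have hG2 : ∀ x, G2 (Q2.mk p X.π F x) = G x := fun x => Q2.lift_mk p X.π F G hrel x
  let g2 : X.Q →+* Q2 p X.π F := (Q2.mk p X.π F).comp (jP X.Q)
  have hchar : CharP (Q2 p X.π F) p := charP_between p g2 G2
  let h : Q2 p X.π F →+* PerfectClosure (Q2 p X.π F) p := PerfectClosure.of _ p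
  let f' : PerfectClosure (Q2 p X.π F) p →+* PreTilt S p := PerfectClosure.lift _ p _ G2
  have hf'h : ∀ x, f' (h x) = G2 x := fun x =>
    RingHom.congr_fun ((PerfectClosure.lift _ p _).symm_apply_apply G2) x
  have hnzd2 := Q2.nzd p X.π X.nzd F hF hd
  refine ⟨⟨PerfectClosure (Q2 p X.π F) p, h (g2 X.π), nzd_perf p g2 h hnzd2, f', ?_⟩,
    h.comp g2, rfl, h (Q2.mk p X.π F (MvPolynomial.C Polynomial.X)),
    eqFlat_perf p g2 h hnzd2 (Q2.eqFlat p X.π F hF hd), ?_, ?_, ?_⟩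
  · change f' (h (Q2.mk p X.π F (jP X.Q X.π))) = _
    rw [hf'h, hG2, ← RingHom.comp_apply, hGj, X.hf]
  · ext x
    change f' (h (Q2.mk p X.π F (jP X.Q x))) = X.f x
    rw [hf'h, hG2, ← RingHom.comp_apply, hGj]
  · change f' (h _) = _
    rw [hf'h, hG2]
    simp [G]
  · exact ext_root p X.π F h

theorem stage_ext {hS : PS p i ϖ} (X : Stg hS) (F : Polynomial X.B) (hF : F.Monic)
    (hd : 0 < F.natDegree) (αf : PreTilt S p) (hα : F.eval₂ X.χ αf.untilt = 0) :
    ∃ (Y : Stg hS) (ψ : X.B →+* Y.B) (T : Y.Q), EqFlat ψ (p : X.B) ∧ Y.χ.comp ψ = X.χ ∧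
      Y.f T = αf ∧ F.eval₂ ψ (BQ.mk p Y.Q Y.π (WittVector.teichmuller p T)) = 0 := by
  have hl : F ∈ Polynomial.lifts (BQ.mk p X.Q X.π) := by
    rw [Polynomial.lifts_iff_coeff_lifts]
    intro n
    exact BQ.mk_surj p _
  obtain ⟨F', hF', hdeg, hm⟩ := Polynomial.lifts_and_natDegree_eq_and_monic hl hF
  obtain ⟨Y, g, hg, T, h1, h2, h3, h4⟩ := stage_ext_aux X F' hm (hdeg ▸ hd) αf (by
    rw [← hF', Polynomial.eval₂_map] at hα
    exact hα)
  refine ⟨Y, BQ.map p g hg, T, BQ.eqFlat_map p g hg h1, ?_, h3, ?_⟩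
  · ext x
    obtain ⟨x, rfl⟩ := BQ.mk_surj p x
    rw [RingHom.comp_apply, BQ.map_mk, Stg.χ_mk, Stg.χ_mk, ← h2]
    rfl
  · rw [← hF', Polynomial.eval₂_map]
    exact h4

end ext

theorem min_rel {A O σ : Type} [CommRing A] [IsDomain A] [CommRing O] [IsDomain O]
    (j : A →+* O) (hj : Function.Injective j) (u : σ → O) (F : σ → Polynomial A)
    (hF : ∀ s, (F s).Monic)
    (ρ : MvPolynomial σ A) (hρ : ρ.eval₂ j u = 0) :
    ∃ (g : MvPolynomial σ A) (k : ℕ), g.eval₂ j u ≠ 0 ∧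
      g * ρ ^ k ∈ Ideal.span (Set.range fun s => (F s).eval₂ MvPolynomial.C (MvPolynomial.X s)) := by
  classical
  let ev : MvPolynomial σ A →+* O := MvPolynomial.eval₂Hom j u
  let P := RingHom.ker ev
  have hP : P.IsPrime := RingHom.ker_isPrime ev
  by_contra hcon
  push Not at hcon
  let I := Ideal.span (Set.range fun s => (F s).eval₂ MvPolynomial.C (MvPolynomial.X s))
  have hdis : Disjoint (I : Set (MvPolynomial σ A))
      (P.primeCompl ⊔ Submonoid.powers ρ : Submonoid (MvPolynomial σ A)) := by
    rw [Set.disjoint_left]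
    intro x hx hx'
    obtain ⟨g, hg, _, ⟨k, rfl⟩, rfl⟩ := Submonoid.mem_sup.1 hx'
    exact hcon g k hg hx
  obtain ⟨q, hq, hIq, hqd⟩ := Ideal.exists_le_prime_disjoint I _ hdis
  have hqP : q ≤ P := by
    intro x hx
    by_contra hxP
    exact Set.disjoint_left.1 hqd hx ((le_sup_left : P.primeCompl ≤ _) hxP)
  have hρq : ρ ∉ q := fun h => Set.disjoint_left.1 hqd h
    ((le_sup_right : Submonoid.powers ρ ≤ _) (Submonoid.mem_powers ρ))
  let a : A →+* MvPolynomial σ A ⧸ q := (Ideal.Quotient.mk q).comp MvPolynomial.C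
  have hint : ∀ x : MvPolynomial σ A, a.IsIntegralElem (Ideal.Quotient.mk q x) := by
    intro x
    induction x using MvPolynomial.induction_on with
    | C r => exact a.isIntegralElem_map
    | add x y hx hy => rw [map_add]; exact RingHom.IsIntegralElem.add _ hx hy
    | mul_X x s hx =>
      rw [map_mul]
      refine RingHom.IsIntegralElem.mul _ hx ⟨F s, hF s, ?_⟩
      rw [← Polynomial.hom_eval₂]
      exact Ideal.Quotient.eq_zero_iff_mem.2 (hIq (Ideal.subset_span ⟨s, rfl⟩))
  let ev' : MvPolynomial σ A ⧸ q →+* O := Ideal.Quotient.lift q ev (fun x hx => hqP hx)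
  let _ := a.toAlgebra
  have h1 := Ideal.comap_ne_bot_of_integral_mem (R := A) (I := RingHom.ker ev')
    (x := Ideal.Quotient.mk q ρ) (fun h => hρq (Ideal.Quotient.eq_zero_iff_mem.1 h))
    (RingHom.mem_ker.2 hρ) (hint ρ)
  apply h1
  rw [eq_bot_iff]
  intro x hx
  have h2 : ev' (a x) = 0 := hx
  have h3 : ev' (a x) = j x := by
    change ev (MvPolynomial.C x) = j x
    simp [ev]
  rw [h3] at h2
  exact hj (by rw [h2, map_zero])

section adj
variable {p : ℕ} [Fact p.Prime] {O S : Type} [CommRing O] [IsDomain O] [CommRing S]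
  [Fact ¬IsUnit (p : S)] [IsAdicComplete (Ideal.span {(p : S)}) S]
  {i : O →+* S} {ϖ : ℕ → O} {hS : PS p i ϖ} {A : Type} [CommRing A] (j : A →+* O)

theorem frob_symm_pow (p : ℕ) [Fact p.Prime] {Q : Type} [CommRing Q] [CharP Q p] [PerfectRing Q p]
    (l : ℕ) (T : Q) : ((frobeniusEquiv Q p).symm^[l]) T ^ p ^ l = T := by
  induction l with
  | zero => simp
  | succ l ih =>
    rw [Function.iterate_succ_apply', pow_succ', pow_mul, frobeniusEquiv_symm_pow_p, ih]

theorem frob_symm_iter (p : ℕ) [Fact p.Prime] {Q Q' : Type} [CommRing Q] [CharP Q p]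
    [PerfectRing Q p] [CommRing Q'] [CharP Q' p] [PerfectRing Q' p] (f : Q →+* Q')
    (l : ℕ) (T : Q) : f (((frobeniusEquiv Q p).symm^[l]) T) =
      ((frobeniusEquiv Q' p).symm^[l]) (f T) := by
  apply perf_inj p l
  rw [← map_pow, frob_symm_pow, frob_symm_pow]

theorem Stg.nontriv (X : Stg hS) : Nontrivial X.B := by
  have : Nontrivial S := by
    by_contra h
    rw [not_nontrivial_iff_subsingleton] at h
    exact (Fact.out : ¬ IsUnit (p : S)) (isUnit_of_subsingleton _)
  exact X.χ.domain_nontrivial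

/-- Compatible stage. -/
structure Good (X : Stg hS) (φ : A →+* X.B) : Prop where
  flat : EqFlat φ (p : A)
  comp : ∀ a, X.χ (φ a) = i (j a)

theorem Good.step {X : Stg hS} {φ : A →+* X.B} (h : Good j X φ) {Y : Stg hS} {ψ : X.B →+* Y.B}
    (hψ : EqFlat ψ (p : X.B)) (hχ : Y.χ.comp ψ = X.χ) : Good j Y (ψ.comp φ) := by
  refine ⟨h.flat.comp (by rwa [map_natCast]), fun a => ?_⟩
  rw [← h.comp, ← hχ]; rfl

theorem adjoin_roots {X : Stg hS} {φ : A →+* X.B} (h : Good j X φ) (n : ℕ) (u : Fin n → O)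
    (F : Fin n → Polynomial A) (hF : ∀ s, (F s).Monic) (hu : ∀ s, (F s).eval₂ j (u s) = 0) :
    ∃ (Y : Stg hS) (φ' : A →+* Y.B) (U : Fin n → Y.B), Good j Y φ' ∧ (∀ s, Y.χ (U s) = i (u s)) ∧
      ∀ s, (F s).eval₂ φ' (U s) = 0 := by
  induction n with
  | zero => exact ⟨X, φ, Fin.elim0, h, fun s => s.elim0, fun s => s.elim0⟩
  | succ n ih =>
    obtain ⟨Y, φ', U, h1, h2, h3⟩ := ih (fun s => u s.castSucc) (fun s => F s.castSucc)
      (fun s => hF _) (fun s => hu _)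
    obtain ⟨αf, r, hr0, hr, hαf⟩ := hS.exists_tilt (u (Fin.last n))
    have hα : αf.untilt = i (u (Fin.last n)) := by rw [← hr0]; exact hαf 0
    obtain ⟨Z, ψ, T, k1, k2, k3, k4⟩ := stage_ext Y ((F (Fin.last n)).map φ') ((hF _).map _) (by
      have := Y.nontriv
      rw [(hF _).natDegree_map, Nat.pos_iff_ne_zero]
      intro h0
      have h1 := hu (Fin.last n)
      rw [Polynomial.eq_one_of_monic_natDegree_zero (hF _) h0, Polynomial.eval₂_one] at h1
      exact one_ne_zero h1) αf (by
      rw [Polynomial.eval₂_map, hα]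
      have : Y.χ.comp φ' = i.comp j := RingHom.ext h1.comp
      rw [this, ← Polynomial.hom_eval₂, hu, map_zero])
    have hk2 : ∀ x, Z.χ (ψ x) = Y.χ x := fun x => RingHom.congr_fun k2 x
    refine ⟨Z, ψ.comp φ', Fin.snoc (fun s => ψ (U s))
      (BQ.mk p Z.Q Z.π (WittVector.teichmuller p T)), h1.step j k1 k2, fun s => ?_, fun s => ?_⟩
    · refine Fin.lastCases ?_ (fun s => ?_) s
      · rw [Fin.snoc_last, Stg.χ_teich, k3, hα]
      · rw [Fin.snoc_castSucc, hk2, h2]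
    · refine Fin.lastCases ?_ (fun s => ?_) s
      · rw [Fin.snoc_last, ← Polynomial.eval₂_map]
        exact k4
      · rw [Fin.snoc_castSucc, ← Polynomial.hom_eval₂, h3, map_zero]

theorem adjoin_all [IsDomain A] (hj : Function.Injective j) (hji : j.IsIntegral)
    {X : Stg hS} {φ : A →+* X.B} (h : Good j X φ) (n m : ℕ) (u : Fin n → O)
    (ρ : Fin m → MvPolynomial (Fin n) A) (hρ : ∀ t, (ρ t).eval₂ j u = 0) :
    ∃ (Y : Stg hS) (φ' : A →+* Y.B) (U : Fin n → Y.B) (r : ℕ → O) (G : ℕ → Y.B),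
      Good j Y φ' ∧ (∀ s, Y.χ (U s) = i (u s)) ∧ r 0 ≠ 0 ∧ (∀ k, r (k + 1) ^ p = r k) ∧
      (∀ k, Y.χ (G k) = i (r k)) ∧
      ∀ t k M, (p : Y.B) ^ M ∣ G k * (ρ t).eval₂ φ' U := by
  choose F hF hu using fun s => hji (u s)
  choose g k hg hgk using fun t => min_rel j hj u F hF (ρ t) (hρ t)
  obtain ⟨Y, φ', U, h1, h2, h3⟩ := adjoin_roots j h n u F hF hu
  let c : MvPolynomial (Fin n) A := ∏ t, g t
  have hc : c.eval₂ j u ≠ 0 := by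
    simp only [c]
    rw [← MvPolynomial.coe_eval₂Hom, map_prod, Finset.prod_ne_zero_iff]
    exact fun t _ => hg t
  obtain ⟨αf, r, hr0, hr, hαf⟩ := hS.exists_tilt (c.eval₂ j u)
  have hα : αf.untilt = i (c.eval₂ j u) := by rw [← hr0]; exact hαf 0
  have hcomp : Y.χ.comp φ' = i.comp j := RingHom.ext h1.comp
  have hcU : Y.χ (c.eval₂ φ' U) = i (c.eval₂ j u) := by
    rw [MvPolynomial.eval₂_comp_left, MvPolynomial.eval₂_comp_left, hcomp]
    congr 1
    exact funext h2
  have hnt : Nontrivial Y.B := Y.nontriv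
  obtain ⟨Z, ψ, T, k1, k2, k3, k4⟩ := stage_ext Y
    (Polynomial.X - Polynomial.C (c.eval₂ φ' U)) (Polynomial.monic_X_sub_C _)
    (by rw [Polynomial.natDegree_X_sub_C]; exact one_pos) αf (by simp [hcU, hα])
  have hk2 : ∀ x, Z.χ (ψ x) = Y.χ x := fun x => RingHom.congr_fun k2 x
  have hT : BQ.mk p Z.Q Z.π (WittVector.teichmuller p T) = ψ (c.eval₂ φ' U) := by
    simpa [sub_eq_zero] using k4
  refine ⟨Z, ψ.comp φ', fun s => ψ (U s), r,
    fun k => BQ.mk p Z.Q Z.π (WittVector.teichmuller p (((frobeniusEquiv Z.Q p).symm^[k]) T)),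
    h1.step j k1 k2, fun s => by rw [hk2, h2], by rw [hr0]; exact hc, hr, fun k => ?_, ?_⟩
  · rw [Stg.χ_teich, ← hαf, ← k3]
    rw [frob_symm_iter]
  · intro t l M
    apply BQ.nilp p Z.nzd (k := p ^ l * (k t + 1))
    have e1 : BQ.mk p Z.Q Z.π (WittVector.teichmuller p (((frobeniusEquiv Z.Q p).symm^[l]) T))
        ^ p ^ l = ψ (c.eval₂ φ' U) := by
      rw [← map_pow, ← map_pow, frob_symm_pow, hT]
    have e2 : (ρ t).eval₂ (ψ.comp φ') (fun s => ψ (U s)) = ψ ((ρ t).eval₂ φ' U) := by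
      rw [MvPolynomial.eval₂_comp_left]; rfl
    rw [mul_pow, pow_mul, e1, e2, ← map_pow, ← map_pow, ← map_mul]
    have e3 : (c * ρ t ^ k t).eval₂ φ' U = 0 := by
      have : c * ρ t ^ k t ∈ Ideal.span (Set.range fun s =>
          (F s).eval₂ MvPolynomial.C (MvPolynomial.X s)) := by
        obtain ⟨c', hc'⟩ : g t ∣ c := Finset.dvd_prod_of_mem _ (Finset.mem_univ t)
        rw [hc', show g t * c' * ρ t ^ k t = c' * (g t * ρ t ^ k t) by ring]
        exact Ideal.mul_mem_left _ _ (hgk t)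
      have hle : Ideal.span (Set.range fun s => (F s).eval₂ MvPolynomial.C (MvPolynomial.X s)) ≤
          RingHom.ker (MvPolynomial.eval₂Hom φ' U) := by
        rw [Ideal.span_le]
        rintro _ ⟨s, rfl⟩
        change MvPolynomial.eval₂Hom φ' U _ = 0
        rw [Polynomial.hom_eval₂]
        have : (MvPolynomial.eval₂Hom φ' U).comp MvPolynomial.C = φ' := by ext; simp
        rw [this]
        simpa using h3 s
      exact hle this
    rw [MvPolynomial.eval₂_mul, MvPolynomial.eval₂_pow] at e3
    have hpl : p ^ l * (k t + 1) = k t + (p ^ l * (k t + 1) - k t) := by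
      have : 1 ≤ p ^ l := Nat.one_le_iff_ne_zero.2 (pow_ne_zero _ (Fact.out : p.Prime).ne_zero)
      have : k t ≤ p ^ l * (k t + 1) := by nlinarith
      omega
    rw [hpl, pow_add (MvPolynomial.eval₂ φ' U (ρ t)), pow_succ _ (k t), mul_assoc,
      ← mul_assoc (MvPolynomial.eval₂ φ' U c), e3, zero_mul, mul_zero, map_zero]

end adj

theorem frob_add_dvd {O : Type} [CommRing O] (p : ℕ) [Fact p.Prime] {q : O} (hq : q ∣ (p : O))
    (x y : O) : q ∣ (x + y) ^ p - (x ^ p + y ^ p) := by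
  obtain ⟨r, hr⟩ := exists_add_pow_prime_eq (Fact.out : p.Prime) x y
  rw [hr]
  refine hq.trans ⟨x * y * r, by ring⟩

theorem frob_sum_dvd {O ι : Type} [CommRing O] (p : ℕ) [Fact p.Prime] {q : O} (hq : q ∣ (p : O))
    (s : Finset ι) (f : ι → O) : q ∣ (∑ i ∈ s, f i) ^ p - ∑ i ∈ s, f i ^ p := by
  classical
  induction s using Finset.induction_on with
  | empty => simp [(Fact.out : p.Prime).ne_zero]
  | insert a s ha ih =>
    rw [Finset.sum_insert ha, Finset.sum_insert ha]
    have := dvd_add (frob_add_dvd p hq (f a) (∑ i ∈ s, f i)) ih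
    convert this using 1
    ring

theorem frob_cong {O : Type} [CommRing O] (p : ℕ) [Fact p.Prime] {q q' : O} (hq : q ∣ (p : O))
    (hq' : q' ^ p = q) {x y : O} (h : q' ∣ x - y) : q ∣ x ^ p - y ^ p := by
  obtain ⟨t, ht⟩ := h
  have h1 := frob_add_dvd p hq y (q' * t)
  rw [mul_pow, hq'] at h1
  rw [show x = y + q' * t by linear_combination ht]
  have := dvd_add h1 (dvd_mul_right q (t ^ p))
  convert this using 1
  ring

/-- Towers of subrings. -/
structure Twr (p : ℕ) {O ι : Type} [Fintype ι] [CommRing O] (T : ℕ → Subring O) (ϖ : ℕ → O)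
    (M : ℕ → ι → O) : Prop where
  mono : ∀ m, T m ≤ T (m + 1)
  hϖ : ∀ m, ϖ m ∈ T m
  hMT : ∀ m I, M m I ∈ T m
  h0 : ϖ 0 = p
  h1 : ∀ m, ϖ (m + 1) ^ p = ϖ m
  hM : ∀ m I, M (m + 1) I ^ p = M m I
  ne : (p : O) ≠ 0
  gen : ∀ m, ∀ x ∈ T (m + 1), ∃ a : ℕ → ι → O, (∀ l I, a l I ∈ T m) ∧
    x = ∑ l ∈ Finset.range p, ϖ (m + 1) ^ l * ∑ I, a l I * M (m + 1) I
  a0 : ∀ y, (p : O) * y ∈ T 0 → y ∈ T 0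
  b0 : ∀ x ∈ T 0, ∃ c : ι → O, (∀ I, c I ∈ T 0) ∧ (p : O) ∣ x - ∑ I, c I ^ p * M 0 I
  c0 : ∀ c : ι → O, (∀ I, c I ∈ T 0) → (p : O) ∣ ∑ I, c I ^ p * M 0 I → ∀ I, (p : O) ∣ c I

section twr
variable {p : ℕ} [Fact p.Prime] {O ι : Type} [Fintype ι] [CommRing O] [IsDomain O]
  {T : ℕ → Subring O} {ϖ : ℕ → O} {M : ℕ → ι → O}

theorem Twr.pw (h : Twr p T ϖ M) (n : ℕ) : ϖ n ^ p ^ n = p := by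
  induction n with
  | zero => simp [h.h0]
  | succ n ih => rw [pow_succ', pow_mul, h.h1, ih]

theorem Twr.dvd_p (h : Twr p T ϖ M) (n : ℕ) : ϖ n ∣ (p : O) := by
  rw [← h.pw n]
  exact dvd_pow_self _ (pow_ne_zero _ (Fact.out : p.Prime).ne_zero)

theorem Twr.ϖne (h : Twr p T ϖ M) (n : ℕ) : ϖ n ≠ 0 := fun h0 => h.ne (by
  have := h.dvd_p n
  rwa [h0, zero_dvd_iff] at this)

theorem Twr.gen' (h : Twr p T ϖ M) (m : ℕ) (x : O) (hx : x ∈ T (m + 1)) :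
    ∃ (a : ι → O) (x' : O), (∀ I, a I ∈ T m) ∧ x' ∈ T (m + 1) ∧
      x = ∑ I, a I * M (m + 1) I + ϖ (m + 1) * x' := by
  obtain ⟨a, ha, rfl⟩ := h.gen m x hx
  obtain ⟨k, hk⟩ : ∃ k, p = k + 1 := ⟨p - 1, by have := (Fact.out : p.Prime).pos; omega⟩
  refine ⟨a 0, ∑ l ∈ Finset.range k, ϖ (m + 1) ^ l * ∑ I, a (l + 1) I * M (m + 1) I, ha 0,
    ?_, ?_⟩
  · exact sum_mem fun l _ => mul_mem (pow_mem (h.hϖ _) _) (sum_mem fun I _ =>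
      mul_mem (h.mono _ (ha _ _)) (h.hMT _ _))
  · rw [show Finset.range p = Finset.range (k + 1) by rw [hk], Finset.sum_range_succ', pow_zero,
      one_mul, add_comm, Finset.mul_sum]
    congr 1
    refine Finset.sum_congr rfl fun l _ => ?_
    rw [pow_succ']; ring

theorem Twr.frobM (h : Twr p T ϖ M) (m : ℕ) (a : ι → O) {x : O}
    (hx : ϖ (m + 1) ∣ x - ∑ I, a I * M (m + 1) I) :
    ϖ m ∣ x ^ p - ∑ I, a I ^ p * M m I := by
  have h1 := frob_cong p (h.dvd_p m) (h.h1 m) hx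
  have h2 := frob_sum_dvd p (h.dvd_p m) Finset.univ (fun I => a I * M (m + 1) I)
  have h3 := dvd_add h1 h2
  simp only [mul_pow, h.hM] at h3
  convert h3 using 1
  ring

theorem Twr.uniq (h : Twr p T ϖ M) (m : ℕ)
    (C : ∀ c : ι → O, (∀ I, c I ∈ T m) → ϖ m ∣ ∑ I, c I ^ p * M m I → ∀ I, ϖ m ∣ c I)
    (a : ι → O) (ha : ∀ I, a I ∈ T m) (hd : ϖ (m + 1) ∣ ∑ I, a I * M (m + 1) I) :
    ∀ I, ϖ m ∣ a I := by
  apply C a ha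
  have := h.frobM m a (x := 0) (by rw [zero_sub, dvd_neg]; exact hd)
  rwa [zero_pow (Fact.out : p.Prime).ne_zero, zero_sub, dvd_neg] at this

theorem Twr.C (h : Twr p T ϖ M) (m : ℕ) : ∀ c : ι → O, (∀ I, c I ∈ T m) →
    ϖ m ∣ ∑ I, c I ^ p * M m I → ∀ I, ϖ m ∣ c I := by
  induction m with
  | zero => simpa only [h.h0] using h.c0
  | succ m ih =>
    intro c hc hd I
    choose a x' ha hx' hcx using fun I => h.gen' m (c I) (hc I)
    have h1 : ∀ I, ϖ m ∣ c I ^ p - ∑ J, a I J ^ p * M m J := fun I =>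
      h.frobM m (a I) ⟨x' I, by linear_combination hcx I⟩
    have h12 : ϖ (m + 1) ∣ ϖ m := by
      rw [← h.h1 m]; exact dvd_pow_self _ (Fact.out : p.Prime).ne_zero
    have h2 : ϖ (m + 1) ∣ ∑ I, (∑ J, a I J ^ p * M m J) * M (m + 1) I := by
      have h3 : ϖ (m + 1) ∣ ∑ I, (c I ^ p - ∑ J, a I J ^ p * M m J) * M (m + 1) I :=
        Finset.dvd_sum fun I _ => (h12.trans (h1 I)).mul_right _
      have h4 := dvd_sub hd h3
      rw [← Finset.sum_sub_distrib] at h4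
      convert h4 using 2
      ring
    have h5 := h.uniq m ih _ (fun I => sum_mem fun J _ =>
      mul_mem (pow_mem (ha I J) _) (h.hMT _ _)) h2 I
    have h6 := ih (a I) (ha I) h5
    rw [hcx I]
    exact dvd_add (Finset.dvd_sum fun J _ => (h12.trans (h6 J)).mul_right _) (dvd_mul_right _ _)

theorem Twr.A (h : Twr p T ϖ M) (m : ℕ) : ∀ y, ϖ m * y ∈ T m → y ∈ T m := by
  induction m with
  | zero => simpa only [h.h0] using h.a0
  | succ m ih =>
    intro y hy
    obtain ⟨a, x', ha, hx', he⟩ := h.gen' m _ hy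
    have h1 := h.uniq m (h.C m) a ha ⟨y - x', by linear_combination -he⟩
    choose b hb using h1
    obtain ⟨k, hk⟩ : ∃ k, p = k + 1 := ⟨p - 1, by have := (Fact.out : p.Prime).pos; omega⟩
    have h2 : ϖ m = ϖ (m + 1) * ϖ (m + 1) ^ k := by rw [← pow_succ', ← hk, h.h1]
    have h3 : y = ϖ (m + 1) ^ k * ∑ I, b I * M (m + 1) I + x' := by
      apply mul_left_cancel₀ (h.ϖne (m + 1))
      rw [he, mul_add, ← mul_assoc, ← h2, Finset.mul_sum]
      congr 1
      exact Finset.sum_congr rfl fun I _ => by rw [hb I]; ring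
    rw [h3]
    refine add_mem (mul_mem (pow_mem (h.hϖ _) _) (sum_mem fun I _ => mul_mem (h.mono _ ?_)
      (h.hMT _ _))) hx'
    apply ih
    rw [← hb]; exact ha I

theorem Twr.B (h : Twr p T ϖ M) (m : ℕ) : ∀ x ∈ T m, ∃ c : ι → O, (∀ I, c I ∈ T m) ∧
    ϖ m ∣ x - ∑ I, c I ^ p * M m I := by
  induction m with
  | zero => simpa only [h.h0] using h.b0
  | succ m ih =>
    intro x hx
    obtain ⟨a, x', ha, hx', rfl⟩ := h.gen' m _ hx
    choose c hc hd using fun I => ih (a I) (ha I)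
    refine ⟨fun I => ∑ J, c I J * M (m + 1) J, fun I => sum_mem fun J _ =>
      mul_mem (h.mono _ (hc _ _)) (h.hMT _ _), ?_⟩
    have h12 : ϖ (m + 1) ∣ ϖ m := by
      rw [← h.h1 m]; exact dvd_pow_self _ (Fact.out : p.Prime).ne_zero
    have h1 : ∀ I, ϖ m ∣ (∑ J, c I J * M (m + 1) J) ^ p - a I := fun I => by
      have := dvd_sub (h.frobM m (c I) (x := ∑ J, c I J * M (m + 1) J) (by simp)) (hd I)
      convert this using 1
      ring
    have h2 : ϖ (m + 1) ∣ ∑ I, ((∑ J, c I J * M (m + 1) J) ^ p - a I) * M (m + 1) I :=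
      Finset.dvd_sum fun I _ => (h12.trans (h1 I)).mul_right _
    have h3 := dvd_sub (dvd_mul_right (ϖ (m + 1)) x') h2
    convert h3 using 1
    simp only [sub_mul, Finset.sum_sub_distrib]
    ring

theorem Twr.le (h : Twr p T ϖ M) : Monotone T := monotone_nat_of_le_succ h.mono

theorem Twr.mem (h : Twr p T ϖ M) {x : O} : x ∈ (⨆ m, T m) ↔ ∃ m, x ∈ T m :=
  Subring.mem_iSup_of_directed h.le.directed_le

theorem Twr.A_pow (h : Twr p T ϖ M) (m l : ℕ) : ∀ y, ϖ m ^ l * y ∈ T m → y ∈ T m := by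
  induction l with
  | zero => simp
  | succ l ih => exact fun y hy => h.A m _ (ih _ (by rwa [pow_succ, mul_assoc] at hy))

theorem Twr.E1 (h : Twr p T ϖ M) (y : O) (hy : (p : O) * y ∈ ⨆ m, T m) : y ∈ ⨆ m, T m := by
  obtain ⟨m, hm⟩ := h.mem.1 hy
  exact h.mem.2 ⟨m, h.A_pow m (p ^ m) y (by rwa [h.pw])⟩

theorem Twr.E1' (h : Twr p T ϖ M) (m : ℕ) (y : O) (hy : ϖ m * y ∈ ⨆ m, T m) :
    y ∈ ⨆ m, T m := by
  apply h.E1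
  obtain ⟨k, hk⟩ : ∃ k, p ^ m = k + 1 := ⟨p ^ m - 1, by
    have := pow_pos (Fact.out : p.Prime).pos m; omega⟩
  rw [← h.pw m, hk, pow_succ, mul_assoc]
  exact mul_mem (pow_mem (h.mem.2 ⟨m, h.hϖ m⟩) _) hy

theorem Twr.E2 (h : Twr p T ϖ M) (x : O) (hx : x ∈ ⨆ m, T m) :
    ∃ y ∈ ⨆ m, T m, (p : O) ∣ x - y ^ p := by
  obtain ⟨m, hm⟩ := h.mem.1 hx
  have key : ∀ l, ∀ x ∈ T m, ∃ y ∈ ⨆ m, T m, ∃ z ∈ T m, (p : O) ∣ x - y ^ p - ϖ m ^ l * z := by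
    intro l
    induction l with
    | zero => exact fun x hx => ⟨0, zero_mem _, x, hx, by
        simp [zero_pow (Fact.out : p.Prime).ne_zero]⟩
    | succ l ih =>
      intro x hx
      obtain ⟨c, hc, t, ht⟩ := h.B m x hx
      have htT : t ∈ T m := by
        apply h.A m
        rw [← ht]
        exact sub_mem hx (sum_mem fun I _ => mul_mem (pow_mem (hc I) _) (h.hMT _ _))
      obtain ⟨y, hy, z, hz, hd⟩ := ih t htT
      refine ⟨(∑ I, c I * M (m + 1) I) + ϖ (m + 1) * y, ?_, z, hz, ?_⟩
      · refine add_mem (h.mem.2 ⟨m + 1, sum_mem fun I _ => mul_mem (h.mono _ (hc I)) (h.hMT _ _)⟩)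
          (mul_mem (h.mem.2 ⟨m + 1, h.hϖ _⟩) hy)
      · have h1 := frob_add_dvd p (dvd_refl (p : O)) (∑ I, c I * M (m + 1) I) (ϖ (m + 1) * y)
        have h2 := frob_sum_dvd p (dvd_refl (p : O)) Finset.univ (fun I => c I * M (m + 1) I)
        simp only [mul_pow, h.hM, h.h1] at h1 h2
        have h3 := dvd_sub (dvd_sub (hd.mul_left (ϖ m)) h1) h2
        convert h3 using 1
        linear_combination ht
  obtain ⟨y, hy, z, hz, hd⟩ := key (p ^ m) x hm
  refine ⟨y, hy, ?_⟩
  rw [h.pw] at hd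
  simpa using dvd_add hd (dvd_mul_right (p : O) z)

theorem Twr.uniq_p (h : Twr p T ϖ M) (m : ℕ) (a : ℕ → ι → O) (ha : ∀ l I, a l I ∈ T m)
    (hd : ϖ m ∣ ∑ l ∈ Finset.range p, ϖ (m + 1) ^ l * ∑ I, a l I * M (m + 1) I) :
    ∀ l < p, ∀ I, ϖ m ∣ a l I := by
  intro l
  induction l using Nat.strong_induction_on with
  | _ l ih =>
    intro hl
    apply h.uniq m (h.C m) (a l) (ha l)
    have h12 : ϖ (m + 1) ^ (l + 1) ∣ ϖ m := by
      rw [← h.h1 m]; exact pow_dvd_pow _ hl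
    have h1 : ϖ m ∣ ∑ l ∈ Finset.range l, ϖ (m + 1) ^ l * ∑ I, a l I * M (m + 1) I :=
      Finset.dvd_sum fun l' hl' => Dvd.dvd.mul_left (Finset.dvd_sum fun I _ =>
        (ih l' (Finset.mem_range.1 hl') ((Finset.mem_range.1 hl').trans hl) I).mul_right _) _
    have h2 : ϖ (m + 1) ^ (l + 1) ∣ ∑ l ∈ Finset.Ico (l + 1) p,
        ϖ (m + 1) ^ l * ∑ I, a l I * M (m + 1) I :=
      Finset.dvd_sum fun l' hl' => (pow_dvd_pow _ (Finset.mem_Ico.1 hl').1).mul_right _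
    have h3 := dvd_sub (dvd_sub (h12.trans hd) h2) (h12.trans h1)
    rw [← Finset.sum_range_add_sum_Ico _ hl, Finset.sum_range_succ, add_sub_cancel_right,
      add_sub_cancel_left, pow_succ] at h3
    exact (mul_dvd_mul_iff_left (pow_ne_zero l (h.ϖne _))).1 h3

theorem Twr.flat1 (h : Twr p T ϖ M) (m : ℕ) :
    EqFlat (Subring.inclusion (h.mono m)) (⟨ϖ m, h.hϖ m⟩ : T m) := by
  intro κ _ x y hxy
  choose a ha hay using fun k => h.gen m (y k) (y k).2
  have hd : ϖ m ∣ ∑ l ∈ Finset.range p, ϖ (m + 1) ^ l *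
      ∑ I, (∑ k, (x k : O) * a k l I) * M (m + 1) I := by
    have h1 := map_dvd (T (m + 1)).subtype hxy
    rw [map_sum] at h1
    change ϖ m ∣ ∑ k, (x k : O) * (y k : O) at h1
    convert h1 using 1
    simp only [hay, Finset.mul_sum, Finset.sum_mul]
    rw [Finset.sum_comm]
    conv_rhs => rw [Finset.sum_comm]
    rw [Finset.sum_comm]
    refine Finset.sum_congr rfl fun l _ => ?_
    conv_rhs => rw [Finset.sum_comm]
    exact Finset.sum_congr rfl fun I _ => Finset.sum_congr rfl fun k _ => by ring
  have h2 := h.uniq_p m _ (fun l I => sum_mem fun k _ => mul_mem (x k).2 (ha k l I)) hd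
  refine ⟨Fin p × ι, inferInstance, fun s k => ⟨a k s.1 s.2, ha _ _ _⟩,
    fun s => ⟨ϖ (m + 1) ^ (s.1 : ℕ) * M (m + 1) s.2, mul_mem (pow_mem (h.hϖ _) _) (h.hMT _ _)⟩,
    fun s => ?_, fun k => ?_⟩
  · obtain ⟨t, ht⟩ := h2 s.1 s.1.2 s.2
    refine ⟨⟨t, h.A m t ?_⟩, ?_⟩
    · rw [← ht]; exact sum_mem fun k _ => mul_mem (x k).2 (ha k _ _)
    · ext
      change (T m).subtype _ = ϖ m * t
      rw [map_sum, ← ht]; rfl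
  · ext
    change (y k : O) = (T (m + 1)).subtype _
    rw [map_sum, hay k, Fintype.sum_prod_type, Finset.sum_range]
    refine Finset.sum_congr rfl fun l _ => ?_
    rw [Finset.mul_sum]
    refine Finset.sum_congr rfl fun I _ => ?_
    change _ = ϖ (m + 1) ^ (l : ℕ) * M (m + 1) I * a k l I
    ring

theorem Twr.flatm (h : Twr p T ϖ M) (m : ℕ) :
    EqFlat (Subring.inclusion (h.le (Nat.zero_le m))) (p : T 0) := by
  induction m with
  | zero =>
    intro κ _ x y hxy
    refine ⟨Unit, inferInstance, fun _ => y, fun _ => 1, fun _ => hxy, fun i => ?_⟩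
    simp only [Finset.univ_unique, Finset.sum_singleton, one_mul]; rfl
  | succ m ih =>
    have h1 := EqFlat.pow (h.flat1 m) (fun b hb => by
      have h2 : ϖ m * (b : O) = 0 := congrArg (T (m + 1)).subtype hb
      exact Subtype.ext ((mul_eq_zero.1 h2).resolve_left (h.ϖne m))) (p ^ m)
    have h3 : (⟨ϖ m, h.hϖ m⟩ : T m) ^ p ^ m = p := Subtype.ext (by
      change ϖ m ^ p ^ m = _
      rw [h.pw]; rfl)
    rw [h3] at h1
    exact ih.comp (g := Subring.inclusion (h.mono m)) (by rwa [map_natCast])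

theorem Twr.flat (h : Twr p T ϖ M) :
    EqFlat (Subring.inclusion (le_iSup T 0)) (p : T 0) := by
  intro κ _ x y ⟨z, hz⟩
  choose n hn using fun k => h.mem.1 (y k).2
  obtain ⟨l, hl⟩ := h.mem.1 z.2
  let N := l + ∑ k, n k
  have hnN : ∀ k, n k ≤ N := fun k =>
    (Finset.single_le_sum (f := n) (fun _ _ => Nat.zero_le _) (Finset.mem_univ k)).trans
      (Nat.le_add_left _ _)
  have hz' := congrArg (⨆ m, T m).subtype hz
  rw [map_sum] at hz'
  obtain ⟨κ', i', b, w, hb, hw⟩ := h.flatm N κ x (fun k => ⟨y k, h.le (hnN k) (hn k)⟩)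
    ⟨⟨z, h.le (Nat.le_add_right _ _) hl⟩, Subtype.ext (by
      change (T N).subtype _ = _
      rw [map_sum]; exact hz')⟩
  refine ⟨κ', i', b, fun s => Subring.inclusion (le_iSup T N) (w s), hb, fun k => Subtype.ext ?_⟩
  have h2 := congrArg (T N).subtype (hw k)
  rw [map_sum] at h2
  change (y k : O) = (⨆ m, T m).subtype _
  rw [map_sum]
  exact h2

end twr

theorem EqFlat.of_dense {A B : Type} [CommRing A] [CommRing B] {f : A →+* B} {a : A}
    (hd : ∀ y, ∃ e s, y = f e + f a * s) (hi : ∀ e, f a ∣ f e → a ∣ e) : EqFlat f a := by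
  classical
  intro ι _ x y hxy
  choose e s hes using fun k => hd (y k)
  refine ⟨Option ι, inferInstance, fun o => o.elim e (fun k => Pi.single k a),
    fun o => o.elim 1 s, ?_, fun k => ?_⟩
  · rintro (_ | k)
    · apply hi
      rw [map_sum]
      have h1 : f a ∣ ∑ k, f (x k) * (f a * s k) :=
        Finset.dvd_sum fun k _ => (dvd_mul_right _ _).mul_left _
      have h2 := dvd_sub hxy h1
      rw [← Finset.sum_sub_distrib] at h2
      convert h2 using 2 with k
      simp only [Option.elim]
      rw [hes k, map_mul]; ring
    · refine Finset.dvd_sum fun l _ => ?_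
      simp only [Option.elim]
      rcases eq_or_ne l k with rfl | h
      · simp
      · simp [Pi.single_eq_of_ne h]
  · rw [Fintype.sum_option, hes k]
    simp only [Option.elim, one_mul]
    congr 1
    rw [Finset.sum_eq_single k]
    · simp [mul_comm]
    · intro l _ h
      rw [Pi.single_eq_of_ne h.symm, map_zero, mul_zero]
    · simp

section base
variable {p : ℕ} [Fact p.Prime] {O S : Type} [CommRing O] [IsDomain O] [CommRing S]
  [Fact ¬IsUnit (p : S)] [IsAdicComplete (Ideal.span {(p : S)}) S]
  {i : O →+* S} {ϖ : ℕ → O}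

/-- The perfect ring attached to a subring. -/
def Q0 (p : ℕ) [Fact p.Prime] [Fact ¬IsUnit (p : S)] (i : O →+* S) (E : Subring O) :
    Subring (PreTilt S p) where
  carrier := {x | ∀ n, ∃ e ∈ E, PreTilt.coeff n x = Ideal.Quotient.mk (Ideal.span {(p : S)}) (i e)}
  mul_mem' := by
    intro x y hx hy n
    obtain ⟨e, he, h1⟩ := hx n
    obtain ⟨e', he', h2⟩ := hy n
    exact ⟨e * e', mul_mem he he', by rw [map_mul, h1, h2, map_mul, map_mul]⟩
  one_mem' := fun n => ⟨1, one_mem _, by rw [map_one, map_one, map_one]⟩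
  add_mem' := by
    intro x y hx hy n
    obtain ⟨e, he, h1⟩ := hx n
    obtain ⟨e', he', h2⟩ := hy n
    exact ⟨e + e', add_mem he he', by rw [map_add, h1, h2, map_add, map_add]⟩
  zero_mem' := fun n => ⟨0, zero_mem _, by rw [map_zero, map_zero, map_zero]⟩
  neg_mem' := by
    intro x hx n
    obtain ⟨e, he, h1⟩ := hx n
    exact ⟨-e, neg_mem he, by rw [map_neg, h1, map_neg, map_neg]⟩

instance Q0.charP (E : Subring O) : CharP (Q0 p i E) p :=
  (Q0 p i E).subtype.charP Subtype.val_injective p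

instance Q0.perfect (E : Subring O) : PerfectRing (Q0 p i E) p := by
  refine ⟨fun x y hxy => Subtype.ext (perf_inj p 1 ?_), fun x => ?_⟩
  · rw [pow_one]; exact congrArg Subtype.val hxy
  refine ⟨⟨(frobeniusEquiv (PreTilt S p) p).symm x, fun n => ?_⟩, Subtype.ext ?_⟩
  · obtain ⟨e, he, h⟩ := x.2 (n + 1)
    exact ⟨e, he, by rw [← h]; exact PreTilt.coeff_iterate_frobeniusEquiv_symm n 1 (x : PreTilt S p)⟩
  · change ((frobeniusEquiv (PreTilt S p) p).symm x) ^ p = x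
    exact frobeniusEquiv_symm_pow_p _ _ _

variable (hS : PS p i ϖ) (E : Subring O) (hE1 : ∀ m y, ϖ m * y ∈ E → y ∈ E)
  (hE2 : ∀ x ∈ E, ∃ y ∈ E, (p : O) ∣ x - y ^ p) (hϖ : ∀ m, ϖ m ∈ E)

/-- The base stage. -/
def baseStg : Stg hS where
  Q := Q0 p i E
  π := ⟨hS.pf, fun n => ⟨ϖ n, hϖ n, coeff_tlt _ _ n⟩⟩
  nzd := fun b hb => Subtype.ext (hS.pf_nzd b (congrArg Subtype.val hb))
  f := (Q0 p i E).subtype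
  hf := rfl

theorem base_div (hE1 : ∀ m y, ϖ m * y ∈ E → y ∈ E) (x : (baseStg hS E hϖ).Q)
    (hx : PreTilt.coeff 0 ((baseStg hS E hϖ).f x) = 0) : (baseStg hS E hϖ).π ∣ x := by
  choose Y hYE hY using x.2
  obtain ⟨y', h1, h2⟩ := hS.pf_dvd' _ hx Y hY
  refine ⟨⟨y', fun n => ?_⟩, Subtype.ext h1⟩
  obtain ⟨z, hz, h3⟩ := h2 n
  exact ⟨z ^ p, pow_mem (hE1 (n + 1) z (by rw [hz]; exact hYE _)) _, h3⟩

theorem base_inj (hE1 : ∀ m y, ϖ m * y ∈ E → y ∈ E) :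
    Function.Injective (baseStg hS E hϖ).χ := by
  rw [injective_iff_map_eq_zero]
  intro b hb
  obtain ⟨x, rfl⟩ := BQ.mk_surj p b
  rw [BQ.mk_eq_zero]
  exact theta_ker hS _ (baseStg hS E hϖ).hf (base_div hS E hϖ hE1) x hb

theorem base_dvd (hE1 : ∀ m y, ϖ m * y ∈ E → y ∈ E) (b : (baseStg hS E hϖ).B)
    (hb : (p : S) ∣ (baseStg hS E hϖ).χ b) : (p : (baseStg hS E hϖ).B) ∣ b := by
  obtain ⟨x, rfl⟩ := BQ.mk_surj p b
  rw [← BQ.mk_p]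
  refine BQ.dvd_of_coeff p (base_div hS E hϖ hE1 _ ?_) dvd_rfl
  rw [Stg.χ_mk] at hb
  have h1 := WittVector.mk_fontaineTheta (R := S) (p := p) (WittVector.map (baseStg hS E hϖ).f x)
  rw [WittVector.map_coeff] at h1
  rw [← h1]
  exact Ideal.Quotient.eq_zero_iff_mem.2 (Ideal.mem_span_singleton.2 hb)

theorem base_lift0 (hE2 : ∀ x ∈ E, ∃ y ∈ E, (p : O) ∣ x - y ^ p) (e : O) (he : e ∈ E) :
    ∃ x : Q0 p i E, PreTilt.coeff 0 (x : PreTilt S p) =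
      Ideal.Quotient.mk (Ideal.span {(p : S)}) (i e) := by
  choose g hg hgd using hE2
  let s : ℕ → E := fun n => Nat.rec ⟨e, he⟩ (fun _ y => ⟨g y y.2, hg y y.2⟩) n
  have hs : ∀ n, (p : O) ∣ (s n).1 - (s (n + 1)).1 ^ p := fun n => by
    have h := hgd (s n).1 (s n).2
    exact h
  have hd : ∀ n, (p : S) ∣ i (s (n + 1)).1 ^ p - i (s n).1 := fun n => by
    have := map_dvd i (hs n)
    rw [dvd_sub_comm]
    simpa using this
  exact ⟨⟨tlt (fun n => i (s n).1) hd, fun n => ⟨(s n).1, (s n).2, coeff_tlt _ hd n⟩⟩,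
    coeff_tlt _ hd 0⟩

theorem base_coeff (b : (baseStg hS E hϖ).B) : ∃ e ∈ E, (p : S) ∣ (baseStg hS E hϖ).χ b - i e := by
  obtain ⟨x, rfl⟩ := BQ.mk_surj p b
  obtain ⟨e, he, h⟩ := (x.coeff 0).2 0
  refine ⟨e, he, ?_⟩
  have h1 := WittVector.mk_fontaineTheta (R := S) (p := p) (WittVector.map (baseStg hS E hϖ).f x)
  rw [WittVector.map_coeff] at h1
  rw [Stg.χ_mk, ← Ideal.mem_span_singleton, ← Ideal.Quotient.eq]
  exact h1.trans h

theorem base_untilt (x : Q0 p i E) (M : ℕ) : ∃ e ∈ E, (p : S) ^ M ∣ (x : PreTilt S p).untilt - i e := by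
  obtain ⟨e, he, h⟩ := x.2 M
  refine ⟨e ^ p ^ M, pow_mem he _, ?_⟩
  rw [← PreTilt.untilt_iterate_frobeniusEquiv_symm_pow (x : PreTilt S p) M, map_pow]
  refine (pow_dvd_pow _ (Nat.le_succ M)).trans (dvd_sub_pow_of_dvd_sub ?_ M)
  rw [← Ideal.mem_span_singleton, ← Ideal.Quotient.eq, PreTilt.mk_untilt_eq_coeff_zero,
    PreTilt.coeff_iterate_frobeniusEquiv_symm, zero_add, h]

theorem base_surj (hE1 : ∀ m y, ϖ m * y ∈ E → y ∈ E)
    (hE2 : ∀ x ∈ E, ∃ y ∈ E, (p : O) ∣ x - y ^ p) (e : O) (he : e ∈ E) :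
    ∃ b, (baseStg hS E hϖ).χ b = i e := by
  let P : S → Prop := fun s => ∀ M, ∃ e ∈ E, (p : S) ^ M ∣ s - i e
  have step : ∀ s, P s → ∃ (x : Q0 p i E) (s' : S), s = (x : PreTilt S p).untilt + p * s' ∧
      P s' := by
    intro s hs
    obtain ⟨e, he, h1⟩ := hs 1
    obtain ⟨x, hx⟩ := base_lift0 (i := i) E hE2 e he
    have h2 : (p : S) ∣ s - (x : PreTilt S p).untilt := by
      rw [← PreTilt.mk_untilt_eq_coeff_zero, Ideal.Quotient.eq, Ideal.mem_span_singleton] at hx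
      rw [pow_one] at h1
      have := dvd_sub h1 hx
      convert this using 1
      ring
    obtain ⟨s', hs'⟩ := h2
    refine ⟨x, s', by linear_combination hs', fun M => ?_⟩
    obtain ⟨e1, he1, h3⟩ := hs (M + 1)
    obtain ⟨e2, he2, h4⟩ := base_untilt E x (M + 1)
    obtain ⟨t, ht⟩ := dvd_sub h3 h4
    have h5 : (p : S) ^ 1 ∣ i (e1 - e2) := ⟨s' - p ^ M * t, by
      rw [map_sub]; linear_combination -ht + hs'⟩
    obtain ⟨e', he'⟩ := hS.hinj 1 _ h5
    refine ⟨e', hE1 0 _ ?_, t, ?_⟩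
    · rw [hS.h0, ← pow_one (p : O), ← he']; exact sub_mem he1 he2
    · rw [← sub_eq_zero]
      apply hS.nzd
      have h6 := congrArg i he'
      rw [map_mul, map_pow, map_natCast, map_sub] at h6
      linear_combination -hs' + ht + h6
  choose! X s' hX hP using step
  let ss : ℕ → S := fun n => s'^[n] (i e)
  have hss : ∀ n, P (ss n) := by
    intro n
    induction n with
    | zero => exact fun M => ⟨e, he, by simp [ss]⟩
    | succ n ih =>
      simp only [ss, Function.iterate_succ_apply']
      exact hP _ ih
  have hsum : ∀ n, i e = ∑ k ∈ Finset.range n, p ^ k * (X (ss k) : PreTilt S p).untilt +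
      p ^ n * ss n := by
    intro n
    induction n with
    | zero => simp [ss]
    | succ n ih =>
      rw [Finset.sum_range_succ]
      have h4 := hX _ (hss n)
      have h5 : ss (n + 1) = s' (ss n) := by simp only [ss, Function.iterate_succ_apply']
      rw [h5, pow_succ]
      linear_combination ih + p ^ n * h4
  obtain ⟨y, hy⟩ := prec_p p fun k => WittVector.teichmuller p (X (ss k))
  refine ⟨BQ.mk p _ _ y, ?_⟩
  rw [← sub_eq_zero]
  apply haus_p p
  intro M
  let Γ : WittVector p (Q0 p i E) →+* S :=
    (baseStg hS E hϖ).χ.comp (BQ.mk p (baseStg hS E hϖ).Q (baseStg hS E hϖ).π)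
  have h1 := map_dvd Γ (hy M)
  rw [map_pow, map_natCast, map_sub, map_sum] at h1
  have h2 : ∀ k, Γ
      ((p : WittVector p (Q0 p i E)) ^ k * WittVector.teichmuller p (X (ss k))) =
      p ^ k * (X (ss k) : PreTilt S p).untilt := by
    intro k
    rw [map_mul, map_pow, map_natCast]
    have h3 : Γ (WittVector.teichmuller p (X (ss k))) = _ :=
      Stg.χ_teich (baseStg hS E hϖ) (X (ss k))
    rw [h3]; rfl
  simp only [h2] at h1
  obtain ⟨t, ht⟩ := h1
  refine ⟨t - ss M, ?_⟩
  change Γ y - i e = _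
  linear_combination ht - hsum M

theorem base_good {A : Type} [CommRing A] (j : A →+* O) (hE1 : ∀ m y, ϖ m * y ∈ E → y ∈ E)
    (hE2 : ∀ x ∈ E, ∃ y ∈ E, (p : O) ∣ x - y ^ p) (φ : A →+* E) (hφ : ∀ a, (φ a : O) = j a)
    (hfl : EqFlat φ (p : A)) :
    ∃ φ' : A →+* (baseStg hS E hϖ).B, Good j (baseStg hS E hϖ) φ' := by
  have hinj := base_inj hS E hϖ hE1
  choose g hg using fun e : E => base_surj hS E hϖ hE1 hE2 e e.2
  let ε : E →+* (baseStg hS E hϖ).B :=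
    { toFun := g
      map_one' := hinj (by rw [hg, map_one]; exact map_one i)
      map_zero' := hinj (by rw [hg, map_zero]; exact map_zero i)
      map_add' := fun x y => hinj (by rw [hg, map_add, hg, hg]; exact map_add i _ _)
      map_mul' := fun x y => hinj (by rw [hg, map_mul, hg, hg]; exact map_mul i _ _) }
  have hε : ∀ e : E, (baseStg hS E hϖ).χ (ε e) = i e := hg
  refine ⟨ε.comp φ, hfl.comp ?_, fun a => by rw [RingHom.comp_apply, hε, hφ]⟩
  rw [map_natCast]
  refine EqFlat.of_dense (fun y => ?_) (fun e he => ?_)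
  · obtain ⟨e, he, h1⟩ := base_coeff hS E hϖ y
    obtain ⟨s, hs⟩ := base_dvd hS E hϖ hE1 (y - ε ⟨e, he⟩) (by rw [map_sub, hε]; exact h1)
    exact ⟨⟨e, he⟩, s, by rw [map_natCast]; linear_combination hs⟩
  · rw [map_natCast] at he
    have h1 := map_dvd (baseStg hS E hϖ).χ he
    rw [hε, map_natCast] at h1
    obtain ⟨t, ht⟩ := hS.hinj 1 (e : O) (by rwa [pow_one])
    rw [pow_one] at ht
    refine ⟨⟨t, hE1 0 t (by rw [hS.h0, ← ht]; exact e.2)⟩, Subtype.ext ?_⟩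
    exact ht

end base

theorem dvd_of_integral {A O : Type} [CommRing A] [CommRing O] [IsDomain O] (j : A →+* O)
    (hj : Function.Injective j) (hji : j.IsIntegral) (q : A) (hq : (Ideal.span {q}).IsPrime)
    (a : A) (h : j q ∣ j a) : q ∣ a := by
  let _ := j.toAlgebra
  have : Algebra.IsIntegral A O := ⟨hji⟩
  obtain ⟨P, hP, hPc⟩ := Ideal.exists_ideal_over_prime_of_isIntegral_of_isDomain (S := O)
    (Ideal.span {q}) (by rw [(RingHom.injective_iff_ker_eq_bot _).1 (show Function.Injective (algebraMap A O) from hj)]; exact bot_le)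
  have hqP : j q ∈ P := by
    have : q ∈ Ideal.comap (algebraMap A O) P := by rw [hPc]; exact Ideal.mem_span_singleton_self q
    exact this
  rw [← Ideal.mem_span_singleton, ← hPc]
  exact P.mem_of_dvd h hqP

section tower
variable {O κ : Type} [CommRing O] [Fintype κ] [DecidableEq κ]

/-- The tower of subrings. -/
noncomputable def tow (T0 : Subring O) (g : ℕ → Option κ → O) : ℕ → Subring O
  | 0 => T0
  | m + 1 => (MvPolynomial.eval₂Hom (tow T0 g m).subtype (g (m + 1))).range

theorem tow_mono (T0 : Subring O) (g : ℕ → Option κ → O) (m : ℕ) :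
    tow T0 g m ≤ tow T0 g (m + 1) := fun x hx => ⟨MvPolynomial.C ⟨x, hx⟩, by simp⟩

theorem tow_mem (T0 : Subring O) (g : ℕ → Option κ → O) (h0 : ∀ o, g 0 o ∈ T0) (m : ℕ) (o) :
    g m o ∈ tow T0 g m := by
  cases m with
  | zero => exact h0 o
  | succ m => exact ⟨MvPolynomial.X o, by simp⟩

theorem tow_gen (p : ℕ) (hp : 0 < p) (T0 : Subring O) (g : ℕ → Option κ → O) (h0 : ∀ o, g 0 o ∈ T0)
    (hg : ∀ m o, g (m + 1) o ^ p = g m o) (m : ℕ) (x : O) (hx : x ∈ tow T0 g (m + 1)) :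
    ∃ a : ℕ → (κ → Fin p) → O, (∀ l I, a l I ∈ tow T0 g m) ∧
      x = ∑ l ∈ Finset.range p, g (m + 1) none ^ l *
        ∑ I, a l I * ∏ k, g (m + 1) (some k) ^ (I k).val := by
  obtain ⟨P, hPx⟩ := hx
  induction P using MvPolynomial.induction_on' generalizing x with
  | add P Q hP hQ =>
    obtain ⟨a, ha, h1⟩ := hP _ rfl
    obtain ⟨b, hb, h2⟩ := hQ _ rfl
    refine ⟨fun l I => a l I + b l I, fun l I => add_mem (ha l I) (hb l I), ?_⟩
    rw [← hPx, map_add, h1, h2, ← Finset.sum_add_distrib]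
    refine Finset.sum_congr rfl fun l _ => ?_
    rw [← mul_add, ← Finset.sum_add_distrib]
    congr 1
    exact Finset.sum_congr rfl fun l _ => (add_mul _ _ _).symm
  | monomial s c =>
    have hmod : ∀ n : ℕ, ∀ o, g (m + 1) o ^ n = g m o ^ (n / p) * g (m + 1) o ^ (n % p) := by
      intro n o
      rw [← hg m o, ← pow_mul, ← pow_add, Nat.div_add_mod]
    let I0 : κ → Fin p := fun k => ⟨s (some k) % p, Nat.mod_lt _ hp⟩
    let C : O := c.1 * (g m none ^ (s none / p) * ∏ k, g m (some k) ^ (s (some k) / p))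
    have hC : C ∈ tow T0 g m := mul_mem c.2 (mul_mem (pow_mem (tow_mem T0 g h0 _ _) _)
      (prod_mem fun k _ => pow_mem (tow_mem T0 g h0 _ _) _))
    refine ⟨fun l I => if l = s none % p ∧ I = I0 then C else 0, fun l I => ?_, ?_⟩
    · dsimp only
      split_ifs
      · exact hC
      · exact zero_mem _
    · dsimp only
      rw [← hPx, Finset.sum_eq_single (s none % p)]
      · rw [Finset.sum_eq_single I0]
        · rw [if_pos ⟨rfl, rfl⟩, MvPolynomial.coe_eval₂Hom, MvPolynomial.eval₂_monomial,
            Finsupp.prod_fintype _ _ (fun o => pow_zero _), Fintype.prod_option, hmod (s none),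
            Finset.prod_congr rfl (fun k _ => hmod (s (some k)) (some k)), Finset.prod_mul_distrib]
          simp only [C, I0, Subring.subtype_apply]
          ring
        · intro I _ hI
          rw [if_neg (fun h => hI h.2), zero_mul]
        · simp
      · intro l _ hl
        rw [Finset.sum_eq_zero, mul_zero]
        intro I _
        rw [if_neg (fun h => hl h.1), zero_mul]
      · intro h
        exact absurd (Finset.mem_range.2 (Nat.mod_lt _ hp)) h

end tower

theorem tower_good {p : ℕ} [Fact p.Prime] {O S κ A : Type} [CommRing O] [IsDomain O] [CommRing S]
    [Fact ¬IsUnit (p : S)] [IsAdicComplete (Ideal.span {(p : S)}) S] [Fintype κ] [DecidableEq κ] [CommRing A]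
    {i : O →+* S} {ϖ : ℕ → O} (hS : PS p i ϖ) (j : A →+* O) (hj : Function.Injective j)
    (hji : j.IsIntegral) (hpp : (Ideal.span {(p : A)}).IsPrime) (w : κ → A)
    (hα : ∀ a : A, ∃ c : (κ → Fin p) → A, (p : A) ∣ a - ∑ I, c I ^ p * ∏ k, w k ^ (I k).val)
    (hβ : ∀ c : (κ → Fin p) → A, (p : A) ∣ ∑ I, c I ^ p * ∏ k, w k ^ (I k).val → ∀ I, (p : A) ∣ c I) :
    ∃ (X : Stg hS) (φ : A →+* X.B), Good j X φ := by
  have hdv : ∀ a : A, (p : O) ∣ j a → (p : A) ∣ a := fun a h =>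
    dvd_of_integral j hj hji _ hpp a (by rwa [map_natCast])
  choose rt hrt using hS.hroot
  let ω : κ → ℕ → O := fun k n => Nat.rec (j (w k)) (fun _ y => rt y) n
  have hω : ∀ k n, ω k (n + 1) ^ p = ω k n := fun k n => hrt _
  let g : ℕ → Option κ → O := fun m o => o.elim (ϖ m) (fun k => ω k m)
  have h0 : ∀ o, g 0 o ∈ j.range := by
    rintro (_ | k)
    · exact ⟨(p : A), by simp [g, hS.h0]⟩
    · exact ⟨w k, rfl⟩
  have hg : ∀ m o, g (m + 1) o ^ p = g m o := by
    rintro m (_ | k)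
    · exact hS.h1 m
    · exact hω k m
  have ht : Twr p (tow j.range g) ϖ (fun m (I : κ → Fin p) => ∏ k, g m (some k) ^ (I k).val) := by
    refine ⟨tow_mono _ _, fun m => tow_mem j.range g h0 m none, fun m I =>
      prod_mem fun k _ => pow_mem (tow_mem j.range g h0 m _) _, hS.h0, hS.h1, fun m I => ?_, hS.hp0,
      fun m x hx => tow_gen p (Fact.out : p.Prime).pos j.range g h0 hg m x hx, ?_, ?_, ?_⟩
    · rw [← Finset.prod_pow]
      refine Finset.prod_congr rfl fun k _ => ?_
      rw [← pow_mul, mul_comm, pow_mul, hg]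
    · rintro y ⟨a, ha⟩
      obtain ⟨b, rfl⟩ := hdv a ⟨y, ha⟩
      rw [map_mul, map_natCast] at ha
      exact ⟨b, mul_left_cancel₀ hS.hp0 ha⟩
    · rintro x ⟨a, rfl⟩
      obtain ⟨c, hc⟩ := hα a
      refine ⟨fun I => j (c I), fun I => ⟨_, rfl⟩, ?_⟩
      have := map_dvd j hc
      simpa [g, ω] using this
    · intro c hc hd
      choose c' hc' using hc
      obtain rfl : c = fun I => j (c' I) := funext fun I => (hc' I).symm
      intro I
      have := hβ c' (hdv _ (by simpa [g, ω] using hd)) I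
      simpa using map_dvd j this
  have hle : ∀ a, j a ∈ tow j.range g 0 := fun a => ⟨a, rfl⟩
  let φ0 : A →+* tow j.range g 0 := j.codRestrict _ hle
  have hφ0 : EqFlat φ0 (p : A) := by
    refine EqFlat.of_dense ?_ ?_
    · rintro ⟨y, a, rfl⟩
      exact ⟨a, 0, by rw [mul_zero, add_zero]; rfl⟩
    · rintro a ⟨y, hy⟩
      refine hdv a ⟨y, ?_⟩
      have := congrArg Subtype.val hy
      simpa [φ0] using this
  have hfl := EqFlat.comp hφ0 (g := Subring.inclusion (le_iSup (tow j.range g) 0))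
    (by rw [map_natCast]; exact ht.flat)
  obtain ⟨φ', h⟩ := base_good hS (⨆ m, tow j.range g m) (fun m => ht.mem.2 ⟨m, ht.hϖ m⟩) j
    ht.E1' ht.E2 _ (fun a => rfl) hfl
  exact ⟨_, φ', h⟩

theorem exists_PS (p : ℕ) {O : Type} [CommRing O]
    (hroot : ∀ x : O, ∃ y, y ^ p = x) (hnorm : ∀ (a b : O) (n : ℕ), 0 < n → a ^ n ∣ b ^ n → a ∣ b)
    (hp0 : (p : O) ≠ 0) (hu : ¬ IsUnit (p : O)) :
    ∃ (S : Type) (_ : CommRing S) (_ : Fact ¬IsUnit (p : S))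
      (_ : IsAdicComplete (Ideal.span {(p : S)}) S) (i : O →+* S) (ϖ : ℕ → O), PS p i ϖ := by
  choose rt hrt using hroot
  have hm : (Ideal.span {(p : O)}).map (algebraMap O (AdicCompletion (Ideal.span {(p : O)}) O)) =
      Ideal.span {(p : AdicCompletion (Ideal.span {(p : O)}) O)} := by
    rw [Ideal.map_span, Set.image_singleton, map_natCast]
  have hfg : (Ideal.span {(p : O)}).FG := ⟨{(p : O)}, by simp⟩
  have hinj : ∀ M x, (p : AdicCompletion (Ideal.span {(p : O)}) O) ^ M ∣
      algebraMap O (AdicCompletion (Ideal.span {(p : O)}) O) x → (p : O) ^ M ∣ x := by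
    intro M x h
    have h1 := map_dvd (AdicCompletion.evalₐ (Ideal.span {(p : O)}) M) h
    rw [AlgHom.commutes, map_pow, map_natCast] at h1
    have h2 : ((p : O ⧸ Ideal.span {(p : O)} ^ M)) ^ M = 0 := by
      have : Ideal.Quotient.mk (Ideal.span {(p : O)} ^ M) ((p : O) ^ M) = 0 :=
        Ideal.Quotient.eq_zero_iff_mem.2 (Ideal.pow_mem_pow (Ideal.mem_span_singleton_self _) M)
      rwa [map_pow, map_natCast] at this
    rw [h2, zero_dvd_iff] at h1
    have h3 := Ideal.Quotient.eq_zero_iff_mem.1 h1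
    rwa [Ideal.span_singleton_pow, Ideal.mem_span_singleton] at h3
  refine ⟨AdicCompletion (Ideal.span {(p : O)}) O, inferInstance, ⟨fun h => ?_⟩, ?_,
    algebraMap _ _, fun n => Nat.rec (p : O) (fun _ y => rt y) n, ⟨fun x => ⟨rt x, hrt x⟩, hnorm, hp0,
      hinj, ?_, rfl, fun n => hrt _⟩⟩
  · have := hinj 1 1 (by rw [pow_one]; exact h.dvd)
    rw [pow_one] at this
    exact hu (isUnit_of_dvd_one this)
  · rw [← hm, IsAdicComplete.map_algebraMap_iff]
    exact AdicCompletion.isAdicComplete hfg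
  · intro M s
    obtain ⟨x, hx⟩ := Ideal.Quotient.mk_surjective (AdicCompletion.evalₐ (Ideal.span {(p : O)}) M s)
    have h1 : s - algebraMap O _ x ∈ (AdicCompletion.eval (Ideal.span {(p : O)}) O M).ker := by
      rw [LinearMap.mem_ker, ← AdicCompletion.factor_evalₐ_eq_eval _ _ (by simp), map_sub, AlgHom.commutes, ← hx]
      simp
    rw [← AdicCompletion.pow_smul_top_eq_ker_eval hfg, Ideal.span_singleton_pow,
      Submodule.ideal_span_singleton_smul, Submodule.mem_smul_pointwise_iff_exists] at h1
    obtain ⟨t, -, ht⟩ := h1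
    refine ⟨x, t, ?_⟩
    have h2 : (p : O) ^ M • t = (p : AdicCompletion (Ideal.span {(p : O)}) O) ^ M * t := by
      simp only [Algebra.smul_def, map_pow, map_natCast]
    rw [← h2, ht]
    ring

section rplus
variable (R : Type) [CommRing R] [IsDomain R]

theorem RPlus.root (n : ℕ) (hn : 0 < n) (x : RPlus R) : ∃ y, y ^ n = x := by
  obtain ⟨y, hy⟩ := IsAlgClosed.exists_pow_nat_eq (x : AlgebraicClosure (FractionRing R)) hn
  have : IsIntegral R y := IsIntegral.of_pow hn (by rw [hy]; exact x.2)
  exact ⟨⟨y, this⟩, Subtype.ext hy⟩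

theorem RPlus.norm (a b : RPlus R) (n : ℕ) (hn : 0 < n) (h : a ^ n ∣ b ^ n) : a ∣ b := by
  by_cases ha : a = 0
  · subst ha
    rw [zero_pow hn.ne', zero_dvd_iff] at h
    rw [pow_eq_zero_iff hn.ne' |>.1 h]
  obtain ⟨c, hc⟩ := h
  have ha' : (a : AlgebraicClosure (FractionRing R)) ≠ 0 := fun h => ha (Subtype.ext h)
  have : IsIntegral R ((b : AlgebraicClosure (FractionRing R)) / a) := by
    refine IsIntegral.of_pow hn ?_
    have : ((b : AlgebraicClosure (FractionRing R)) / a) ^ n = c := by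
      rw [div_pow, div_eq_iff (pow_ne_zero _ ha'), mul_comm]
      exact_mod_cast congrArg Subtype.val hc
    rw [this]
    exact c.2
  refine ⟨⟨_, this⟩, Subtype.ext ?_⟩
  change (b : AlgebraicClosure (FractionRing R)) = a * (b / a)
  rw [mul_div_cancel₀ _ ha']

theorem RPlus.inj : Function.Injective (algebraMap R (RPlus R)) := by
  intro a b h
  have h1 := congrArg (fun x : RPlus R => (x : AlgebraicClosure (FractionRing R))) h
  have h2 : algebraMap R (AlgebraicClosure (FractionRing R)) a =
    algebraMap R (AlgebraicClosure (FractionRing R)) b := h1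
  rw [IsScalarTower.algebraMap_apply R (FractionRing R), IsScalarTower.algebraMap_apply R (FractionRing R) _ b] at h2
  exact IsFractionRing.injective R (FractionRing R) ((algebraMap _ _).injective h2)

theorem RPlus.integral : (algebraMap R (RPlus R)).IsIntegral := fun x => Algebra.IsIntegral.isIntegral x

end rplus

theorem msp {A : Type} [CommRing A] {I : Ideal A} {a f : A} :
    f ∈ I ⊔ Ideal.span {a} ↔ ∃ h, f - a * h ∈ I := by
  rw [Submodule.mem_sup]
  constructor
  · rintro ⟨y, hy, z, hz, rfl⟩
    obtain ⟨h, rfl⟩ := Ideal.mem_span_singleton.1 hz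
    exact ⟨h, by simpa using hy⟩
  · rintro ⟨h, hh⟩
    exact ⟨_, hh, a * h, Ideal.mem_span_singleton.2 (dvd_mul_right _ _), by ring⟩

/-- Ideals generated by variables. -/
structure Nice (p : ℕ) {A : Type} [CommRing A] (I : Ideal A) : Prop where
  nz : ∀ f, (p : A) * f ∈ I → f ∈ I
  pr : (I ⊔ Ideal.span {(p : A)}).IsPrime
  hd : ∀ f, (∀ b : ℕ, f ∈ I ⊔ Ideal.span {(p : A) ^ b}) → f ∈ I

section nice
variable {p : ℕ} {A : Type} [CommRing A] {I : Ideal A}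

theorem Nice.pow (h : Nice p I) (N : ℕ) (f : A) (hf : (p : A) ^ N * f ∈ I) : f ∈ I := by
  induction N with
  | zero => simpa using hf
  | succ N ih => exact ih (h.nz _ (by rw [← mul_assoc, ← pow_succ']; exact hf))

theorem Nice.exp (h : Nice p I) (z : A) (hz : z ∉ I) :
    ∃ (b : ℕ) (z' : A), z - (p : A) ^ b * z' ∈ I ∧ z' ∉ I ⊔ Ideal.span {(p : A)} := by
  classical
  have h1 : ∃ b : ℕ, z ∉ I ⊔ Ideal.span {(p : A) ^ b} := by
    by_contra! h2
    exact hz (h.hd z h2)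
  obtain ⟨b, hb⟩ : ∃ b, Nat.find h1 = b + 1 := Nat.exists_eq_succ_of_ne_zero fun h0 => by
    have := Nat.find_spec h1
    rw [h0, pow_zero, Ideal.span_singleton_one, sup_top_eq] at this
    exact this trivial
  have h2 : z ∈ I ⊔ Ideal.span {(p : A) ^ b} := not_not.1 (Nat.find_min h1 (by omega))
  have h3 := Nat.find_spec h1
  rw [hb] at h3
  obtain ⟨z', hz'⟩ := msp.1 h2
  refine ⟨b, z', hz', fun h4 => h3 ?_⟩
  obtain ⟨w, hw⟩ := msp.1 h4
  refine msp.2 ⟨w, ?_⟩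
  convert I.add_mem hz' (I.mul_mem_left ((p : A) ^ b) hw) using 1
  ring

theorem Nice.mul (h : Nice p I) (z : A) (hz : z ∉ I ⊔ Ideal.span {(p : A)}) (N : ℕ) (g : A)
    (hg : z * g ∈ I ⊔ Ideal.span {(p : A) ^ N}) : g ∈ I ⊔ Ideal.span {(p : A) ^ N} := by
  induction N generalizing g with
  | zero => simp
  | succ N ih =>
    obtain ⟨w, hw⟩ := msp.1 hg
    have h1 : z * g ∈ I ⊔ Ideal.span {(p : A)} :=
      msp.2 ⟨(p : A) ^ N * w, by rw [← mul_assoc, ← pow_succ']; exact hw⟩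
    obtain ⟨g', hg'⟩ := msp.1 ((h.pr.mem_or_mem h1).resolve_left hz)
    have h2 : z * g' ∈ I ⊔ Ideal.span {(p : A) ^ N} := by
      refine msp.2 ⟨w, h.nz _ ?_⟩
      convert I.sub_mem hw (I.mul_mem_left z hg') using 1
      ring
    obtain ⟨k, hk⟩ := msp.1 (ih g' h2)
    refine msp.2 ⟨k, ?_⟩
    convert I.add_mem hg' (I.mul_mem_left (p : A) hk) using 1
    ring

theorem Nice.fact2 (h : Nice p I) (z : A) (hz : z ∉ I) : ∃ b : ℕ, ∀ (N : ℕ) (f : A),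
    z * f ∈ I ⊔ Ideal.span {(p : A) ^ N} → f ∈ I ⊔ Ideal.span {(p : A) ^ (N - b)} := by
  obtain ⟨b, z', h1, h2⟩ := h.exp z hz
  refine ⟨b, fun N f hf => ?_⟩
  rcases le_total N b with hN | hN
  · rw [Nat.sub_eq_zero_of_le hN]; simp
  obtain ⟨N, rfl⟩ := Nat.exists_eq_add_of_le hN
  rw [Nat.add_sub_cancel_left]
  obtain ⟨w, hw⟩ := msp.1 hf
  refine h.mul z' h2 N f (msp.2 ⟨w, h.pow b _ ?_⟩)
  convert I.sub_mem hw (I.mul_mem_left f h1) using 1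
  ring

theorem Nice.fact1 (h : Nice p I) (y z : A) (h' : Nice p (I ⊔ Ideal.span {y}))
    (hz : z ∉ I ⊔ Ideal.span {y}) (hy : y ∉ I ⊔ Ideal.span {(p : A)}) :
    ∃ b : ℕ, ∀ (N : ℕ) (f : A), y * f ∈ I ⊔ Ideal.span {z} ⊔ Ideal.span {(p : A) ^ N} →
      f ∈ I ⊔ Ideal.span {z} ⊔ Ideal.span {(p : A) ^ (N - b)} := by
  obtain ⟨b, hb⟩ := h'.fact2 z hz
  refine ⟨b, fun N f hf => ?_⟩
  obtain ⟨k, hk⟩ := msp.1 hf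
  obtain ⟨g, hg⟩ := msp.1 hk
  have h1 : z * g ∈ I ⊔ Ideal.span {y} ⊔ Ideal.span {(p : A) ^ N} := by
    refine msp.2 ⟨-k, msp.2 ⟨f, ?_⟩⟩
    convert I.neg_mem hg using 1
    ring
  obtain ⟨g', hg'⟩ := msp.1 (hb N g h1)
  obtain ⟨g'', hg''⟩ := msp.1 hg'
  obtain ⟨e, he⟩ : (p : A) ^ (N - b) ∣ (p : A) ^ N := pow_dvd_pow _ (Nat.sub_le _ _)
  have h2 : y * (f - z * g'') ∈ I ⊔ Ideal.span {(p : A) ^ (N - b)} := by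
    refine msp.2 ⟨e * k + z * g', ?_⟩
    convert I.add_mem hg (I.mul_mem_left z hg'') using 1
    rw [he]
    ring
  obtain ⟨l, hl⟩ := msp.1 (h.mul y hy _ _ h2)
  refine msp.2 ⟨l, msp.2 ⟨g'', ?_⟩⟩
  convert hl using 1
  ring

end nice

section exch
variable {p : ℕ} [Fact p.Prime] {O S : Type} [CommRing O] [IsDomain O] [CommRing S]
  [Fact ¬IsUnit (p : S)] [IsAdicComplete (Ideal.span {(p : S)}) S]
  {i : O →+* S} {ϖ : ℕ → O} {hS : PS p i ϖ} {A : Type} [CommRing A] (j : A →+* O)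

theorem adjoin_all' [IsDomain A] (hj : Function.Injective j) (hji : j.IsIntegral)
    {X : Stg hS} {φ : A →+* X.B} (h : Good j X φ) (σ : Type) [Fintype σ] (m : ℕ) (u : σ → O)
    (ρ : Fin m → MvPolynomial σ A) (hρ : ∀ t, (ρ t).eval₂ j u = 0) :
    ∃ (Y : Stg hS) (φ' : A →+* Y.B) (U : σ → Y.B) (r : ℕ → O) (G : ℕ → Y.B),
      Good j Y φ' ∧ (∀ s, Y.χ (U s) = i (u s)) ∧ r 0 ≠ 0 ∧ (∀ k, r (k + 1) ^ p = r k) ∧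
      (∀ k, Y.χ (G k) = i (r k)) ∧
      ∀ t k M, (p : Y.B) ^ M ∣ G k * (ρ t).eval₂ φ' U := by
  obtain ⟨Y, φ', U, r, G, h1, h2, h3, h4, h5, h6⟩ := adjoin_all j hj hji h (Fintype.card σ) m
    (u ∘ (Fintype.equivFin σ).symm) (fun t => MvPolynomial.rename (Fintype.equivFin σ) (ρ t))
    (fun t => by
      rw [MvPolynomial.eval₂_rename, Function.comp_assoc, Equiv.symm_comp_self, Function.comp_id]
      exact hρ t)
  refine ⟨Y, φ', U ∘ Fintype.equivFin σ, r, G, h1, fun s => ?_, h3, h4, h5, fun t k M => ?_⟩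
  · rw [Function.comp_apply, h2, Function.comp_apply, Equiv.symm_apply_apply]
  · have := h6 t k M
    rwa [MvPolynomial.eval₂_rename] at this

theorem PS.descend (hS : PS p i ϖ) (K : Ideal O) (M : ℕ) (hM : (p : O) ^ M ∈ K) (o : O)
    (h : i o ∈ K.map i) : o ∈ K := by
  have key : ∀ s ∈ K.map i, ∃ k ∈ K, ∃ t, s = i k + (p : S) ^ M * t := by
    intro s hs
    induction hs using Submodule.span_induction with
    | mem x hx =>
      obtain ⟨k, hk, rfl⟩ := hx
      exact ⟨k, hk, 0, by ring⟩
    | zero => exact ⟨0, K.zero_mem, 0, by simp⟩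
    | add x y _ _ hx hy =>
      obtain ⟨k, hk, t, rfl⟩ := hx
      obtain ⟨k', hk', t', rfl⟩ := hy
      exact ⟨k + k', K.add_mem hk hk', t + t', by rw [map_add]; ring⟩
    | smul a x _ hx =>
      obtain ⟨k, hk, t, rfl⟩ := hx
      obtain ⟨a', t', rfl⟩ := hS.hdense M a
      exact ⟨a' * k, K.mul_mem_left _ hk, t' * i k + (i a' + (p : S) ^ M * t') * t, by
        rw [map_mul, smul_eq_mul]; ring⟩
  obtain ⟨k, hk, t, ht⟩ := key _ h
  have h1 : (p : O) ^ M ∣ o - k := hS.hinj M _ ⟨t, by rw [map_sub, ht]; ring⟩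
  have := K.add_mem (K.mem_of_dvd h1 hM) hk
  simpa using this

theorem Good.out {X : Stg hS} {φ : A →+* X.B} (h : Good j X φ) (I : Ideal A) (x : O) (x' v : X.B)
    (hx : X.χ x' = i x) (o : O) (hv : X.χ v = i o) (M : ℕ)
    (hm : v ∈ I.map φ ⊔ Ideal.span {x'} ⊔ Ideal.span {(p : X.B) ^ M}) :
    o ∈ I.map j ⊔ Ideal.span {x} ⊔ Ideal.span {(p : O) ^ M} := by
  refine hS.descend _ M (Ideal.mem_sup_right (Ideal.mem_span_singleton_self _)) o ?_
  rw [← hv]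
  have := Ideal.mem_map_of_mem X.χ hm
  rw [Ideal.map_sup, Ideal.map_sup, Ideal.map_map, Ideal.map_span, Ideal.map_span,
    Set.image_singleton, Set.image_singleton, hx, map_pow, map_natCast,
    show X.χ.comp φ = i.comp j from RingHom.ext h.comp] at this
  rw [Ideal.map_sup, Ideal.map_sup, Ideal.map_map, Ideal.map_span, Ideal.map_span,
    Set.image_singleton, Set.image_singleton, map_pow, map_natCast]
  exact this

theorem Good.colon [IsNoetherianRing A] {X : Stg hS} {φ : A →+* X.B} (h : Good j X φ) (N : ℕ)
    {s : A} {I J : Ideal A} (hIJ : ∀ t, s * t ∈ I ⊔ Ideal.span {(p : A) ^ N} → t ∈ J) {v : X.B}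
    (hv : φ s * v ∈ I.map φ ⊔ Ideal.span {(p : X.B) ^ N}) : v ∈ J.map φ := by
  refine EqFlat.colon (h.flat.pow (fun b hb => ?_) N) (IsNoetherian.noetherian I) hIJ ?_
  · rw [map_natCast] at hb
    exact BQ.p_nzd p X.nzd hb
  · rwa [map_pow, map_natCast]

theorem exch0 [IsDomain A] [IsNoetherianRing A] (hj : Function.Injective j) (hji : j.IsIntegral)
    {X : Stg hS} {φ : A →+* X.B} (h : Good j X φ) (z : A) (hz : z ≠ 0) (hN : Nice p (⊥ : Ideal A)) :
    ∃ b : ℕ, ∀ (N : ℕ) (u : O), j z * u ∈ Ideal.span {(p : O) ^ N} →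
      ∃ r : ℕ → O, r 0 ≠ 0 ∧ (∀ k, r (k + 1) ^ p = r k) ∧
        ∀ k, r k ^ 2 * u ∈ Ideal.span {(p : O) ^ (N - b)} := by
  obtain ⟨b, hb⟩ := hN.fact2 z hz
  refine ⟨b, fun N u hu => ?_⟩
  obtain ⟨s, hs⟩ := Ideal.mem_span_singleton.1 hu
  obtain ⟨Y, φ', U, r, G, h1, h2, h3, h4, h5, h6⟩ := adjoin_all' j hj hji h (Fin 2) 1 ![u, s]
    ![MvPolynomial.C z * MvPolynomial.X 0 - MvPolynomial.C ((p : A) ^ N) * MvPolynomial.X 1]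
    (fun t => by
      fin_cases t
      simp [hs])
  refine ⟨r, h3, h4, fun k => ?_⟩
  have e1 := h6 0 k N
  simp only [Matrix.cons_val_zero, MvPolynomial.eval₂_sub, MvPolynomial.eval₂_mul,
    MvPolynomial.eval₂_C, MvPolynomial.eval₂_X] at e1
  simp only [map_pow, map_natCast] at e1
  have e2 : φ' z * (G k * U 0) ∈ (⊥ : Ideal A).map φ' ⊔ Ideal.span {(p : Y.B) ^ N} := by
    refine Ideal.mem_sup_right (Ideal.mem_span_singleton.2 ?_)
    convert dvd_add e1 (dvd_mul_right ((p : Y.B) ^ N) (G k * U 1)) using 1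
    ring
  have e3 := h1.colon j N (fun t => hb N t) e2
  rw [Ideal.map_sup, Ideal.map_span, Set.image_singleton, map_pow, map_natCast] at e3
  have e4 := h1.out j ⊥ 0 0 (G k * U 0) (by simp) (r k * u) (by rw [map_mul, h5, h2]; simp) (N - b)
    (by simpa using e3)
  have e5 : r k * u ∈ Ideal.span {(p : O) ^ (N - b)} := by simpa using e4
  rw [pow_two, mul_assoc]
  exact Ideal.mul_mem_left _ _ e5

theorem exch [IsDomain A] [IsNoetherianRing A] (hj : Function.Injective j) (hji : j.IsIntegral)
    {X : Stg hS} {φ : A →+* X.B} (h : Good j X φ) {m : ℕ} (Y : Fin m → A) (y z : A)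
    (hN : Nice p (Ideal.span (Set.range Y))) (hN' : Nice p (Ideal.span (Set.range Y) ⊔ Ideal.span {y}))
    (hz : z ∉ Ideal.span (Set.range Y) ⊔ Ideal.span {y})
    (hy : y ∉ Ideal.span (Set.range Y) ⊔ Ideal.span {(p : A)}) (x : O)
    (hzx : j z ∈ (Ideal.span (Set.range Y)).map j ⊔ Ideal.span {x}) :
    ∃ b : ℕ, ∀ (N : ℕ) (u : O),
      j y * u ∈ (Ideal.span (Set.range Y)).map j ⊔ Ideal.span {x} ⊔ Ideal.span {(p : O) ^ N} →
      ∃ r : ℕ → O, r 0 ≠ 0 ∧ (∀ k, r (k + 1) ^ p = r k) ∧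
        ∀ k, r k ^ 2 * u ∈ (Ideal.span (Set.range Y)).map j ⊔ Ideal.span {x} ⊔
          Ideal.span {(p : O) ^ (N - b)} := by
  have hmem : ∀ f, f ∈ (Ideal.span (Set.range Y)).map j → ∃ c : Fin m → O, ∑ t, c t * j (Y t) = f := by
    intro f hf
    rw [Ideal.map_span, ← Set.range_comp] at hf
    exact Ideal.mem_span_range_iff_exists_fun.1 hf
  obtain ⟨b1, hb1⟩ := hN.fact1 y z hN' hz hy
  obtain ⟨b2, hb2⟩ := hN.fact2 z (fun h => hz (Ideal.mem_sup_left h))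
  refine ⟨b1 + b2, fun N u hu => ?_⟩
  obtain ⟨s', hs'⟩ := msp.1 hu
  obtain ⟨s, hs⟩ := msp.1 hs'
  obtain ⟨sY, hsY⟩ := hmem _ hs
  obtain ⟨w, hw⟩ := msp.1 hzx
  obtain ⟨wY, hwY⟩ := hmem _ hw
  obtain ⟨X', φ', V, r, G, h1, h2, h3, h4, h5, h6⟩ := adjoin_all' j hj hji h
    (Fin 5 ⊕ (Fin m ⊕ Fin m)) 2 (Sum.elim ![u, x, w, s, s'] (Sum.elim sY wY))
    ![MvPolynomial.C y * MvPolynomial.X (Sum.inl 0) -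
        MvPolynomial.C ((p : A) ^ N) * MvPolynomial.X (Sum.inl 4) -
        MvPolynomial.X (Sum.inl 1) * MvPolynomial.X (Sum.inl 3) -
        ∑ t, MvPolynomial.X (Sum.inr (Sum.inl t)) * MvPolynomial.C (Y t),
      MvPolynomial.C z - MvPolynomial.X (Sum.inl 1) * MvPolynomial.X (Sum.inl 2) -
        ∑ t, MvPolynomial.X (Sum.inr (Sum.inr t)) * MvPolynomial.C (Y t)]
    (fun t => by
      fin_cases t
      · simp [MvPolynomial.eval₂_sum, hsY]
      · simp [MvPolynomial.eval₂_sum, hwY])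
  refine ⟨r, h3, h4, fun k => ?_⟩
  have e1 := h6 0 k N
  have e2 := h6 1 k N
  simp only [Matrix.cons_val_zero, Matrix.cons_val_one, MvPolynomial.eval₂_sub,
    MvPolynomial.eval₂_mul, MvPolynomial.eval₂_sum,
    MvPolynomial.eval₂_C, MvPolynomial.eval₂_X] at e1 e2
  simp only [map_pow, map_natCast] at e1 e2
  generalize hσ1 : ∑ t, V (Sum.inr (Sum.inl t)) * φ' (Y t) = σ1 at e1
  generalize hσ2 : ∑ t, V (Sum.inr (Sum.inr t)) * φ' (Y t) = σ2 at e2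
  have hσm : ∀ c : Fin m → X'.B, ∑ t, c t * φ' (Y t) ∈ (Ideal.span (Set.range Y)).map φ' := fun c =>
    sum_mem fun t _ => Ideal.mul_mem_left _ _ (Ideal.mem_map_of_mem _ (Ideal.subset_span ⟨t, rfl⟩))
  have hm1 : σ1 ∈ (Ideal.span (Set.range Y)).map φ' := hσ1 ▸ hσm _
  have hm2 : σ2 ∈ (Ideal.span (Set.range Y)).map φ' := hσ2 ▸ hσm _
  have hu1 : X'.χ (V (Sum.inl 0)) = i u := h2 _
  have hx1 : X'.χ (V (Sum.inl 1)) = i x := h2 _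
  generalize V (Sum.inl 0) = U at *
  generalize V (Sum.inl 1) = x' at *
  generalize V (Sum.inl 2) = W at *
  generalize V (Sum.inl 3) = s1 at *
  generalize V (Sum.inl 4) = s2 at *
  obtain ⟨a1, ha1⟩ := e1
  obtain ⟨a2, ha2⟩ := e2
  have e3 : φ' y * (G k * W * U) ∈ (Ideal.span (Set.range Y) ⊔ Ideal.span {z}).map φ' ⊔
      Ideal.span {(p : X'.B) ^ N} := by
    rw [Ideal.map_sup, Ideal.map_span (s := {z}), Set.image_singleton]
    refine msp.2 ⟨W * a1 + G k * W * s2 - s1 * a2, msp.2 ⟨G k * s1, ?_⟩⟩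
    convert Ideal.sub_mem _ (Ideal.mul_mem_left _ (G k * W) hm1)
      (Ideal.mul_mem_left _ (G k * s1) hm2) using 1
    linear_combination W * ha1 - s1 * ha2
  have e4 := h1.colon j N (fun t => hb1 N t) e3
  rw [Ideal.map_sup, Ideal.map_sup, Ideal.map_span (s := {z}), Set.image_singleton,
    Ideal.map_span (s := {(p : A) ^ (N - b1)}), Set.image_singleton, map_pow, map_natCast] at e4
  obtain ⟨q, hq⟩ := msp.1 e4
  obtain ⟨v, hv⟩ := msp.1 hq
  obtain ⟨e, he⟩ : (p : X'.B) ^ (N - b1) ∣ (p : X'.B) ^ N := pow_dvd_pow _ (Nat.sub_le _ _)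
  have e5 : φ' z * (G k ^ 2 * U - G k * x' * v) ∈ (Ideal.span (Set.range Y)).map φ' ⊔
      Ideal.span {(p : X'.B) ^ (N - b1)} := by
    refine msp.2 ⟨e * a2 * G k * U + q * G k * x', ?_⟩
    convert Ideal.add_mem _ (Ideal.mul_mem_left _ (G k ^ 2 * U) hm2)
      (Ideal.mul_mem_left _ (G k * x') hv) using 1
    linear_combination G k * U * ha2 + G k * U * a2 * he
  have e6 := h1.colon j (N - b1) (fun t => hb2 (N - b1) t) e5
  rw [Ideal.map_sup, Ideal.map_span (s := {(p : A) ^ (N - b1 - b2)}), Set.image_singleton, map_pow,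
    map_natCast] at e6
  obtain ⟨l, hl⟩ := msp.1 e6
  refine h1.out j _ x x' (G k ^ 2 * U) hx1 _ (by rw [map_mul, map_pow, h5, hu1, map_mul, map_pow]) _ ?_
  rw [← Nat.sub_sub]
  refine msp.2 ⟨l, msp.2 ⟨G k * v, ?_⟩⟩
  convert hl using 1
  ring

theorem PS.root_out (hS : PS p i ϖ) (r : ℕ → O) (hr : ∀ k, r (k + 1) ^ p = r k) (L : Ideal O) (u : O)
    (h : ∀ k, r k ^ 2 * u ∈ L) (n : ℕ) (hn : 0 < n) (d : O) (hd : d ^ n = r 0) : d * u ∈ L := by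
  have h1 : ∀ k, r k ^ p ^ k = r 0 := by
    intro k
    induction k with
    | zero => simp
    | succ k ih => rw [pow_succ', pow_mul, hr, ih]
  have h2 : r (2 * n) ^ 2 ∣ d := by
    refine hS.hnorm _ _ n hn ?_
    rw [hd, ← h1 (2 * n), ← pow_mul]
    exact pow_dvd_pow _ (Nat.lt_pow_self (Fact.out : p.Prime).one_lt).le
  obtain ⟨e, rfl⟩ := h2
  rw [mul_assoc, mul_comm e, ← mul_assoc]
  exact L.mul_mem_right _ (h _)

end exch

theorem gen1 {O κ : Type} [CommRing O] [Fintype κ] [DecidableEq κ] (p : ℕ) (hp : 0 < p) (T : Subring O)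
    (g : κ → O) (hg : ∀ k, g k ^ p ∈ T) (x : O)
    (hx : x ∈ (MvPolynomial.eval₂Hom T.subtype g).range) :
    ∃ a : (κ → Fin p) → O, (∀ I, a I ∈ T) ∧ x = ∑ I, a I * ∏ k, g k ^ (I k).val := by
  obtain ⟨P, hPx⟩ := hx
  induction P using MvPolynomial.induction_on' generalizing x with
  | add P Q hP hQ =>
    obtain ⟨a, ha, h1⟩ := hP _ rfl
    obtain ⟨b, hb, h2⟩ := hQ _ rfl
    refine ⟨fun I => a I + b I, fun I => add_mem (ha I) (hb I), ?_⟩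
    rw [← hPx, map_add, h1, h2, ← Finset.sum_add_distrib]
    exact Finset.sum_congr rfl fun l _ => (add_mul _ _ _).symm
  | monomial s c =>
    have hmod : ∀ n : ℕ, ∀ o, g o ^ n = (g o ^ p) ^ (n / p) * g o ^ (n % p) := by
      intro n o
      rw [← pow_mul, ← pow_add, Nat.div_add_mod]
    let I0 : κ → Fin p := fun k => ⟨s k % p, Nat.mod_lt _ hp⟩
    let C : O := c.1 * ∏ k, (g k ^ p) ^ (s k / p)
    have hC : C ∈ T := mul_mem c.2 (prod_mem fun k _ => pow_mem (hg k) _)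
    refine ⟨fun I => if I = I0 then C else 0, fun I => ?_, ?_⟩
    · dsimp only
      split_ifs
      · exact hC
      · exact zero_mem _
    · dsimp only
      rw [← hPx, Finset.sum_eq_single I0]
      · rw [if_pos rfl, MvPolynomial.coe_eval₂Hom, MvPolynomial.eval₂_monomial,
            Finsupp.prod_fintype _ _ (fun o => pow_zero _),
            Finset.prod_congr rfl (fun k _ => hmod (s k) k), Finset.prod_mul_distrib]
        simp only [C, I0, Subring.subtype_apply]
        ring
      · intro I _ hI
        rw [if_neg hI, zero_mul]
      · simp

section pbasis
variable {k : Type} [Field k] (p : ℕ) [Fact p.Prime] [CharP k p]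

theorem pb_card {e m : ℕ} (s : Fin m → k) (hs : ∀ a : k, ∃ c : Fin m → k, a = ∑ i, (c i) ^ p * s i)
    (t : Fin e → k) (ht : ∀ c : (Fin e → Fin p) → k, ∑ I, c I ^ p * ∏ i, t i ^ (I i).val = 0 → ∀ I, c I = 0) :
    e < m := by
  let F := (frobenius k p).fieldRange
  have hsp : Submodule.span F (Set.range s) = ⊤ := by
    refine eq_top_iff.2 fun a _ => ?_
    obtain ⟨c, rfl⟩ := hs a
    refine Submodule.sum_mem _ fun i _ => ?_
    exact Submodule.smul_mem _ (⟨c i ^ p, c i, rfl⟩ : F) (Submodule.subset_span ⟨i, rfl⟩)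
  have hli : LinearIndependent F (fun I : Fin e → Fin p => ∏ i, t i ^ (I i).val) := by
    rw [Fintype.linearIndependent_iff]
    intro g hg I
    have : ∀ I, ∃ c, c ^ p = (g I).1 := fun I => (g I).2
    choose c hc using this
    have := ht c (by rw [← hg]; exact Finset.sum_congr rfl fun J _ => by rw [hc]; rfl) I
    ext
    rw [← hc, this, zero_pow (Fact.out : p.Prime).ne_zero]; rfl
  have _ : Fintype (Set.range s) := Fintype.ofFinite _
  have := linearIndependent_le_span' _ hli (Set.range s) (by rw [hsp]; exact fun _ _ => trivial)
  rw [← Cardinal.mk_fintype] at this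
  have h2 : Fintype.card (Fin e → Fin p) ≤ m := by
    have h3 := this.trans (Cardinal.mk_range_le (f := s))
    rw [Cardinal.mk_fin] at h3
    rw [Cardinal.mk_fintype] at h3
    exact_mod_cast h3
  rw [Fintype.card_fun, Fintype.card_fin, Fintype.card_fin] at h2
  exact (Nat.lt_pow_self (Fact.out : p.Prime).one_lt).trans_le h2

/-- the subfield generated by p-th powers and `t` -/
noncomputable def pbK {e : ℕ} (t : Fin e → k) : Subfield k where
  __ := (MvPolynomial.eval₂Hom (frobenius k p).range.subtype t).range
  inv_mem' := by
    intro x hx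
    by_cases h0 : x = 0
    · simpa [h0] using hx
    have : x⁻¹ = x ^ (p - 1) * x⁻¹ ^ p := by
      obtain ⟨q, hq⟩ : ∃ q, p = q + 1 := ⟨p - 1, (Nat.succ_pred_prime Fact.out).symm⟩
      rw [hq]
      rw [Nat.add_sub_cancel, pow_succ, ← mul_assoc, ← mul_pow, mul_inv_cancel₀ h0, one_pow, one_mul]
    rw [this]
    have hx' : x ∈ (MvPolynomial.eval₂Hom (frobenius k p).range.subtype t).range := hx
    have h2 : x⁻¹ ^ p ∈ (MvPolynomial.eval₂Hom (frobenius k p).range.subtype t).range :=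
      ⟨MvPolynomial.C ⟨x⁻¹ ^ p, x⁻¹, rfl⟩, by simp⟩
    exact mul_mem (pow_mem hx' _) h2

theorem pb_ext {e : ℕ} (t : Fin e → k) (ht : ∀ c : (Fin e → Fin p) → k, ∑ I, c I ^ p * ∏ i, t i ^ (I i).val = 0 → ∀ I, c I = 0)
    (x : k) (hx : x ∉ pbK p t) (c : (Fin (e + 1) → Fin p) → k)
    (hc : ∑ I, c I ^ p * ∏ i, (Fin.cons x t : Fin (e + 1) → k) i ^ (I i).val = 0) (I) : c I = 0 := by
  let K := pbK p t
  have hpp : p.Prime := Fact.out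
  have hxp : ∀ y : k, y ^ p ∈ K := fun y => ⟨MvPolynomial.C ⟨y ^ p, y, rfl⟩, by simp⟩
  have htK : ∀ i, t i ∈ K := fun i => ⟨MvPolynomial.X i, by simp⟩
  have hirr : Irreducible (Polynomial.X ^ p - Polynomial.C (⟨x ^ p, hxp x⟩ : K)) := by
    apply X_pow_sub_C_irreducible_of_prime hpp
    intro b hb
    have : (b : k) ^ p = x ^ p := congrArg Subtype.val hb
    rw [← frobenius_def, ← frobenius_def] at this
    exact hx (frobenius_inj k p this ▸ b.2)
  have hmin := minpoly.eq_of_irreducible_of_monic hirr (x := x) (by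
    simp only [map_sub, map_pow, Polynomial.aeval_X, Polynomial.aeval_C]
    exact sub_self _) (Polynomial.monic_X_pow_sub_C _ hpp.ne_zero)
  let s : Fin p → K := fun l => ∑ I : Fin e → Fin p, ⟨c (Fin.cons l I) ^ p, hxp _⟩ * ∏ i, (⟨t i, htK i⟩ : K) ^ (I i).val
  have hs : ∀ l, (s l : k) = ∑ I : Fin e → Fin p, c (Fin.cons l I) ^ p * ∏ i, t i ^ (I i).val := by
    intro l
    simp [s]
  have hsum : ∑ l, (s l : k) * x ^ l.val = 0 := by
    rw [← hc, ← (Fin.consEquiv (fun _ : Fin (e + 1) => Fin p)).sum_comp, Fintype.sum_prod_type]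
    refine Finset.sum_congr rfl fun l _ => ?_
    rw [hs, Finset.sum_mul]
    refine Finset.sum_congr rfl fun J _ => ?_
    rw [show (Fin.consEquiv fun x => Fin p) (l, J) = (Fin.cons l J : Fin (e + 1) → Fin p) from rfl]
    simp only [Fin.prod_univ_succ, Fin.cons_zero, Fin.cons_succ]
    ring
  have hs0 : ∀ l, s l = 0 := by
    let f : Polynomial K := ∑ l : Fin p, Polynomial.monomial l.val (s l)
    have hf : f = 0 := by
      by_contra hf
      have h1 : Polynomial.aeval x f = 0 := by
        simp only [f, map_sum, Polynomial.aeval_monomial]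
        exact hsum
      have h2 := minpoly.degree_le_of_ne_zero K x hf h1
      rw [← hmin, Polynomial.degree_X_pow_sub_C hpp.pos] at h2
      have h3 : f.degree < p := by
        refine lt_of_le_of_lt (Polynomial.degree_sum_le _ _) ?_
        rw [Finset.sup_lt_iff (by exact WithBot.bot_lt_coe p)]
        intro l _
        exact (Polynomial.degree_monomial_le _ _).trans_lt (by exact_mod_cast l.2)
      exact absurd h2 (not_le.2 h3)
    intro l
    have := congrArg (fun g => Polynomial.coeff g l.val) hf
    simpa [f, Polynomial.finsetSum_coeff, Polynomial.coeff_monomial, Fin.val_inj] using this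
  have := ht (fun J => c (Fin.cons (I 0) J)) (by rw [← hs, hs0]; rfl) (Fin.tail I)
  simpa using this

theorem exists_pbasis {m : ℕ} (s : Fin m → k) (hs : ∀ a : k, ∃ c : Fin m → k, a = ∑ i, (c i) ^ p * s i) :
    ∃ (e : ℕ) (t : Fin e → k),
      (∀ a : k, ∃ c : (Fin e → Fin p) → k, a = ∑ I, c I ^ p * ∏ i, t i ^ (I i).val) ∧
      (∀ c : (Fin e → Fin p) → k, ∑ I, c I ^ p * ∏ i, t i ^ (I i).val = 0 → ∀ I, c I = 0) := by
  classical
  let Q : ℕ → Prop := fun e => ∃ t : Fin e → k,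
    (∀ c : (Fin e → Fin p) → k, ∑ I, c I ^ p * ∏ i, t i ^ (I i).val = 0 → ∀ I, c I = 0)
  have hQb : ∀ e, Q e → e ≤ m := fun e ⟨t, ht⟩ => (pb_card p s hs t ht).le
  have hQ0 : Q 0 := ⟨Fin.elim0, fun c hc I => by
    rw [Fintype.sum_unique] at hc
    simp only [Finset.univ_eq_empty, Finset.prod_empty, mul_one] at hc
    rw [← pow_eq_zero_iff (Fact.out : p.Prime).ne_zero, ← hc, Subsingleton.elim I]⟩
  obtain ⟨t, ht⟩ := Nat.findGreatest_spec (P := Q) (Nat.zero_le m) hQ0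
  refine ⟨_, t, fun a => ?_, ht⟩
  by_cases ha : a ∈ pbK p t
  · obtain ⟨c, hc, h⟩ := gen1 p (Fact.out : p.Prime).pos (frobenius k p).range t (fun i => ⟨t i, rfl⟩) a ha
    choose c' hc' using hc
    exact ⟨c', by rw [h]; simp only [← hc', frobenius_def]⟩
  · have h1 : Q (Nat.findGreatest Q m + 1) := ⟨Fin.cons a t, fun c hc I => pb_ext p t ht a ha c hc I⟩
    have := Nat.le_findGreatest (hQb _ h1) h1
    omega

variable {σ ε : Type} [Fintype σ] [DecidableEq σ] [Fintype ε] [DecidableEq ε]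

theorem ps_coeff (t : ε → k) (c : (σ ⊕ ε → Fin p) → MvPowerSeries σ k) (n : σ →₀ ℕ) (i : σ → Fin p) :
    MvPowerSeries.coeff (p • n + Finsupp.equivFunOnFinite.symm fun s => (i s).val) (∑ I, c I ^ p * ∏ o, (Sum.elim (fun s => MvPowerSeries.X s)
      (fun s => MvPowerSeries.C (t s)) o : MvPowerSeries σ k) ^ (I o).val) =
    ∑ J : ε → Fin p, (MvPowerSeries.coeff n (c (Sum.elim i J))) ^ p * ∏ s, t s ^ (J s).val := by
  have hp0 : p ≠ 0 := (Fact.out : p.Prime).ne_zero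
  have key : ∀ (i' : σ → Fin p) (J : ε → Fin p) (f : MvPowerSeries σ k),
      MvPowerSeries.coeff (p • n + Finsupp.equivFunOnFinite.symm fun s => (i s).val) (f ^ p * ∏ o, (Sum.elim (fun s => MvPowerSeries.X s)
      (fun s => MvPowerSeries.C (t s)) o : MvPowerSeries σ k) ^ ((Sum.elim i' J : σ ⊕ ε → Fin p) o).val) =
      if i' = i then (MvPowerSeries.coeff n f) ^ p * ∏ s, t s ^ (J s).val else 0 := by
    intro i' J f
    have h1 : ∏ s, (MvPowerSeries.X s : MvPowerSeries σ k) ^ (i' s).val =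
        MvPowerSeries.monomial (Finsupp.equivFunOnFinite.symm fun s => (i' s).val) 1 := by
      rw [MvPowerSeries.monomial_one_eq, Finsupp.prod_fintype _ _ (fun _ => pow_zero _)]
      rfl
    have h2 : ∏ s, (MvPowerSeries.C (t s) : MvPowerSeries σ k) ^ (J s).val =
      MvPowerSeries.C (∏ s, t s ^ (J s).val) := by simp
    simp only [Fintype.prod_sum_type, Sum.elim_inl, Sum.elim_inr]
    rw [h1, h2, ← mul_assoc, MvPowerSeries.coeff_mul_C, MvPowerSeries.coeff_mul_monomial, mul_one,
      ← MvPowerSeries.map_frobenius_expand p hp0, MvPowerSeries.coeff_map]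
    split_ifs with ha hb hb
    · subst hb
      rw [add_tsub_cancel_right, MvPowerSeries.coeff_expand_smul, frobenius_def]
    · obtain ⟨s, hs⟩ := Function.ne_iff.1 hb
      rw [MvPowerSeries.coeff_expand_of_not_dvd p hp0 f (i := s), map_zero, zero_mul]
      have h3 := ha s
      simp only [Finsupp.coe_add, Pi.add_apply, Finsupp.coe_smul, Pi.smul_apply, smul_eq_mul, Finsupp.coe_tsub, Pi.sub_apply, Finsupp.equivFunOnFinite_symm_apply_apply] at h3 ⊢
      rintro ⟨q, hq⟩
      have e1 : p * n s + (i s).val = p * q + (i' s).val := by omega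
      have := congrArg (· % p) e1
      simp only [Nat.mul_add_mod, Nat.mod_eq_of_lt (i s).2, Nat.mod_eq_of_lt (i' s).2] at this
      exact hs (Fin.ext this.symm)
    · subst hb
      exact absurd le_add_self ha
    · rw [zero_mul]
  rw [map_sum, ← (Equiv.sumArrowEquivProdArrow σ ε (Fin p)).symm.sum_comp, Fintype.sum_prod_type, Finset.sum_eq_single i]
  · refine Finset.sum_congr rfl fun J _ => ?_
    exact (key i J _).trans (if_pos rfl)
  · intro i' _ hi
    refine Finset.sum_eq_zero fun J _ => ?_
    exact (key i' J _).trans (if_neg hi)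
  · simp

theorem ps_split (hp : 0 < p) (n : σ →₀ ℕ) : ∃ (n' : σ →₀ ℕ) (i : σ → Fin p),
    n = p • n' + Finsupp.equivFunOnFinite.symm fun s => (i s).val := by
  refine ⟨Finsupp.equivFunOnFinite.symm fun s => n s / p, fun s => ⟨n s % p, Nat.mod_lt _ hp⟩, ?_⟩
  ext s
  simp [Nat.div_add_mod]

theorem ps_alpha (t : ε → k)
    (hα : ∀ a : k, ∃ c : (ε → Fin p) → k, a = ∑ I, c I ^ p * ∏ i, t i ^ (I i).val) (a : MvPowerSeries σ k) :
    ∃ c : (σ ⊕ ε → Fin p) → MvPowerSeries σ k, a = ∑ I, c I ^ p * ∏ o, (Sum.elim (fun s => MvPowerSeries.X s)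
      (fun s => MvPowerSeries.C (t s)) o : MvPowerSeries σ k) ^ (I o).val := by
  choose D hD using hα
  let c : (σ ⊕ ε → Fin p) → MvPowerSeries σ k := fun I n => D (MvPowerSeries.coeff (p • n + Finsupp.equivFunOnFinite.symm fun s => (I (Sum.inl s)).val) a)
    (fun s => I (Sum.inr s))
  refine ⟨c, ?_⟩
  ext n
  obtain ⟨n, i, rfl⟩ := ps_split p (Fact.out : p.Prime).pos n
  rw [ps_coeff]
  exact hD _

theorem ps_beta (t : ε → k)
    (hβ : ∀ c : (ε → Fin p) → k, ∑ I, c I ^ p * ∏ i, t i ^ (I i).val = 0 → ∀ I, c I = 0)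
    (c : (σ ⊕ ε → Fin p) → MvPowerSeries σ k) (hc : ∑ I, c I ^ p * ∏ o, (Sum.elim (fun s => MvPowerSeries.X s)
      (fun s => MvPowerSeries.C (t s)) o : MvPowerSeries σ k) ^ (I o).val = 0) (I) : c I = 0 := by
  ext n
  have h := ps_coeff p t c n (fun s => I (Sum.inl s))
  rw [hc, map_zero] at h
  have := hβ _ h.symm (fun s => I (Sum.inr s))
  rwa [show Sum.elim (fun s => I (Sum.inl s)) (fun s => I (Sum.inr s)) = I from Sum.elim_comp_inl_inr I] at this
end pbasis

theorem pb_beta {k ε : Type} [Field k] (p : ℕ) [Fact p.Prime] [CharP k p] [Fintype ε] [DecidableEq ε] (t : ε → k)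
    (hβ : ∀ c : (ε → Fin p) → k, ∑ I, c I ^ p * ∏ i, t i ^ (I i).val = 0 → ∀ I, c I = 0) (n : ℕ) :
    ∀ c : (ε → Fin (p ^ n)) → k, ∑ I, c I ^ (p ^ n) * ∏ i, t i ^ (I i).val = 0 → ∀ I, c I = 0 := by
  induction n with
  | zero =>
    intro c hc I
    have hs : ∀ I : ε → Fin (p ^ 0), I = fun _ => ⟨0, by simp⟩ := fun I => funext fun i => by
      have := (I i).2
      exact Fin.ext (Nat.lt_one_iff.1 (this.trans_eq (pow_zero p)))
    rw [Finset.sum_eq_single I (fun J _ hJ => absurd ((hs J).trans (hs I).symm) hJ) (fun h => absurd (Finset.mem_univ _) h)] at hc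
    have h0 : ∀ i, (I i).val = 0 := fun i => by rw [hs I]
    simpa [h0] using hc
  | succ n ih =>
    intro c hc
    let E : (ε → Fin (p ^ n)) × (ε → Fin p) ≃ (ε → Fin (p ^ (n + 1))) :=
      (Equiv.arrowProdEquivProdArrow ε (fun _ => Fin (p ^ n)) (fun _ => Fin p)).symm.trans
        (Equiv.arrowCongr (Equiv.refl _) finProdFinEquiv)
    have hE : ∀ I J i, (E (I, J) i).val = (J i).val + p * (I i).val := fun I J i => rfl
    have h1 : ∀ J : ε → Fin p, ∑ I : ε → Fin (p ^ n), c (E (I, J)) ^ (p ^ n) * ∏ i, t i ^ (I i).val = 0 := by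
      refine hβ _ ?_
      rw [← hc, ← E.sum_comp, Fintype.sum_prod_type, Finset.sum_comm]
      refine Finset.sum_congr rfl fun J _ => ?_
      rw [sum_pow_char, Finset.sum_mul]
      refine Finset.sum_congr rfl fun I _ => ?_
      have h2 : ∏ i, t i ^ (E (I, J) i).val = (∏ i, t i ^ (J i).val) * (∏ i, t i ^ (I i).val) ^ p := by
        rw [← Finset.prod_pow, ← Finset.prod_mul_distrib]
        refine Finset.prod_congr rfl fun i _ => ?_
        rw [hE, pow_add, pow_mul']
      rw [h2, mul_pow, ← pow_mul, ← pow_succ]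
      ring
    intro I
    have := ih _ (h1 (E.symm I).2) (E.symm I).1
    simpa using this

section Vring
variable {R : Type} [CommRing R] (p : ℕ) [Fact p.Prime] {ε : Type} [Fintype ε] [DecidableEq ε]

noncomputable def Lam (R : Type) [CommRing R] (n : ℕ) : Subring R :=
  (WittVector.ghostComponent n : WittVector p R →+* R).range

theorem ghost_sum (n : ℕ) (x : WittVector p R) : WittVector.ghostComponent n x =
    ∑ i ∈ Finset.range (n + 1), (p : R) ^ i * x.coeff i ^ p ^ (n - i) := by
  rw [WittVector.ghostComponent_apply, wittPolynomial_eq_sum_C_mul_X_pow]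
  simp

theorem Lam_pow (n : ℕ) (a : R) : a ^ p ^ n ∈ Lam p R n :=
  ⟨WittVector.teichmuller p a, WittVector.ghostComponent_teichmuller p a n⟩

theorem Lam_p (n : ℕ) (a : R) (h : a ∈ Lam p R n) : p * a ∈ Lam p R (n + 1) := by
  obtain ⟨x, rfl⟩ := h
  exact ⟨WittVector.verschiebung x, WittVector.ghostComponent_verschiebung x n⟩

theorem Lam_split (n : ℕ) (a : R) (h : a ∈ Lam p R (n + 1)) :
    ∃ b, ∃ c ∈ Lam p R n, a = b ^ p ^ (n + 1) + p * c := by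
  obtain ⟨x, rfl⟩ := h
  refine ⟨x.coeff 0, _, ⟨WittVector.mk p fun i => x.coeff (i + 1), rfl⟩, ?_⟩
  rw [ghost_sum, ghost_sum, Finset.sum_range_succ', add_comm, Finset.mul_sum]
  congr 1
  · simp
  · refine Finset.sum_congr rfl fun i _ => ?_
    rw [WittVector.coeff_mk, Nat.add_sub_add_right]
    ring

theorem Lam_succ (n : ℕ) (a : R) (h : a ∈ Lam p R (n + 1)) : ∃ b ∈ Lam p R n, ∃ c, a = b + p ^ (n + 1) * c := by
  obtain ⟨x, rfl⟩ := h
  refine ⟨_, ⟨WittVector.mk p fun i => x.coeff i ^ p, rfl⟩, x.coeff (n + 1), ?_⟩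
  rw [ghost_sum, ghost_sum, Finset.sum_range_succ]
  congr 1
  · refine Finset.sum_congr rfl fun i hi => ?_
    rw [WittVector.coeff_mk, ← pow_mul, ← pow_succ', Nat.sub_add_comm (Nat.lt_succ_iff.1 (Finset.mem_range.1 hi))]
  · simp

noncomputable def Cn (t : ε → R) (n : ℕ) : Subring R :=
  (MvPolynomial.eval₂Hom (Lam p R n).subtype t).range

theorem Lam_le_Cn (t : ε → R) (n : ℕ) : Lam p R n ≤ Cn p t n := fun a ha =>
  ⟨MvPolynomial.C ⟨a, ha⟩, by simp⟩

theorem t_mem_Cn (t : ε → R) (n : ℕ) (i) : t i ∈ Cn p t n := ⟨MvPolynomial.X i, by simp⟩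

theorem Cn_repr (t : ε → R) (n : ℕ) (a : R) (ha : a ∈ Cn p t n) :
    ∃ l : (ε → Fin (p ^ n)) → R, (∀ I, l I ∈ Lam p R n) ∧ a = ∑ I, l I * ∏ i, t i ^ (I i).val :=
  gen1 (p ^ n) (pow_pos (Fact.out : p.Prime).pos _) _ t (fun i => Lam_pow p n _) a ha

theorem mon_mem (t : ε → R) (n : ℕ) (I : ε → ℕ) : ∏ i, t i ^ I i ∈ Cn p t n :=
  prod_mem fun i _ => pow_mem (t_mem_Cn p t n i) _

theorem Cn_p (t : ε → R) (n : ℕ) (a : R) (h : a ∈ Cn p t n) : p * a ∈ Cn p t (n + 1) := by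
  obtain ⟨l, hl, rfl⟩ := Cn_repr p t n a h
  rw [Finset.mul_sum]
  refine sum_mem fun I _ => ?_
  rw [← mul_assoc]
  exact mul_mem (Lam_le_Cn p t _ (Lam_p p n _ (hl I))) (mon_mem p t _ _)

variable [IsLocalRing R]

noncomputable def Vn (t : ε → R) (n : ℕ) : Subring R :=
  ((Cn p t n).map (Ideal.Quotient.mk (maximalIdeal R ^ (n + 1)))).comap (Ideal.Quotient.mk (maximalIdeal R ^ (n + 1)))

theorem mem_Vn {t : ε → R} {n : ℕ} {a : R} : a ∈ Vn p t n ↔ ∃ c ∈ Cn p t n, a - c ∈ maximalIdeal R ^ (n + 1) := by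
  constructor
  · rintro ⟨c, hc, h⟩
    exact ⟨c, hc, Ideal.Quotient.eq.1 h.symm⟩
  · rintro ⟨c, hc, h⟩
    exact ⟨c, hc, (Ideal.Quotient.eq.2 h).symm⟩

theorem Cn_le_Vn (t : ε → R) (n : ℕ) : Cn p t n ≤ Vn p t n := fun a ha => (mem_Vn p).2 ⟨a, ha, by simp⟩

theorem Vn_of_sub {t : ε → R} {n : ℕ} {a b : R} (hb : b ∈ Vn p t n) (h : a - b ∈ maximalIdeal R ^ (n + 1)) : a ∈ Vn p t n := by
  have : a - b ∈ Vn p t n := (mem_Vn p).2 ⟨0, zero_mem _, by simpa using h⟩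
  simpa using add_mem this hb

theorem Vn_p (hp : (p : R) ∈ maximalIdeal R) (t : ε → R) (n : ℕ) (a : R) (h : a ∈ Vn p t n) : p * a ∈ Vn p t (n + 1) := by
  obtain ⟨c, hc, h⟩ := (mem_Vn p).1 h
  refine (mem_Vn p).2 ⟨_, Cn_p p t n c hc, ?_⟩
  rw [← mul_sub, pow_succ']
  exact Ideal.mul_mem_mul hp h

theorem Vn_succ_le (hp : (p : R) ∈ maximalIdeal R) (t : ε → R) (n : ℕ) : Vn p t (n + 1) ≤ Vn p t n := by
  intro a ha
  obtain ⟨c, hc, h⟩ := (mem_Vn p).1 ha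
  refine Vn_of_sub p ?_ (Ideal.pow_le_pow_right (Nat.le_succ _) h)
  obtain ⟨l, hl, rfl⟩ := Cn_repr p t _ c hc
  refine sum_mem fun I _ => mul_mem ?_ (Cn_le_Vn p t n (mon_mem p t _ _))
  obtain ⟨b, hb, c, h⟩ := Lam_succ p n _ (hl I)
  rw [h]
  refine Vn_of_sub p (Cn_le_Vn p t n (Lam_le_Cn p t n hb)) ?_
  rw [add_sub_cancel_left]
  exact Ideal.mul_mem_right _ _ (Ideal.pow_mem_pow hp _)

theorem Vn_max (hp : (p : R) ∈ maximalIdeal R) (t : ε → R) [CharP (ResidueField R) p]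
    (hβ : ∀ c : (ε → Fin p) → ResidueField R, ∑ I, c I ^ p * ∏ i, (residue R (t i)) ^ (I i).val = 0 → ∀ I, c I = 0)
    (n : ℕ) (a : R) (ha : a ∈ Vn p t (n + 1)) (ham : a ∈ maximalIdeal R) :
    ∃ b ∈ Vn p t n, a - p * b ∈ maximalIdeal R ^ (n + 2) := by
  obtain ⟨c, hc, h⟩ := (mem_Vn p).1 ha
  have hcm : c ∈ maximalIdeal R := by
    have := sub_mem ham (Ideal.pow_le_self (Nat.succ_ne_zero _) h)
    simpa using this
  obtain ⟨l, hl, rfl⟩ := Cn_repr p t _ c hc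
  have := fun I => Lam_split p n _ (hl I)
  choose b l' hl' hll using this
  have hb := pb_beta p (fun i => residue R (t i)) hβ (n + 1) (fun I => residue R (b I)) (by
    rw [← residue_eq_zero_iff] at hcm
    rw [← hcm, map_sum]
    refine Finset.sum_congr rfl fun I _ => ?_
    rw [hll I, map_mul, map_add, map_mul, (residue_eq_zero_iff _).2 hp]
    simp)
  refine ⟨∑ I, l' I * ∏ i, t i ^ (I i).val, sum_mem fun I _ => mul_mem
    (Cn_le_Vn p t n (Lam_le_Cn p t n (hl' I))) (Cn_le_Vn p t n (mon_mem p t _ _)), ?_⟩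
  have h2 : ∑ I, l I * ∏ i, t i ^ (I i).val - p * ∑ I, l' I * ∏ i, t i ^ (I i).val ∈ maximalIdeal R ^ (n + 2) := by
    rw [Finset.mul_sum, ← Finset.sum_sub_distrib]
    refine sum_mem fun I _ => ?_
    rw [hll I, add_mul, mul_assoc, add_sub_cancel_right]
    refine Ideal.mul_mem_right _ _ (Ideal.pow_le_pow_right ?_ (Ideal.pow_mem_pow ((residue_eq_zero_iff _).1 (hb I)) _))
    exact Nat.lt_pow_self (Fact.out : p.Prime).one_lt
  have := add_mem h h2
  simpa using this

theorem Cn_surj (t : ε → R) [CharP (ResidueField R) p]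
    (hα : ∀ a : ResidueField R, ∃ c : (ε → Fin p) → ResidueField R, a = ∑ I, c I ^ p * ∏ i, (residue R (t i)) ^ (I i).val)
    (n : ℕ) (a : R) : ∃ b ∈ Cn p t n, a - b ∈ maximalIdeal R := by
  have key : ∀ j, j ≤ n → ∀ a : ResidueField R, a ^ p ^ (n - j) ∈ (Cn p t n).map (residue R) := by
    intro j hj
    induction j with
    | zero =>
      intro a
      obtain ⟨a, rfl⟩ := residue_surjective a
      exact ⟨a ^ p ^ n, Lam_le_Cn p t n (Lam_pow p n a), by simp⟩
    | succ j ih =>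
      intro a
      obtain ⟨c, hc⟩ := hα a
      rw [hc, sum_pow_char_pow]
      refine sum_mem fun I _ => ?_
      rw [mul_pow, ← pow_mul, ← pow_succ', show n - (j + 1) + 1 = n - j by omega]
      have ht : ∀ i, residue R (t i) ∈ (Cn p t n).map (residue R) := fun i => ⟨t i, t_mem_Cn p t n i, rfl⟩
      exact mul_mem (ih (by omega) _) (pow_mem (prod_mem fun i _ => pow_mem (ht i) _) _)
  obtain ⟨b, hb, h⟩ := key n le_rfl (residue R a)
  refine ⟨b, hb, ?_⟩
  rw [← residue_eq_zero_iff, map_sub, h]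
  simp

theorem Vn_ext (hp : (p : R) ∈ maximalIdeal R) (t : ε → R) [CharP (ResidueField R) p]
    (hα : ∀ a : ResidueField R, ∃ c : (ε → Fin p) → ResidueField R, a = ∑ I, c I ^ p * ∏ i, (residue R (t i)) ^ (I i).val)
    (hβ : ∀ c : (ε → Fin p) → ResidueField R, ∑ I, c I ^ p * ∏ i, (residue R (t i)) ^ (I i).val = 0 → ∀ I, c I = 0)
    (n : ℕ) : ∀ a ∈ Vn p t n, ∃ b ∈ Vn p t (n + 1), b - a ∈ maximalIdeal R ^ (n + 1) := by
  induction n with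
  | zero =>
    intro a _
    obtain ⟨b, hb, h⟩ := Cn_surj p t hα 1 a
    exact ⟨b, Cn_le_Vn p t 1 hb, by rw [zero_add, pow_one, ← neg_sub]; exact neg_mem h⟩
  | succ n ih =>
    intro a ha
    obtain ⟨v, hv, h⟩ := Cn_surj p t hα (n + 2) a
    have hv1 := Vn_succ_le p hp t _ (Cn_le_Vn p t _ hv)
    obtain ⟨w, hw, h2⟩ := Vn_max p hp t hβ n (a - v) (sub_mem ha hv1) h
    obtain ⟨w', hw', h3⟩ := ih w hw
    refine ⟨v + p * w', add_mem (Cn_le_Vn p t _ hv) (Vn_p p hp t _ _ hw'), ?_⟩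
    have h4 : (p : R) * (w' - w) ∈ maximalIdeal R ^ (n + 2) := by
      rw [pow_succ']
      exact Ideal.mul_mem_mul hp h3
    have := sub_mem h4 h2
    convert this using 1
    ring
end Vring

/-- `V` is a Cohen-type coefficient subring. -/
structure IsCoeff {R : Type} [CommRing R] [IsLocalRing R] (p : ℕ) (V : Subring R) : Prop where
  surj : ∀ r : R, ∃ v ∈ V, r - v ∈ maximalIdeal R
  pmax : ∀ v ∈ V, v ∈ maximalIdeal R → ∃ w ∈ V, v = p * w
  closed : ∀ r : R, (∀ n, ∃ v ∈ V, r - v ∈ maximalIdeal R ^ n) → r ∈ V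

section
variable {R : Type} [CommRing R] [IsLocalRing R] [IsNoetherianRing R]

theorem krull_closed (I : Ideal R) (x : R) (h : ∀ n, ∃ y ∈ I, x - y ∈ maximalIdeal R ^ n) : x ∈ I := by
  by_cases hI : I = ⊤
  · rw [hI]; trivial
  rw [← Ideal.Quotient.eq_zero_iff_mem]
  have _ : Nontrivial (R ⧸ I) := Ideal.Quotient.nontrivial_iff.2 hI
  have _ : IsLocalRing (R ⧸ I) := IsLocalRing.of_surjective' _ Ideal.Quotient.mk_surjective
  have hb := Ideal.iInf_pow_eq_bot_of_isLocalRing (maximalIdeal (R ⧸ I)) (Ideal.IsPrime.ne_top inferInstance)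
  rw [← Ideal.mem_bot, ← hb, Ideal.mem_iInf]
  intro n
  obtain ⟨y, hy, h⟩ := h n
  have h1 := Ideal.mem_map_of_mem (Ideal.Quotient.mk I) h
  rw [map_sub, Ideal.Quotient.eq_zero_iff_mem.2 hy, sub_zero, Ideal.map_pow] at h1
  refine Ideal.pow_right_mono ?_ n h1
  rw [Ideal.map_le_iff_le_comap]
  exact (IsLocalRing.eq_maximalIdeal (Ideal.comap_isMaximal_of_surjective _ Ideal.Quotient.mk_surjective)).ge

theorem exists_coeff {ε : Type} [Fintype ε] [DecidableEq ε] [IsDomain R] [IsAdicComplete (maximalIdeal R) R]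
    (p : ℕ) [Fact p.Prime] [CharP (ResidueField R) p] (hp : (p : R) ∈ maximalIdeal R) (hp0 : (p : R) ≠ 0) (t : ε → R)
    (hα : ∀ a : ResidueField R, ∃ c : (ε → Fin p) → ResidueField R, a = ∑ I, c I ^ p * ∏ i, (residue R (t i)) ^ (I i).val)
    (hβ : ∀ c : (ε → Fin p) → ResidueField R, ∑ I, c I ^ p * ∏ i, (residue R (t i)) ^ (I i).val = 0 → ∀ I, c I = 0) :
    ∃ V : Subring R, IsCoeff p V ∧ ∀ i, t i ∈ V := by
  have hmono : ∀ m n, m ≤ n → Vn p t n ≤ Vn p t m := fun m n h => by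
    induction h with
    | refl => exact le_rfl
    | step _ ih => exact (Vn_succ_le p hp t _).trans ih
  have hmem : ∀ x, x ∈ (⨅ n, Vn p t n) ↔ ∀ n, x ∈ Vn p t n := fun x => by rw [Subring.mem_iInf]
  refine ⟨⨅ n, Vn p t n, ⟨?_, ?_, ?_⟩, fun i => (hmem _).2 fun n => Cn_le_Vn p t n (t_mem_Cn p t n i)⟩
  · intro r
    obtain ⟨v0, hv0, h0⟩ := Cn_surj p t hα 0 r
    choose! F hF hF' using Vn_ext p hp t hα hβ
    let f : ℕ → R := fun n => Nat.rec v0 (fun n x => F n x) n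
    have hf : ∀ n, f n ∈ Vn p t n := fun n => by
      induction n with
      | zero => exact Cn_le_Vn p t 0 hv0
      | succ n ih => exact hF n _ ih
    have hff : ∀ n, f (n + 1) - f n ∈ maximalIdeal R ^ (n + 1) := fun n => hF' n _ (hf n)
    have hc : ∀ m n, m ≤ n → f n - f m ∈ maximalIdeal R ^ (m + 1) := fun m n h => by
      induction n, h using Nat.le_induction with
      | base => simp
      | succ n h ih =>
        have := add_mem (Ideal.pow_le_pow_right (by omega) (hff n)) ih
        simpa using this
    obtain ⟨L, hL⟩ := IsPrecomplete.prec (inferInstance : IsPrecomplete (maximalIdeal R) R) (f := f) (fun {m n} h => by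
      rw [smul_eq_mul, Ideal.mul_top]
      refine (SModEq.sub_mem.2 ?_).symm
      exact Ideal.pow_le_pow_right (Nat.le_succ m) (hc m n h))
    have hL' : ∀ n, L - f n ∈ maximalIdeal R ^ (n + 1) := fun n => by
      have h1 := hL (n + 1)
      rw [smul_eq_mul, Ideal.mul_top] at h1
      have := sub_mem (hff n) (SModEq.sub_mem.1 h1)
      simpa using this
    refine ⟨L, (hmem _).2 fun n => Vn_of_sub p (hf n) (hL' n), ?_⟩
    have := sub_mem h0 (by simpa using hL' 0)
    simpa [f] using this
  · intro v hv hm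
    have h1 := fun n => Vn_max p hp t hβ n v ((hmem _).1 hv _) hm
    have h2 : v ∈ Ideal.span {(p : R)} := by
      refine krull_closed _ _ fun n => ?_
      obtain ⟨b, _, h⟩ := h1 n
      exact ⟨p * b, Ideal.mul_mem_right _ _ (Ideal.mem_span_singleton_self _), Ideal.pow_le_pow_right (by omega) h⟩
    obtain ⟨w, rfl⟩ := Ideal.mem_span_singleton.1 h2
    refine ⟨w, (hmem _).2 fun n => ?_, rfl⟩
    obtain ⟨c, hc⟩ := Ideal.exists_pow_inf_eq_pow_smul (maximalIdeal R) (Ideal.span {(p : R)})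
    obtain ⟨b, hb, h⟩ := h1 (n + c)
    refine Vn_of_sub p (hmono n _ (by omega) hb) ?_
    rw [← mul_sub] at h
    have h3 : (p : R) * (w - b) ∈ maximalIdeal R ^ (n + c + 2) • (⊤ : Ideal R) ⊓ Ideal.span {(p : R)} :=
      ⟨by simpa using h, Ideal.mul_mem_right _ _ (Ideal.mem_span_singleton_self _)⟩
    rw [hc (n + c + 2) (by omega)] at h3
    have h4 := Submodule.smul_mono le_rfl inf_le_right h3
    rw [smul_eq_mul, mul_comm, Ideal.mem_span_singleton_mul] at h4
    obtain ⟨z, hz, h5⟩ := h4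
    rw [← mul_left_cancel₀ hp0 h5]
    exact Ideal.pow_le_pow_right (by omega) hz
  · intro r h
    refine (hmem _).2 fun n => ?_
    obtain ⟨v, hv, h⟩ := h (n + 1)
    exact Vn_of_sub p ((hmem _).1 hv n) h

variable {p : ℕ} {V : Subring R}

theorem IsCoeff.pow (h : IsCoeff p V) (hp : (p : R) ∈ maximalIdeal R) [IsDomain R] (hp0 : (p : R) ≠ 0) (n : ℕ) (v : R) (hv : v ∈ V) (hm : (p : R) ^ n ∣ v) :
    ∃ w ∈ V, v = p ^ n * w := by
  induction n generalizing v with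
  | zero => exact ⟨v, hv, by simp⟩
  | succ n ih =>
    obtain ⟨w, hw, rfl⟩ := ih v hv ((pow_dvd_pow _ (Nat.le_succ n)).trans hm)
    rw [pow_succ, mul_dvd_mul_iff_left (pow_ne_zero _ hp0)] at hm
    obtain ⟨w', hw', rfl⟩ := h.pmax w hw ((maximalIdeal R).mem_of_dvd hm hp)
    exact ⟨w', hw', by ring⟩

theorem IsCoeff.complete [IsDomain R] (h : IsCoeff p V) [IsAdicComplete (maximalIdeal R) R] (hp : (p : R) ∈ maximalIdeal R) (hp0 : (p : R) ≠ 0) :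
    IsAdicComplete (Ideal.span {(p : V)}) V := by
  have hd : ∀ n (x : V), x ∈ (Ideal.span {(p : V)} ^ n • ⊤ : Ideal V) ↔ (p : R) ^ n ∣ x := by
    intro n x
    rw [smul_eq_mul, Ideal.mul_top, Ideal.span_singleton_pow, Ideal.mem_span_singleton]
    constructor
    · rintro ⟨y, rfl⟩
      exact ⟨y, by simp⟩
    · intro hx
      obtain ⟨w, hw, h2⟩ := h.pow hp hp0 n x x.2 hx
      exact ⟨⟨w, hw⟩, Subtype.ext (by simpa using h2)⟩
  have hpn : ∀ n (x : R), (p : R) ^ n ∣ x → x ∈ maximalIdeal R ^ n := fun n x hx =>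
    Ideal.mem_of_dvd _ hx (Ideal.pow_mem_pow hp _)
  refine { haus' := ?_, prec' := ?_ }
  · intro x hx
    ext
    refine IsHausdorff.haus (inferInstance : IsHausdorff (maximalIdeal R) R) x.1 fun n => ?_
    have := (hd n _).1 (SModEq.sub_mem.1 (hx n))
    rw [SModEq.sub_mem, smul_eq_mul, Ideal.mul_top]
    exact hpn _ _ (by simpa using this)
  · intro f hf
    have hf' : ∀ {m n}, m ≤ n → (p : R) ^ m ∣ f m - f n := fun {m n} hmn => by
      simpa using (hd m _).1 (SModEq.sub_mem.1 (hf hmn))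
    obtain ⟨L, hL⟩ := IsPrecomplete.prec (inferInstance : IsPrecomplete (maximalIdeal R) R) (f := fun n => (f n : R)) (fun {m n} hmn => by
      rw [SModEq.sub_mem, smul_eq_mul, Ideal.mul_top]
      exact hpn _ _ (hf' hmn))
    have hL' : ∀ n, f n - L ∈ maximalIdeal R ^ n := fun n => by
      have := SModEq.sub_mem.1 (hL n)
      rwa [smul_eq_mul, Ideal.mul_top] at this
    have hLV : L ∈ V := h.closed L fun n => ⟨f n, (f n).2, by rw [← neg_sub]; exact neg_mem (hL' n)⟩
    refine ⟨⟨L, hLV⟩, fun n => ?_⟩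
    rw [SModEq.sub_mem, hd, ← Ideal.mem_span_singleton]
    refine krull_closed _ _ fun k => ?_
    refine ⟨f n - f (max n k), ?_, ?_⟩
    · exact Ideal.mem_span_singleton.2 (hf' (le_max_left _ _))
    · have := Ideal.pow_le_pow_right (le_max_right n k) (hL' (max n k))
      simpa using this

theorem IsCoeff.unit [IsDomain R] (h : IsCoeff p V) [IsAdicComplete (maximalIdeal R) R] (hp : (p : R) ∈ maximalIdeal R) (hp0 : (p : R) ≠ 0)
    (v : V) (hv : (v : R) ∉ maximalIdeal R) : IsUnit v := by
  have _ := h.complete hp hp0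
  obtain ⟨u, hu⟩ := (IsLocalRing.notMem_maximalIdeal.1 hv).exists_right_inv
  obtain ⟨w, hw, hw'⟩ := h.surj u
  obtain ⟨z, hz, h2⟩ := h.pmax (v.1 * w - 1) (sub_mem (mul_mem v.2 hw) (one_mem _)) (by
    rw [← hu, ← mul_sub, ← neg_sub, mul_neg]
    exact neg_mem (Ideal.mul_mem_left _ _ hw'))
  have h3 : v * ⟨w, hw⟩ = (p : V) * ⟨z, hz⟩ + 1 := by
    ext
    push_cast
    rw [← h2]; ring
  have h4 : (p : V) ∈ Ideal.jacobson (⊥ : Ideal V) := IsAdicComplete.le_jacobson_bot (Ideal.span {(p : V)}) (Ideal.mem_span_singleton_self _)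
  rw [Ideal.mem_jacobson_bot] at h4
  have := h4 ⟨z, hz⟩
  rw [← h3] at this
  exact isUnit_of_mul_isUnit_left this

theorem IsCoeff.dvr [IsDomain R] (h : IsCoeff p V) [IsAdicComplete (maximalIdeal R) R] (hp : (p : R) ∈ maximalIdeal R) (hp0 : (p : R) ≠ 0) :
    IsDiscreteValuationRing V := by
  apply IsDiscreteValuationRing.ofHasUnitMulPowIrreducibleFactorization
  have hpu : ¬ IsUnit (p : V) := fun hu => by
    have := hu.map V.subtype
    rw [map_natCast] at this
    exact (IsLocalRing.mem_maximalIdeal _).1 hp this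
  have hdv : ∀ v : V, v.1 ∈ maximalIdeal R → (p : V) ∣ v := fun v hv => by
    obtain ⟨w, hw, h2⟩ := h.pmax v v.2 hv
    exact ⟨⟨w, hw⟩, Subtype.ext (by simpa using h2)⟩
  refine ⟨p, ?_, ?_⟩
  · refine ⟨hpu, fun a b hab => ?_⟩
    by_contra! hn
    have ha : a.1 ∈ maximalIdeal R := by
      by_contra h'; exact hn.1 (h.unit hp hp0 a h')
    have hb : b.1 ∈ maximalIdeal R := by
      by_contra h'; exact hn.2 (h.unit hp hp0 b h')
    obtain ⟨a, rfl⟩ := hdv a ha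
    obtain ⟨b, rfl⟩ := hdv b hb
    have hpV : (p : V) ≠ 0 := fun h => hp0 (by simpa using congrArg Subtype.val h)
    refine hpu (IsUnit.of_mul_eq_one (a * b) (mul_left_cancel₀ hpV ?_))
    rw [mul_one]
    conv_rhs => rw [hab]
    ring
  · intro v hv
    have hne : ∃ n, ¬ (p : R) ^ n ∣ v := by
      by_contra! hall
      refine hv (Subtype.ext ?_)
      refine IsHausdorff.haus (inferInstance : IsHausdorff (maximalIdeal R) R) v.1 fun n => ?_
      rw [SModEq.sub_mem, smul_eq_mul, Ideal.mul_top, sub_zero]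
      exact Ideal.mem_of_dvd _ (hall n) (Ideal.pow_mem_pow hp _)
    classical
    obtain ⟨n, hn⟩ : ∃ n, Nat.find hne = n + 1 := Nat.exists_eq_succ_of_ne_zero fun h0 => Nat.find_spec hne (by rw [h0]; simp)
    have h1 := Nat.find_spec hne
    have h2 := Nat.find_min hne (m := n) (by omega)
    rw [hn] at h1
    obtain ⟨w, hw, h3⟩ := h.pow hp hp0 n v v.2 (not_not.1 h2)
    have hwu : IsUnit (⟨w, hw⟩ : V) := h.unit hp hp0 _ fun hm => h1 (by
      obtain ⟨w', hw', rfl⟩ := h.pmax w hw hm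
      exact ⟨w', by rw [h3]; ring⟩)
    refine ⟨n, hwu.unit, Subtype.ext ?_⟩
    simp [h3]
end

section psV
open MvPowerSeries
variable {V σ : Type} [CommRing V] [Fintype σ] [DecidableEq σ]

theorem mem_KX_of (T : Finset σ) (f : MvPowerSeries σ V) (h : ∀ n : σ →₀ ℕ, (∀ s ∈ T, n s = 0) → coeff n f = 0) :
    f ∈ Ideal.span ((X : σ → MvPowerSeries σ V) '' T) := by
  induction T using Finset.induction_on generalizing f with
  | empty =>
    have : f = 0 := by ext n; exact h n (by simp)
    rw [this]; exact zero_mem _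
  | insert s T hs ih =>
    let f0 : MvPowerSeries σ V := fun n => if n s = 0 then coeff n f else 0
    have hf0 : ∀ n, coeff n f0 = if n s = 0 then coeff n f else 0 := fun n => rfl
    have h1 : (X s : MvPowerSeries σ V) ∣ f - f0 := by
      rw [X_dvd_iff]
      intro m hm
      rw [map_sub, hf0, if_pos hm, sub_self]
    have h2 : f0 ∈ Ideal.span ((X : σ → MvPowerSeries σ V) '' T) := by
      refine ih f0 fun n hn => ?_
      rw [hf0]
      split_ifs with h0
      · refine h n fun i hi => ?_
        rcases Finset.mem_insert.1 hi with rfl | hi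
        · exact h0
        · exact hn i hi
      · rfl
    have h3 : f0 ∈ Ideal.span ((X : σ → MvPowerSeries σ V) '' (insert s T : Finset σ)) :=
      Ideal.span_mono (Set.image_mono (by simp)) h2
    have h4 := Ideal.mem_of_dvd _ h1 (Ideal.subset_span ⟨s, by simp, rfl⟩ :
      X s ∈ Ideal.span ((X : σ → MvPowerSeries σ V) '' (insert s T : Finset σ)))
    simpa using add_mem h4 h3

theorem mem_KX (T : Finset σ) (f : MvPowerSeries σ V) : f ∈ Ideal.span ((X : σ → MvPowerSeries σ V) '' T) ↔
    ∀ n : σ →₀ ℕ, (∀ s ∈ T, n s = 0) → coeff n f = 0 := by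
  refine ⟨fun hf => ?_, mem_KX_of T f⟩
  induction hf using Submodule.span_induction with
  | mem x h =>
    obtain ⟨s, hs, rfl⟩ := h
    intro n hn
    exact X_dvd_iff.1 dvd_rfl n (hn s hs)
  | zero => simp
  | add x y _ _ hx hy => intro n hn; rw [map_add, hx n hn, hy n hn, add_zero]
  | smul a x _ hx =>
    intro n hn
    rw [smul_eq_mul, coeff_mul]
    refine Finset.sum_eq_zero fun ij hij => ?_
    rw [Finset.HasAntidiagonal.mem_antidiagonal] at hij
    rw [hx ij.2 fun s hs => ?_, mul_zero]
    have := hn s hs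
    rw [← hij, Finsupp.add_apply] at this
    omega

theorem mem_KXp (T : Finset σ) (a : V) (f : MvPowerSeries σ V) :
    f ∈ Ideal.span ((X : σ → MvPowerSeries σ V) '' T) ⊔ Ideal.span {C a} ↔
    ∀ n : σ →₀ ℕ, (∀ s ∈ T, n s = 0) → a ∣ coeff n f := by
  rw [msp]
  constructor
  · rintro ⟨g, hg⟩ n hn
    have := (mem_KX _ _).1 hg n hn
    rw [map_sub, coeff_C_mul, sub_eq_zero] at this
    exact ⟨_, this⟩
  · intro h
    have : ∀ n : σ →₀ ℕ, ∃ g : V, (∀ s ∈ T, n s = 0) → coeff n f = a * g := fun n => by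
      by_cases hn : ∀ s ∈ T, n s = 0
      · obtain ⟨g, hg⟩ := h n hn
        exact ⟨g, fun _ => hg⟩
      · exact ⟨0, fun h => absurd h hn⟩
    choose g hg using this
    let g' : MvPowerSeries σ V := g
    have hg' : ∀ n, coeff n g' = g n := fun n => rfl
    refine ⟨g', (mem_KX _ _).2 fun n hn => ?_⟩
    rw [map_sub, coeff_C_mul, hg', hg n hn, sub_self]

theorem emb_off (T : Finset σ) (n : σ →₀ ℕ) : (∀ s ∈ T, n s = 0) ↔
    ∃ m, n = Finsupp.embDomain (Function.Embedding.subtype fun s => s ∉ T) m := by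
  have := Finsupp.mem_range_embDomain_iff (Function.Embedding.subtype fun s => s ∉ T) n
  rw [show (∃ m, n = Finsupp.embDomain (Function.Embedding.subtype fun s => s ∉ T) m) ↔
    n ∈ Set.range (Finsupp.embDomain (Function.Embedding.subtype fun s => s ∉ T)) from
    ⟨fun ⟨m, h⟩ => ⟨m, h.symm⟩, fun ⟨m, h⟩ => ⟨m, h.symm⟩⟩, this]
  constructor
  · intro h s hs
    have : s ∉ T := fun hT => by simp [h s hT] at hs
    exact ⟨⟨s, this⟩, rfl⟩
  · intro h s hs
    by_contra h0
    obtain ⟨⟨s', hs'⟩, rfl⟩ := h (by simpa using h0 : s ∈ (n.support : Set σ))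
    exact hs' hs

theorem KX_prime [IsDomain V] (T : Finset σ) : (Ideal.span ((X : σ → MvPowerSeries σ V) '' T)).IsPrime := by
  have : Ideal.span ((X : σ → MvPowerSeries σ V) '' T) =
      RingHom.ker (killCompl (R := V) (Function.Embedding.subtype fun s => s ∉ T)).toRingHom := by
    ext f
    rw [mem_KX, RingHom.mem_ker, MvPowerSeries.ext_iff]
    constructor
    · intro h n
      exact h _ ((emb_off T _).2 ⟨n, rfl⟩)
    · intro h n hn
      obtain ⟨m, rfl⟩ := (emb_off T n).1 hn
      exact h m
  rw [this]
  have _ : IsDomain (MvPowerSeries { s // s ∉ T } V) := NoZeroDivisors.to_isDomain _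
  exact RingHom.ker_isPrime _

theorem KXp_prime [IsDomain V] {k : Type} [Field k] (T : Finset σ) (a : V) (π : V →+* k) (hπ : ∀ v, π v = 0 ↔ a ∣ v) :
    (Ideal.span ((X : σ → MvPowerSeries σ V) '' T) ⊔ Ideal.span {C a}).IsPrime := by
  have : Ideal.span ((X : σ → MvPowerSeries σ V) '' T) ⊔ Ideal.span {C a} =
      RingHom.ker ((MvPowerSeries.map π).comp (killCompl (R := V) (Function.Embedding.subtype fun s => s ∉ T)).toRingHom) := by
    ext f
    rw [mem_KXp, RingHom.mem_ker, MvPowerSeries.ext_iff]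
    constructor
    · intro h n
      exact (hπ _).2 (h _ ((emb_off T _).2 ⟨n, rfl⟩))
    · intro h n hn
      obtain ⟨m, rfl⟩ := (emb_off T n).1 hn
      exact (hπ _).1 (h m)
  rw [this]
  have _ : IsDomain (MvPowerSeries { s // s ∉ T } k) := NoZeroDivisors.to_isDomain _
  exact RingHom.ker_isPrime _

theorem KX_nice [IsDomain V] {k : Type} [Field k] (T : Finset σ) (p : ℕ) (π : V →+* k) (hπ : ∀ v, π v = 0 ↔ (p : V) ∣ v)
    (hp0 : (p : V) ≠ 0) (hd : ∀ v : V, (∀ b, (p : V) ^ b ∣ v) → v = 0) :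
    Nice p (Ideal.span ((X : σ → MvPowerSeries σ V) '' T)) := by
  have hC : (p : MvPowerSeries σ V) = C (p : V) := by simp
  refine ⟨fun f hf => ?_, ?_, fun f hf => ?_⟩
  · rw [mem_KX] at hf ⊢
    intro n hn
    have := hf n hn
    rw [hC, coeff_C_mul] at this
    exact (mul_eq_zero.1 this).resolve_left hp0
  · rw [hC]
    exact KXp_prime T _ π hπ
  · rw [mem_KX]
    intro n hn
    refine hd _ fun b => ?_
    have := hf b
    rw [hC, ← map_pow, mem_KXp] at this
    exact this n hn

theorem X_notMem_KXp {k : Type} [Field k] (T : Finset σ) (s : σ) (hs : s ∉ T) (p : ℕ) (π : V →+* k) (hπ : ∀ v, π v = 0 ↔ (p : V) ∣ v) :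
    (X s : MvPowerSeries σ V) ∉ Ideal.span ((X : σ → MvPowerSeries σ V) '' T) ⊔ Ideal.span {(p : MvPowerSeries σ V)} := by
  have hC : (p : MvPowerSeries σ V) = C (p : V) := by simp
  rw [hC, mem_KXp]
  intro h
  have := h (Finsupp.single s 1) (fun i hi => by
    rw [Finsupp.single_apply, if_neg]
    rintro rfl; exact hs hi)
  rw [coeff_index_single_self_X, ← hπ, map_one] at this
  exact one_ne_zero this

theorem pdvd_iff {k : Type} [Field k] (p : ℕ) (π : V →+* k) (hπ : ∀ v, π v = 0 ↔ (p : V) ∣ v) (f : MvPowerSeries σ V) :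
    (p : MvPowerSeries σ V) ∣ f ↔ MvPowerSeries.map π f = 0 := by
  have h := mem_KXp (∅ : Finset σ) (p : V) f
  have hC : (p : MvPowerSeries σ V) = C (p : V) := by simp
  simp only [Finset.coe_empty, Set.image_empty, Ideal.span_empty, bot_sup_eq, ← hC, Ideal.mem_span_singleton] at h
  rw [h, MvPowerSeries.ext_iff]
  simp [hπ]

theorem V_alpha {k ε : Type} [Field k] [Fintype ε] [DecidableEq ε] (p : ℕ) [Fact p.Prime] [CharP k p]
    (π : V →+* k) (hπ : ∀ v, π v = 0 ↔ (p : V) ∣ v) (hs : Function.Surjective π) (t : ε → V)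
    (hα : ∀ a : k, ∃ c : (ε → Fin p) → k, a = ∑ I, c I ^ p * ∏ i, (π (t i)) ^ (I i).val) (a : MvPowerSeries σ V) :
    ∃ c : (σ ⊕ ε → Fin p) → MvPowerSeries σ V, (p : MvPowerSeries σ V) ∣ a - ∑ I, c I ^ p * ∏ o, (Sum.elim (fun s => MvPowerSeries.X s)
      (fun s => MvPowerSeries.C (t s)) o : MvPowerSeries σ V) ^ (I o).val := by
  obtain ⟨c, hc⟩ := ps_alpha (σ := σ) p (fun i => π (t i)) hα (MvPowerSeries.map π a)
  have hsur : ∀ f : MvPowerSeries σ k, ∃ g, MvPowerSeries.map π g = f := fun f => by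
    choose g hg using hs
    let g' : MvPowerSeries σ V := fun n => g (coeff n f)
    refine ⟨g', ?_⟩
    ext n
    exact hg _
  choose g hg using hsur
  refine ⟨fun I => g (c I), ?_⟩
  rw [pdvd_iff p π hπ, map_sub, hc, map_sum, sub_eq_zero]
  refine Finset.sum_congr rfl fun I _ => ?_
  rw [map_mul, map_pow, hg, map_prod]
  congr 1
  refine Finset.prod_congr rfl fun o _ => ?_
  cases o <;> simp

theorem V_beta {k ε : Type} [Field k] [Fintype ε] [DecidableEq ε] (p : ℕ) [Fact p.Prime] [CharP k p]
    (π : V →+* k) (hπ : ∀ v, π v = 0 ↔ (p : V) ∣ v) (t : ε → V)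
    (hβ : ∀ c : (ε → Fin p) → k, ∑ I, c I ^ p * ∏ i, (π (t i)) ^ (I i).val = 0 → ∀ I, c I = 0)
    (c : (σ ⊕ ε → Fin p) → MvPowerSeries σ V) (hc : (p : MvPowerSeries σ V) ∣ ∑ I, c I ^ p * ∏ o, (Sum.elim (fun s => MvPowerSeries.X s)
      (fun s => MvPowerSeries.C (t s)) o : MvPowerSeries σ V) ^ (I o).val) (I) : (p : MvPowerSeries σ V) ∣ c I := by
  rw [pdvd_iff p π hπ] at hc ⊢
  refine ps_beta p (fun i => π (t i)) hβ (fun I => MvPowerSeries.map π (c I)) ?_ I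
  rw [← hc, map_sum]
  refine Finset.sum_congr rfl fun I _ => ?_
  rw [map_mul, map_pow, map_prod]
  congr 1
  refine Finset.prod_congr rfl fun o _ => ?_
  cases o <;> simp
end psV

section
open MvPowerSeries
variable {R : Type} [CommRing R] [IsLocalRing R] [IsNoetherianRing R]

theorem exists_ev [IsAdicComplete (maximalIdeal R) R] {σ : Type} [Finite σ] {V : Type} [CommRing V] (φ : V →+* R)
    (y : σ → R) (hy : ∀ s, y s ∈ maximalIdeal R) :
    ∃ ev : MvPowerSeries σ V →+* R, (∀ s, ev (X s) = y s) ∧ ∀ v : V, ev (C v) = φ v := by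
  let _ : UniformSpace V := ⊥
  have _ : DiscreteTopology V := inferInstance
  have _ : IsUniformAddGroup V := inferInstance
  let _ : TopologicalSpace R := (maximalIdeal R).adicTopology
  have had : IsAdic (maximalIdeal R) := rfl
  have _ : IsTopologicalRing R := (maximalIdeal R).ringFilterBasis.isTopologicalRing
  let _ : UniformSpace R := IsTopologicalAddGroup.rightUniformSpace R
  have _ : IsUniformAddGroup R := isUniformAddGroup_of_addCommGroup
  obtain ⟨h1, h2⟩ := (IsAdic.isAdicComplete_iff had).1 inferInstance
  have _ : IsLinearTopology R R := (maximalIdeal R).isLinearTopology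
  have hφ : Continuous φ := continuous_of_discreteTopology
  have ha : HasEval y := by
    refine ⟨fun s => ?_, ?_⟩
    · rw [IsTopologicallyNilpotent, had.hasBasis_nhds_zero.tendsto_right_iff]
      intro n _
      filter_upwards [Filter.eventually_ge_atTop n] with k hk
      exact Ideal.pow_le_pow_right hk (Ideal.pow_mem_pow (hy s) k)
    · rw [Filter.cofinite_eq_bot]; exact Filter.tendsto_bot
  refine ⟨eval₂Hom hφ ha, fun s => ?_, fun v => ?_⟩
  · rw [coe_eval₂Hom, eval₂_X]
  · rw [coe_eval₂Hom, eval₂_C]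

theorem isPrecomplete_pi {B : Type} [CommRing B] (I : Ideal B) [IsPrecomplete I B] (s : ℕ) :
    IsPrecomplete I (Fin s → B) := by
  have key : ∀ (n : ℕ) (v : Fin s → B), v ∈ (I ^ n • ⊤ : Submodule B (Fin s → B)) ↔ ∀ i, v i ∈ I ^ n := by
    intro n v
    constructor
    · intro hv i
      induction hv using Submodule.smul_induction_on' with
      | smul a ha b hb => exact Ideal.mul_mem_right _ _ ha
      | add a _ b _ ha hb => exact add_mem ha hb
    · intro hv
      rw [pi_eq_sum_univ v]
      refine sum_mem fun i _ => Submodule.smul_mem_smul (hv i) trivial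
  refine ⟨fun f hf => ?_⟩
  have h1 : ∀ i, ∃ L : B, ∀ n, f n i ≡ L [SMOD (I ^ n • ⊤ : Submodule B B)] := fun i =>
    IsPrecomplete.prec' (fun n => f n i) fun {m n} hmn => by
      rw [SModEq.sub_mem, smul_eq_mul, Ideal.mul_top]
      exact (key m _).1 ((SModEq.sub_mem).1 (hf hmn)) i
  choose L hL using h1
  refine ⟨L, fun n => ?_⟩
  rw [SModEq.sub_mem, key]
  intro i
  have := hL i n
  rwa [SModEq.sub_mem, smul_eq_mul, Ideal.mul_top] at this

theorem fin_of_precomplete {B M : Type} [CommRing B] [AddCommGroup M] [Module B M] (I : Ideal B) [IsPrecomplete I B]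
    [IsHausdorff I M] (N : Submodule B M) (hN : N.FG) (h : ∀ m : M, ∃ x ∈ N, m - x ∈ (I • ⊤ : Submodule B M)) :
    N = ⊤ := by
  obtain ⟨s, g, rfl⟩ := Submodule.fg_iff_exists_fin_generating_family.1 hN
  have _ := isPrecomplete_pi I s
  rw [← Fintype.range_linearCombination, LinearMap.range_eq_top]
  refine surjective_of_mkQ_comp_surjective (I := I) fun q => ?_
  obtain ⟨m, rfl⟩ := Submodule.mkQ_surjective _ q
  obtain ⟨x, hx, hm⟩ := h m
  rw [← Fintype.range_linearCombination] at hx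
  obtain ⟨c, rfl⟩ := hx
  refine ⟨c, ?_⟩
  rw [LinearMap.comp_apply]
  symm
  rw [← sub_eq_zero, ← map_sub]
  exact (Submodule.Quotient.mk_eq_zero _).2 hm

theorem IsCoeff.fg_approx {p : ℕ} {V : Subring R} (h : IsCoeff p V) (s : ℕ) :
    ∃ N : Submodule V R, N.FG ∧ ∀ r, ∃ x ∈ N, r - x ∈ maximalIdeal R ^ s := by
  induction s with
  | zero => exact ⟨⊥, Submodule.fg_bot, fun r => ⟨0, zero_mem _, by simp⟩⟩
  | succ s ih =>
    obtain ⟨N, hN, hr⟩ := ih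
    obtain ⟨H, hH⟩ := (IsNoetherian.noetherian (maximalIdeal R ^ s))
    have h1 : ∀ e ∈ Ideal.span (H : Set R), ∀ a : R, ∃ x ∈ Submodule.span V (H : Set R),
        a * e - x ∈ maximalIdeal R ^ (s+1) := by
      intro e he
      induction he using Submodule.span_induction with
      | mem e he =>
        intro a
        obtain ⟨v, hv, hav⟩ := h.surj a
        refine ⟨(⟨v, hv⟩ : V) • e, Submodule.smul_mem _ _ (Submodule.subset_span he), ?_⟩
        have : a * e - (⟨v, hv⟩ : V) • e = (a - v) * e := by
          rw [sub_mul]; rfl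
        rw [this, pow_succ']
        refine Ideal.mul_mem_mul hav ?_
        rw [← hH]
        exact Submodule.subset_span he
      | zero => intro a; exact ⟨0, zero_mem _, by simp⟩
      | add e f _ _ he hf =>
        intro a
        obtain ⟨x, hx, h1⟩ := he a
        obtain ⟨y, hy, h2⟩ := hf a
        refine ⟨x + y, add_mem hx hy, ?_⟩
        have := add_mem h1 h2
        convert this using 1; ring
      | smul b e _ he =>
        intro a
        obtain ⟨x, hx, h1⟩ := he (a * b)
        exact ⟨x, hx, by rwa [smul_eq_mul, ← mul_assoc]⟩
    refine ⟨N ⊔ Submodule.span V (H : Set R), hN.sup (Submodule.fg_span H.finite_toSet), fun r => ?_⟩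
    obtain ⟨x, hx, h2⟩ := hr r
    rw [← hH] at h2
    obtain ⟨x', hx', h3⟩ := h1 _ h2 1
    refine ⟨x + x', Submodule.add_mem_sup hx hx', ?_⟩
    convert h3 using 1; ring

theorem IsCoeff.ev_finite {p : ℕ} [IsDomain R] {V : Subring R} (h : IsCoeff p V) [IsAdicComplete (maximalIdeal R) R]
    (hp : (p : R) ∈ maximalIdeal R) (hp0 : (p : R) ≠ 0) {σ : Type} [Finite σ]
    (y : σ → R) (hy : ∀ s, y s ∈ maximalIdeal R) (s : ℕ)
    (hs : maximalIdeal R ^ s ≤ Ideal.span {(p : R)} ⊔ Ideal.span (Set.range y))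
    (ev : MvPowerSeries σ V →+* R) (hX : ∀ s, ev (X s) = y s) (hC : ∀ v : V, ev (C v) = v) : ev.IsIntegral := by
  obtain ⟨N, hN, hr⟩ := h.fg_approx s
  have _ := h.complete hp hp0
  have hJm : Ideal.span (Set.range y) ≤ maximalIdeal R := by
    rw [Ideal.span_le]; rintro _ ⟨i, rfl⟩; exact hy i
  -- step 1
  have h1 : N.map ((Submodule.mkQ (Ideal.span (Set.range y))).restrictScalars V) = ⊤ := by
    have _ : IsHausdorff (Ideal.span {(p : V)}) (R ⧸ Ideal.span (Set.range y)) := by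
      refine ⟨fun q hq => ?_⟩
      obtain ⟨x, rfl⟩ := Ideal.Quotient.mk_surjective q
      rw [Ideal.Quotient.eq_zero_iff_mem]
      refine krull_closed _ _ fun n => ?_
      have h2 := hq n
      rw [SModEq.zero, Ideal.span_singleton_pow, Submodule.ideal_span_singleton_smul,
        Submodule.mem_smul_pointwise_iff_exists] at h2
      obtain ⟨q, _, hq⟩ := h2
      obtain ⟨x', rfl⟩ := Ideal.Quotient.mk_surjective q
      have h3 : Ideal.Quotient.mk (Ideal.span (Set.range y)) ((p:R)^n * x') = Ideal.Quotient.mk _ x := by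
        rw [← hq]
        have : ((p : V) ^ n : V) • x' = (p:R)^n * x' := by
          rw [Subring.smul_def, smul_eq_mul]; simp
        rw [← this]; rfl
      refine ⟨x - p^n * x', Ideal.Quotient.eq.1 h3.symm, ?_⟩
      rw [sub_sub_cancel]
      exact Ideal.mul_mem_right _ _ (Ideal.pow_mem_pow hp n)
    refine fin_of_precomplete (Ideal.span {(p:V)}) _ (hN.map _) fun q => ?_
    obtain ⟨r, rfl⟩ := Ideal.Quotient.mk_surjective q
    obtain ⟨x, hx, hrx⟩ := hr r
    refine ⟨_, Submodule.mem_map_of_mem hx, ?_⟩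
    obtain ⟨a, ha, b, hb, hab⟩ := Submodule.mem_sup.1 (hs hrx)
    obtain ⟨a, rfl⟩ := Ideal.mem_span_singleton.1 ha
    have h3 : (Ideal.Quotient.mk (Ideal.span (Set.range y)) r) - Ideal.Quotient.mk _ x = (p : V) • (Ideal.Quotient.mk _ a) := by
      rw [← map_sub, ← hab, map_add, Ideal.Quotient.eq_zero_iff_mem.2 hb, add_zero]
      have : ((p : V) : V) • a = (p:R) * a := by
        rw [Subring.smul_def, smul_eq_mul]; simp
      rw [← this]; rfl
    exact h3 ▸ Submodule.smul_mem_smul (Ideal.mem_span_singleton_self _) trivial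
  -- step 2
  let _ : Algebra (MvPowerSeries σ V) R := ev.toAlgebra
  obtain ⟨G, hG⟩ := hN
  have hmap : ((Ideal.span (Set.range (X : σ → MvPowerSeries σ V))).map (algebraMap _ R)) = Ideal.span (Set.range y) := by
    rw [Ideal.map_span, ← Set.range_comp]
    congr 2
    funext s
    exact hX s
  have h2 : Submodule.span (MvPowerSeries σ V) (G : Set R) = ⊤ := by
    have _ : IsHausdorff (Ideal.span (Set.range (X : σ → MvPowerSeries σ V))) R := by
      refine ⟨fun x hx => ?_⟩
      refine IsHausdorff.haus (I := maximalIdeal R) inferInstance x fun n => ?_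
      have h3 := hx n
      rw [SModEq.zero, Ideal.smul_top_eq_map, Submodule.restrictScalars_mem, Ideal.map_pow, hmap] at h3
      rw [SModEq.zero, smul_eq_mul, Ideal.mul_top]
      exact Ideal.pow_right_mono hJm n h3
    refine fin_of_precomplete (Ideal.span (Set.range (X : σ → MvPowerSeries σ V))) _ (Submodule.fg_span G.finite_toSet) fun m => ?_
    have h3 : (Ideal.Quotient.mk (Ideal.span (Set.range y)) m) ∈ N.map ((Submodule.mkQ (Ideal.span (Set.range y))).restrictScalars V) := by
      rw [h1]; trivial
    obtain ⟨x, hx, hxm⟩ := h3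
    refine ⟨x, ?_, ?_⟩
    · rw [← hG] at hx
      clear hxm
      induction hx using Submodule.span_induction with
      | mem x hx => exact Submodule.subset_span hx
      | zero => exact zero_mem _
      | add a b ha' hb' ha hb => exact add_mem ha hb
      | smul v a _ ha => 
        have : v • a = (C v : MvPowerSeries σ V) • a := by
          rw [Algebra.smul_def]; change (v:R) * a = ev (C v) * a; rw [hC]
        rw [this]
        exact Submodule.smul_mem _ _ ha
    · rw [Ideal.smul_top_eq_map, Submodule.restrictScalars_mem, hmap]
      exact Ideal.Quotient.eq.1 hxm.symm
  have _ : Module.Finite (MvPowerSeries σ V) R := ⟨⟨G, h2⟩⟩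
  have := Algebra.IsIntegral.of_finite (MvPowerSeries σ V) R
  exact this.isIntegral

theorem ev_inj {A : Type} [CommRing A] [IsDomain A] (ev : A →+* R) (hev : ev.IsIntegral) (d : ℕ)
    (hR : ringKrullDim R = d) (hA : ringKrullDim A ≤ d) : Function.Injective ev := by
  let _ : Algebra A R := ev.toAlgebra
  have _ : Algebra.IsIntegral A R := ⟨hev⟩
  by_contra hi
  have h0 : RingHom.ker ev ≠ ⊥ := fun h => hi ((RingHom.injective_iff_ker_eq_bot _).2 h)
  obtain ⟨l, hl⟩ : ∃ l : LTSeries (PrimeSpectrum R), l.length = d := by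
    have h1 : (d : WithBot ℕ∞) ≤ Order.krullDim (PrimeSpectrum R) := hR.ge
    exact Order.le_krullDim_iff.1 h1
  have hmono : StrictMono (PrimeSpectrum.comap (algebraMap A R)) := by
    intro P Q hPQ
    exact Ideal.IsIntegral.comap_lt_comap (I := P.asIdeal) (J := Q.asIdeal) hPQ
  let l' := l.map _ hmono
  have hlt : (⟨⊥, Ideal.isPrime_bot⟩ : PrimeSpectrum A) < l'.head := by
    change (⊥ : Ideal A) < l'.head.asIdeal
    refine lt_of_lt_of_le (bot_lt_iff_ne_bot.2 h0) ?_
    intro a ha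
    have : ev a = 0 := ha
    change ev a ∈ l.head.asIdeal
    rw [this]; exact zero_mem _
  have h2 := Order.le_krullDim_iff.2 ⟨l'.cons _ hlt, rfl⟩
  have h3 := h2.trans hA
  have h4 : (l'.cons _ hlt).length = d + 1 := by
    rw [RelSeries.cons_length]; change l.length + 1 = d + 1; rw [hl]
  rw [h4] at h3
  have : d + 1 ≤ d := by exact_mod_cast h3
  omega

theorem dim_ps {V : Type} [CommRing V] [IsLocalRing V] [IsNoetherianRing V] {σ : Type} [Fintype σ] [DecidableEq σ] (p : ℕ) (hp : (p : V) ∈ maximalIdeal V)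
    (hV : ∀ v ∈ maximalIdeal V, (p : V) ∣ v) :
    ringKrullDim (MvPowerSeries σ V) ≤ (Fintype.card σ + 1 : ℕ) := by
  classical
  let S : Finset (MvPowerSeries σ V) := insert (p : MvPowerSeries σ V) (Finset.univ.image X)
  have hS : maximalIdeal (MvPowerSeries σ V) ≤ Ideal.span (S : Set (MvPowerSeries σ V)) := by
    intro f hf
    have h1 : ¬ IsUnit (constantCoeff f) := fun hu => hf (isUnit_iff_constantCoeff.2 hu)
    obtain ⟨v, hv⟩ := hV _ h1
    have h2 : f - C (constantCoeff f) ∈ Ideal.span ((X : σ → MvPowerSeries σ V) '' (Finset.univ : Finset σ)) := by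
      rw [mem_KX]
      intro n hn
      have : n = 0 := by ext s; exact hn s (Finset.mem_univ s)
      subst this
      simp
    have h3 : C (constantCoeff f) ∈ Ideal.span (S : Set (MvPowerSeries σ V)) := by
      rw [hv, map_mul, map_natCast]
      exact Ideal.mul_mem_right _ _ (Ideal.subset_span (by simp [S]))
    have h4 := add_mem (Ideal.span_mono (by intro a; simp only [S]; simp; tauto) h2) h3
    simpa using h4
  have hS' : maximalIdeal (MvPowerSeries σ V) = Ideal.span (S : Set (MvPowerSeries σ V)) := by
    refine le_antisymm hS (Ideal.span_le.2 fun f hf => ?_)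
    change ¬ IsUnit f
    rw [isUnit_iff_constantCoeff]
    rcases Finset.mem_insert.1 hf with rfl | hf
    · rw [map_natCast]; exact hp
    · obtain ⟨s, _, rfl⟩ := Finset.mem_image.1 hf
      simp
  refine (ringKrullDim_le_spanFinrank_maximalIdeal _).trans ?_
  have h1 := Submodule.spanFinrank_span_le_ncard_of_finite (R := MvPowerSeries σ V) S.finite_toSet
  rw [Set.ncard_coe_finset] at h1
  have h2 : S.card ≤ Fintype.card σ + 1 := 
    (Finset.card_insert_le _ _).trans (Nat.add_le_add_right Finset.card_image_le _)
  rw [hS']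
  exact_mod_cast h1.trans h2
end

section
variable {R : Type} [CommRing R]

/-- `dim R/I ≤ e`. -/
def DimLe (I : Ideal R) (e : ℕ) : Prop :=
  ∀ Q : PrimeSpectrum R, I ≤ Q.asIdeal → Order.coheight Q ≤ (e : ℕ∞)

theorem DimLe.mono {I J : Ideal R} {e f : ℕ} (h : DimLe I e) (hIJ : I ≤ J) (hef : e ≤ f) : DimLe J f :=
  fun Q hQ => (h Q (hIJ.trans hQ)).trans (by exact_mod_cast hef)

theorem coset_avoid (s : Set (Ideal R)) (hs : s.Finite) (hp : ∀ P ∈ s, P.IsPrime)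
    (hinc : ∀ P ∈ s, ∀ Q ∈ s, P ≤ Q → P = Q) (a : R) (J : Ideal R) (h : ∀ P ∈ s, ¬ Ideal.span {a} ⊔ J ≤ P) :
    ∃ b ∈ J, ∀ P ∈ s, a + b ∉ P := by
  classical
  let T : Finset (Ideal R) := (hs.toFinset).filter (fun P => a ∉ P)
  let S : Set (Ideal R) := {P ∈ s | a ∈ P}
  have hSf : S.Finite := hs.subset fun P hP => hP.1
  have hnot : ¬ ((J * ∏ P ∈ T, P : Ideal R) : Set R) ⊆ ⋃ P ∈ S, (id P : Ideal R) := by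
    intro hsub
    obtain ⟨P, hP, hle⟩ := (Ideal.subset_union_prime_finite (R := R) hSf (f := id) ⊥ ⊥ fun P hP _ _ => hp P hP.1).1 hsub
    have hPp := hp P hP.1
    rcases (Ideal.IsPrime.mul_le hPp).1 hle with h1 | h1
    · exact h P hP.1 (sup_le ((Ideal.span_singleton_le_iff_mem _).2 hP.2) h1)
    · obtain ⟨Q, hQ, hQP⟩ := (Ideal.IsPrime.prod_le hPp).1 h1
      obtain ⟨hQs, hQa⟩ := Finset.mem_filter.1 hQ
      have := hinc Q (hs.mem_toFinset.1 hQs) P hP.1 hQP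
      rw [this] at hQa
      exact hQa hP.2
  obtain ⟨b, hb, hbS⟩ := Set.not_subset.1 hnot
  have hb1 : b ∈ J := (Ideal.mul_le_left : J * ∏ P ∈ T, P ≤ J) hb
  have hb2 : b ∈ (∏ P ∈ T, P : Ideal R) := (Ideal.mul_le_right : J * ∏ P ∈ T, P ≤ _) hb
  refine ⟨b, hb1, fun P hP hab => ?_⟩
  by_cases ha : a ∈ P
  · have h1 : b ∈ P := (Ideal.add_mem_iff_right P ha).1 hab
    have h2 : P ∈ S := ⟨hP, ha⟩
    exact hbS (Set.mem_biUnion h2 h1)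
  · have h1 : b ∈ P := by
      have h2 : P ∈ T := Finset.mem_filter.2 ⟨hs.mem_toFinset.2 hP, ha⟩
      have h3 : (∏ P ∈ T, P : Ideal R) ≤ P := (Ideal.prod_le_inf).trans (Finset.inf_le h2)
      exact h3 hb2
    exact ha ((Ideal.add_mem_iff_left P h1).1 hab)

theorem DimLe.step [IsNoetherianRing R] {I : Ideal R} {e : ℕ} (h : DimLe I (e+1)) (a : R) (J : Ideal R)
    (h' : DimLe (I ⊔ (Ideal.span {a} ⊔ J)) e) : ∃ b ∈ J, DimLe (I ⊔ Ideal.span {a + b}) e := by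
  let s : Set (Ideal R) := {P ∈ I.minimalPrimes | ∃ Q : PrimeSpectrum R, Q.asIdeal = P ∧ ¬ Order.coheight Q ≤ e}
  obtain ⟨b, hb, hP⟩ := coset_avoid s (I.finite_minimalPrimes_of_isNoetherianRing.subset fun P hP => hP.1)
    (fun P hP => hP.1.1.1) (fun P hP Q hQ hPQ => le_antisymm hPQ (hQ.1.2 hP.1.1 hPQ)) a J (by
      rintro P ⟨hP, Q, rfl, hQ⟩ hle
      exact hQ (h' Q (sup_le hP.1.2 hle)))
  refine ⟨b, hb, fun Q hQ => ?_⟩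
  by_contra hc
  have hIQ : I ≤ Q.asIdeal := le_sup_left.trans hQ
  obtain ⟨P, hPm, hPQ⟩ := Ideal.exists_minimalPrimes_le hIQ
  let P' : PrimeSpectrum R := ⟨P, hPm.1.1⟩
  have hle : P' ≤ Q := hPQ
  rcases hle.lt_or_eq with hlt | heq
  · have h1 := Order.coheight_add_one_le hlt
    have h2 := h1.trans (h P' hPm.1.2)
    rw [Nat.cast_add, Nat.cast_one] at h2
    exact hc ((ENat.add_le_add_iff_right ENat.one_ne_top).1 h2)
  · have hQP : Q.asIdeal = P := by rw [← heq]
    refine hP P ⟨hPm, Q, hQP, hc⟩ ?_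
    rw [← hQP]
    exact hQ (Ideal.mem_sup_right (Ideal.mem_span_singleton_self _))

theorem DimLe.chain [IsNoetherianRing R] (e k : ℕ) : ∀ (I : Ideal R) (f : Fin (k+1) → R), DimLe I (e+k) →
    DimLe (I ⊔ Ideal.span (Set.range f)) e → ∃ (Y : Fin k → R) (x : R),
      Ideal.span (Set.range Y) ⊔ Ideal.span {x} = Ideal.span (Set.range f) ∧ DimLe (I ⊔ Ideal.span (Set.range Y)) e := by
  induction k with
  | zero =>
    intro I f h1 h2
    refine ⟨Fin.elim0, f 0, ?_, ?_⟩
    · have : Set.range f = {f 0} := by ext a; simp [Fin.exists_fin_one, eq_comm]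
      rw [Set.range_eq_empty, this]; simp
    · rw [Set.range_eq_empty]; simpa using h1
  | succ k ih =>
    intro I f h1 h2
    have hf : Ideal.span (Set.range f) = Ideal.span {f 0} ⊔ Ideal.span (Set.range fun i : Fin (k+1) => f i.succ) := by
      rw [← Ideal.span_union]
      congr 1
      ext a; simp [Fin.exists_fin_succ, eq_comm]
    obtain ⟨b, hb, h3⟩ := DimLe.step (e := e + k) h1 (f 0) (Ideal.span (Set.range fun i : Fin (k+1) => f i.succ))
      (hf ▸ h2.mono le_rfl (Nat.le_add_right _ _))
    have hf' : Ideal.span (Set.range f) = Ideal.span {f 0 + b} ⊔ Ideal.span (Set.range fun i : Fin (k+1) => f i.succ) := by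
      rw [hf]
      refine le_antisymm (sup_le ?_ le_sup_right) (sup_le ?_ le_sup_right) <;> rw [Ideal.span_singleton_le_iff_mem]
      · have := sub_mem (Ideal.mem_sup_left (Ideal.mem_span_singleton_self (f 0 + b)) : f 0 + b ∈ Ideal.span {f 0 + b} ⊔ Ideal.span (Set.range fun i : Fin (k+1) => f i.succ)) (Ideal.mem_sup_right hb)
        simpa using this
      · exact add_mem (Ideal.mem_sup_left (Ideal.mem_span_singleton_self _)) (Ideal.mem_sup_right hb)
    obtain ⟨Y, x, h4, h5⟩ := ih (I ⊔ Ideal.span {f 0 + b}) (fun i => f i.succ) h3 (by rw [sup_assoc, ← hf']; exact h2)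
    have hY : Ideal.span (Set.range (Fin.cons (f 0 + b) Y : Fin (k+1) → R)) = Ideal.span {f 0 + b} ⊔ Ideal.span (Set.range Y) := by
      rw [← Ideal.span_union]
      congr 1
      ext a; simp [Fin.exists_fin_succ, eq_comm]
    refine ⟨Fin.cons (f 0 + b) Y, x, ?_, ?_⟩
    · rw [hY, hf', ← h4, sup_assoc]
    · rw [hY, ← sup_assoc]; exact h5

theorem DimLe.extend [IsNoetherianRing R] [IsLocalRing R] (e : ℕ) : ∀ (I : Ideal R), DimLe I e →
    ∃ w : Fin e → R, (∀ i, w i ∈ maximalIdeal R) ∧ DimLe (I ⊔ Ideal.span (Set.range w)) 0 := by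
  have hm : DimLe (maximalIdeal R) 0 := by
    intro Q hQ
    have : IsMax Q := by
      intro P hP
      exact (le_maximalIdeal P.isPrime.ne_top).trans hQ
    rw [Order.coheight_eq_zero.2 this]; exact zero_le
  induction e with
  | zero =>
    intro I h
    exact ⟨Fin.elim0, fun i => i.elim0, h.mono le_sup_left le_rfl⟩
  | succ e ih =>
    intro I h
    obtain ⟨b, hb, h1⟩ := h.step 0 (maximalIdeal R) (hm.mono (le_sup_right.trans le_sup_right) (Nat.zero_le _))
    obtain ⟨w, hw, h2⟩ := ih _ h1
    refine ⟨Fin.cons (0+b) w, ?_, ?_⟩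
    · intro i
      refine Fin.cases ?_ (fun i => ?_) i
      · simpa using hb
      · simpa using hw i
    · refine h2.mono ?_ le_rfl
      rw [sup_assoc, ← Ideal.span_union]
      refine sup_le_sup_left (Ideal.span_mono ?_) _
      rintro a (rfl | ⟨i, rfl⟩)
      · exact ⟨0, rfl⟩
      · exact ⟨i.succ, rfl⟩

theorem DimLe.pow_le [IsNoetherianRing R] [IsLocalRing R] (I : Ideal R) (h : DimLe I 0) : ∃ s, maximalIdeal R ^ s ≤ I := by
  refine Ideal.exists_pow_le_of_le_radical_of_fg ?_ (IsNoetherian.noetherian _)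
  rw [Ideal.radical_eq_sInf]
  refine le_sInf ?_
  rintro P ⟨hIP, hP⟩
  have h1 := h ⟨P, hP⟩ hIP
  have h2 : Order.coheight (⟨P, hP⟩ : PrimeSpectrum R) = 0 := by simpa using h1
  have h3 := Order.coheight_eq_zero.1 h2
  exact h3 (b := ⟨maximalIdeal R, inferInstance⟩) (le_maximalIdeal hP.ne_top)

theorem DimLe.of_sop [IsNoetherianRing R] [IsLocalRing R] (I : Ideal R) (S : Finset R)
    (hS : (S : Set R) ⊆ maximalIdeal R) (h : maximalIdeal R ≤ (I ⊔ Ideal.span (S : Set R)).radical) : DimLe I S.card := by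
  classical
  intro Q hQ
  have _ : IsLocalRing (R ⧸ Q.asIdeal) := IsLocalRing.of_surjective' _ Ideal.Quotient.mk_surjective
  have _ : IsLocalHom (Ideal.Quotient.mk Q.asIdeal) := 
    IsLocalHom.of_surjective _ Ideal.Quotient.mk_surjective
  have h0 : ((Order.coheight Q : ℕ∞) : WithBot ℕ∞) = ringKrullDim (R ⧸ Q.asIdeal) := by
    rw [ringKrullDim_quotient, Order.coheight_eq_krullDim_Ici]
    have : Set.Ici Q = PrimeSpectrum.zeroLocus (Q.asIdeal : Set R) := by
      ext P; rfl
    rw [this]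
  have h1 : maximalIdeal (R ⧸ Q.asIdeal) ∈ (Ideal.span ((S.image (Ideal.Quotient.mk Q.asIdeal) : Finset _) : Set (R ⧸ Q.asIdeal))).minimalPrimes := by
    refine ⟨⟨inferInstance, ?_⟩, ?_⟩
    · rw [Ideal.span_le]
      intro a ha
      obtain ⟨b, hb, rfl⟩ := Finset.mem_image.1 ha
      intro hu
      exact hS hb (isUnit_of_map_unit (Ideal.Quotient.mk Q.asIdeal) b hu)
    · rintro P ⟨hP, hPle⟩ _ a ha
      obtain ⟨b, rfl⟩ := Ideal.Quotient.mk_surjective a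
      have hb : b ∈ maximalIdeal R := fun hu => ha (hu.map _)
      have h1 : I ⊔ Ideal.span (S : Set R) ≤ P.comap (Ideal.Quotient.mk Q.asIdeal) := by
        refine sup_le (fun c hc => ?_) (Ideal.span_le.2 fun c hc => ?_)
        · rw [Ideal.mem_comap, Ideal.Quotient.eq_zero_iff_mem.2 (hQ hc)]; exact zero_mem _
        · exact hPle (Ideal.subset_span (Finset.mem_coe.2 (Finset.mem_image_of_mem _ hc)))
      exact (Ideal.IsPrime.radical_le_iff (Ideal.IsPrime.comap _)).2 h1 (h hb)
  have h2 := Ideal.height_le_card_of_mem_minimalPrimes_span_finset h1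
  have h3 : ringKrullDim (R ⧸ Q.asIdeal) ≤ (S.card : ℕ∞) := by
    rw [← IsLocalRing.maximalIdeal_height_eq_ringKrullDim]
    exact_mod_cast h2.trans (by exact_mod_cast Finset.card_image_le)
  rw [← h0] at h3
  exact_mod_cast h3

theorem DimLe.of_ne_zero [IsDomain R] {e : ℕ} (hR : ringKrullDim R ≤ (e + 1 : ℕ)) (a : R) (ha : a ≠ 0) : DimLe (Ideal.span {a}) e := by
  intro Q hQ
  have hlt : (⟨⊥, Ideal.isPrime_bot⟩ : PrimeSpectrum R) < Q := by
    change (⊥ : Ideal R) < Q.asIdeal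
    refine bot_lt_iff_ne_bot.2 fun h => ha ?_
    have := hQ (Ideal.mem_span_singleton_self a)
    rwa [h] at this
  have h1 := Order.coheight_add_one_le hlt
  have h2 := (Order.coheight_le_krullDim (⟨⊥, Ideal.isPrime_bot⟩ : PrimeSpectrum R)).trans hR
  have h3 := h1.trans (by exact_mod_cast h2 : _ ≤ ((e+1 : ℕ) : ℕ∞))
  rw [Nat.cast_add, Nat.cast_one] at h3
  exact (ENat.add_le_add_iff_right ENat.one_ne_top).1 h3

theorem coheight_up {A : Type} [CommRing A] (ev : A →+* R) (hev : ev.IsIntegral) (n : ℕ) :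
    ∀ (K : PrimeSpectrum A) (Q : PrimeSpectrum R), Q.asIdeal.comap ev = K.asIdeal → (n : ℕ∞) ≤ Order.coheight K →
      (n : ℕ∞) ≤ Order.coheight Q := by
  let _ : Algebra A R := ev.toAlgebra
  have _ : Algebra.IsIntegral A R := ⟨hev⟩
  induction n with
  | zero => intro K Q _ _; simp
  | succ n ih =>
    intro K Q hQ hn
    have h1 : ¬ Order.coheight K ≤ (n : ℕ∞) := by
      intro h
      have := hn.trans h
      have : n + 1 ≤ n := by exact_mod_cast this
      omega
    rw [Order.coheight_le_coe_iff] at h1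
    push Not at h1
    obtain ⟨K', hK, hn'⟩ := h1
    have hle : Q.asIdeal.comap (algebraMap A R) ≤ K'.asIdeal := by
      change Q.asIdeal.comap ev ≤ _
      rw [hQ]; exact hK.le
    obtain ⟨Q', hQQ, hp, hc⟩ := Ideal.exists_ideal_over_prime_of_isIntegral K'.asIdeal Q.asIdeal hle
    have h2 := ih K' ⟨Q', hp⟩ hc hn'
    have hlt : Q < ⟨Q', hp⟩ := by
      refine lt_of_le_of_ne hQQ ?_
      rintro rfl
      have : K.asIdeal = K'.asIdeal := hQ.symm.trans hc
      exact hK.ne (PrimeSpectrum.ext this)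
    refine le_trans ?_ (Order.coheight_add_one_le hlt)
    push_cast
    gcongr

end

section
open MvPowerSeries

theorem coheight_KX {V σ : Type} [CommRing V] [Fintype σ] [DecidableEq σ] [IsDomain V] {k : Type} [Field k] (p : ℕ)
    (π : V →+* k) (hπ : ∀ v, π v = 0 ↔ (p : V) ∣ v) (hp0 : (p : V) ≠ 0) (n : ℕ) :
    ∀ (T : Finset σ) (Q : PrimeSpectrum (MvPowerSeries σ V)), Tᶜ.card = n → Q.asIdeal = Ideal.span ((X : σ → MvPowerSeries σ V) '' T) →
      ((n + 1 : ℕ) : ℕ∞) ≤ Order.coheight Q := by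
  induction n with
  | zero =>
    intro T Q _ hQ
    have h1 := KXp_prime (σ := σ) T (p : V) π hπ
    have hlt : Q < ⟨_, h1⟩ := by
      change Q.asIdeal < _
      rw [hQ]
      refine lt_of_le_of_ne le_sup_left fun h => hp0 ?_
      have h2 : (C (p : V) : MvPowerSeries σ V) ∈ Ideal.span ((X : σ → MvPowerSeries σ V) '' T) := by
        rw [h]; exact Ideal.mem_sup_right (Ideal.mem_span_singleton_self _)
      have h3 := (mem_KX T _).1 h2 0 (by simp)
      simpa using h3
    refine le_trans ?_ (Order.coheight_add_one_le hlt)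
    simp
  | succ n ih =>
    intro T Q hT hQ
    obtain ⟨s, hs⟩ : (Tᶜ).Nonempty := by rw [← Finset.card_pos, hT]; omega
    have hs' : s ∉ T := by simpa using hs
    have h1 := KX_prime (V := V) (insert s T)
    have hlt : Q < ⟨_, h1⟩ := by
      change Q.asIdeal < _
      rw [hQ]
      refine lt_of_le_of_ne (Ideal.span_mono (Set.image_mono (by simp))) fun h => ?_
      refine X_notMem_KXp T s hs' p π hπ (Ideal.mem_sup_left ?_)
      rw [h]
      exact Ideal.subset_span ⟨s, by simp, rfl⟩
    have h2 := ih (insert s T) ⟨_, h1⟩ (by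
      rw [Finset.compl_insert, Finset.card_erase_of_mem hs, hT]; rfl) rfl
    refine le_trans ?_ (Order.coheight_add_one_le hlt)
    rw [Nat.cast_add]
    gcongr
    simp

theorem core (R : Type) [CommRing R] [IsDomain R] [IsNoetherianRing R] [IsLocalRing R]
    [IsAdicComplete (maximalIdeal R) R]
    (p : ℕ) [Fact p.Prime] [CharZero R] (hp : (p : R) ∈ maximalIdeal R)
    (hk : FFinite p (ResidueField R)) {σ : Type} [Fintype σ] [DecidableEq σ] (y : σ → R)
    (hy : ∀ s, y s ∈ maximalIdeal R) (s : ℕ)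
    (hs : maximalIdeal R ^ s ≤ Ideal.span {(p : R)} ⊔ Ideal.span (Set.range y))
    (hd : ringKrullDim R = (Fintype.card σ + 1 : ℕ)) :
    ∃ (A : Type) (_ : CommRing A) (_ : IsDomain A) (_ : IsNoetherianRing A) (ev : A →+* R) (Z : σ → A),
      Function.Injective ev ∧ ev.IsIntegral ∧ (∀ s, ev (Z s) = y s) ∧
      (∀ T : Finset σ, (Ideal.span (Z '' T)).IsPrime) ∧
      (∀ T : Finset σ, Nice p (Ideal.span (Z '' T))) ∧
      (∀ T : Finset σ, ∀ s ∉ T, Z s ∉ Ideal.span (Z '' T) ⊔ Ideal.span {(p : A)}) ∧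
      (∀ (T : Finset σ) (Q : PrimeSpectrum A), Q.asIdeal = Ideal.span (Z '' T) →
        ((Tᶜ.card + 1 : ℕ) : ℕ∞) ≤ Order.coheight Q) ∧
      ∃ (κ : Type) (_ : Fintype κ) (_ : DecidableEq κ) (w : κ → A),
        (∀ a : A, ∃ c : (κ → Fin p) → A, (p : A) ∣ a - ∑ I, c I ^ p * ∏ k, w k ^ (I k).val) ∧
        (∀ c : (κ → Fin p) → A, (p : A) ∣ ∑ I, c I ^ p * ∏ k, w k ^ (I k).val → ∀ I, (p : A) ∣ c I) := by
  have hp0 : (p : R) ≠ 0 := Nat.cast_ne_zero.2 (Fact.out : p.Prime).ne_zero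
  have hpk : (p : ResidueField R) = 0 := by
    have := (residue_eq_zero_iff (p : R)).2 hp
    simpa using this
  have _ : CharP (ResidueField R) p := (CharP.charP_iff_prime_eq_zero (Fact.out : p.Prime)).2 hpk
  obtain ⟨m, s0, hs0⟩ := hk
  obtain ⟨e, tk, hα, hβ⟩ := exists_pbasis p s0 hs0
  choose t ht using fun i => residue_surjective (R := R) (tk i)
  have hα' : ∀ a : ResidueField R, ∃ c : (Fin e → Fin p) → ResidueField R, a = ∑ I, c I ^ p * ∏ i, residue R (t i) ^ (I i).val := by
    simpa only [ht] using hα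
  have hβ' : ∀ c : (Fin e → Fin p) → ResidueField R, ∑ I, c I ^ p * ∏ i, residue R (t i) ^ (I i).val = 0 → ∀ I, c I = 0 := by
    simpa only [ht] using hβ
  obtain ⟨V, hV, htV⟩ := exists_coeff p hp hp0 t hα' hβ'
  have _ := hV.dvr hp hp0
  have _ := hV.complete hp hp0
  let π : V →+* ResidueField R := (residue R).comp V.subtype
  have hπm : ∀ v : V, π v = 0 ↔ (v : R) ∈ maximalIdeal R := fun v => residue_eq_zero_iff (v : R)
  have hπ : ∀ v, π v = 0 ↔ (p : V) ∣ v := by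
    intro v
    rw [hπm]
    constructor
    · intro h
      obtain ⟨w, hw, h1⟩ := hV.pmax v v.2 h
      exact ⟨⟨w, hw⟩, Subtype.ext (by simpa using h1)⟩
    · rintro ⟨w, rfl⟩
      have : (((p : V) * w : V) : R) = p * w := by simp
      rw [this]
      exact Ideal.mul_mem_right _ _ hp
  have hπs : Function.Surjective π := by
    intro a
    obtain ⟨r, rfl⟩ := residue_surjective a
    obtain ⟨v, hv, h1⟩ := hV.surj r
    refine ⟨⟨v, hv⟩, ?_⟩
    change residue R v = _
    rw [← sub_eq_zero, ← map_sub, residue_eq_zero_iff, ← neg_sub]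
    exact neg_mem h1
  have hpV0 : (p : V) ≠ 0 := fun h => hp0 (by simpa using congrArg Subtype.val h)
  have hpVm : (p : V) ∈ maximalIdeal V := fun hu => by
    have := (hu.map π)
    rw [(hπ p).2 dvd_rfl] at this
    exact not_isUnit_zero this
  have hVm : ∀ v ∈ maximalIdeal V, (p : V) ∣ v := by
    intro v hv
    rw [← hπ, hπm]
    by_contra h
    exact hv (hV.unit hp hp0 v h)
  have hVd : ∀ v : V, (∀ b, (p:V)^b ∣ v) → v = 0 := by
    intro v hv
    refine IsHausdorff.haus (I := Ideal.span {(p:V)}) inferInstance v fun n => ?_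
    rw [SModEq.zero, smul_eq_mul, Ideal.mul_top, Ideal.span_singleton_pow, Ideal.mem_span_singleton]
    exact hv n
  obtain ⟨ev, hX, hC⟩ := exists_ev V.subtype y hy
  have hint := hV.ev_finite hp hp0 y hy s hs ev hX hC
  have _ : IsDomain (MvPowerSeries σ V) := NoZeroDivisors.to_isDomain _
  have hinj := ev_inj ev hint _ hd (dim_ps p hpVm hVm)
  refine ⟨MvPowerSeries σ V, inferInstance, inferInstance, inferInstance, ev, X, hinj, hint, hX, fun T => KX_prime T,
    fun T => KX_nice T p π hπ hpV0 hVd, fun T s hs => X_notMem_KXp T s hs p π hπ, fun T Q hQ => coheight_KX p π hπ hpV0 _ T Q rfl hQ,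
    σ ⊕ Fin e, inferInstance, inferInstance, Sum.elim (fun s => X s) (fun i => C (⟨t i, htV i⟩ : V)),
    V_alpha p π hπ hπs _ hα', V_beta p π hπ _ hβ'⟩

theorem epf_out {p : ℕ} [Fact p.Prime] (R : Type) [CommRing R] [IsDomain R] {S : Type} [CommRing S] [Fact ¬IsUnit (p : S)]
    [IsAdicComplete (Ideal.span {(p : S)}) S] {i : RPlus R →+* S} {ϖ : ℕ → RPlus R} (hS : PS p i ϖ)
    (J : Ideal (RPlus R)) (b N : ℕ) (u : RPlus R)
    (h : ∃ r : ℕ → RPlus R, r 0 ≠ 0 ∧ (∀ k, r (k+1) ^ p = r k) ∧ ∀ k, r k ^ 2 * u ∈ J ⊔ Ideal.span {(p : RPlus R) ^ (N - b)}) :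
    u ∈ epfPlus p R (J ⊔ Ideal.span {(p : RPlus R) ^ (N - (b+1))}) := by
  obtain ⟨r, h0, hr, h⟩ := h
  refine ⟨r 0, h0, fun n N' hn _ d hd => ?_⟩
  have h1 := hS.root_out r hr _ u h n hn d hd
  refine Ideal.mem_sup_left (sup_le_sup_left ?_ J h1)
  rw [Ideal.span_singleton_le_span_singleton]
  exact pow_dvd_pow _ (by omega)

theorem exists_PS' (R : Type) [CommRing R] [IsDomain R] [IsLocalRing R] (p : ℕ) [Fact p.Prime] [CharZero R]
    (hp : (p : R) ∈ maximalIdeal R) :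
    ∃ (S : Type) (_ : CommRing S) (_ : Fact ¬IsUnit (p : S)) (_ : IsAdicComplete (Ideal.span {(p : S)}) S)
      (i : RPlus R →+* S) (ϖ : ℕ → RPlus R), PS p i ϖ := by
  have hp0 : (p : R) ≠ 0 := Nat.cast_ne_zero.2 (Fact.out : p.Prime).ne_zero
  refine exists_PS p (RPlus.root R p (Fact.out : p.Prime).pos) (RPlus.norm R) ?_ ?_
  · intro h
    refine hp0 (RPlus.inj R ?_)
    rw [map_natCast, h, map_zero]
  · intro hu
    have _ : IsLocalHom (algebraMap R (RPlus R)) := (RPlus.integral R).isLocalHom (RPlus.inj R)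
    refine hp (isUnit_of_map_unit (algebraMap R (RPlus R)) _ ?_)
    rwa [map_natCast]
end

section

theorem IsSOP.dimLe {R : Type} [CommRing R] [IsNoetherianRing R] [IsLocalRing R] {d : ℕ} {X : Fin d → R} (h : IsSOP R X)
    (k : ℕ) (I : Ideal R) (hI : ∀ i : Fin d, (i : ℕ) < k → X i ∈ I) : DimLe I (d - k) := by
  classical
  let S : Finset R := (Finset.univ.filter fun i : Fin d => k ≤ i).image X
  have hX : ∀ i, X i ∈ maximalIdeal R := fun i => by
    rw [← h.2]; exact Ideal.le_radical (Ideal.subset_span ⟨i, rfl⟩)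
  have h1 : DimLe I S.card := by
    refine DimLe.of_sop I S ?_ ?_
    · intro a ha
      obtain ⟨i, _, rfl⟩ := Finset.mem_image.1 ha
      exact hX i
    · rw [← h.2]
      refine Ideal.radical_mono (Ideal.span_le.2 ?_)
      rintro _ ⟨i, rfl⟩
      by_cases hi : (i : ℕ) < k
      · exact Ideal.mem_sup_left (hI i hi)
      · refine Ideal.mem_sup_right (Ideal.subset_span (Finset.mem_coe.2 (Finset.mem_image_of_mem _ ?_)))
        simpa using hi
  refine h1.mono le_rfl (Finset.card_image_le.trans ?_)
  have h2 : (Finset.univ.filter fun i : Fin d => k ≤ i).card = ((Finset.univ.filter fun i : Fin d => k ≤ i).image Fin.val).card :=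
    (Finset.card_image_of_injective _ Fin.val_injective).symm
  rw [h2, ← Nat.card_Ico]
  refine Finset.card_le_card fun a ha => ?_
  obtain ⟨i, hi, rfl⟩ := Finset.mem_image.1 ha
  simp at hi
  simp [hi]

theorem capture0 (R : Type) [CommRing R] [IsDomain R] [IsNoetherianRing R] [IsLocalRing R]
    [IsAdicComplete (maximalIdeal R) R]
    (p : ℕ) [Fact p.Prime] [CharZero R] (hp : (p : R) ∈ maximalIdeal R)
    (hk : FFinite p (ResidueField R)) (x : R) (d : ℕ) (hd : 1 ≤ d) (X : Fin d → R) (hX : IsSOP R X) (hx : X ⟨0, hd⟩ = x) :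
    ∃ b : ℕ, ∀ (N : ℕ) (u : RPlus R), algebraMap R (RPlus R) x * u ∈ Ideal.span {(p : RPlus R) ^ N} →
      u ∈ epfPlus p R (⊥ ⊔ Ideal.span {(p : RPlus R) ^ (N - (b+1))}) := by
  have hp0 : (p : R) ≠ 0 := Nat.cast_ne_zero.2 (Fact.out : p.Prime).ne_zero
  obtain ⟨e, rfl⟩ : ∃ e, d = e + 1 := ⟨d - 1, by omega⟩
  have hx0 : x ≠ 0 := by
    rintro rfl
    have h1 := hX.dimLe 1 ⊥ (fun i hi => by
      have : i = ⟨0, hd⟩ := Fin.ext (by simpa using hi)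
      rw [this, hx]; exact zero_mem _)
    have h2 : ringKrullDim R ≤ (e : ℕ) := by
      rw [ringKrullDim, Order.krullDim_eq_iSup_coheight]
      refine iSup_le fun Q => ?_
      exact_mod_cast h1 Q bot_le
    rw [hX.1] at h2
    have : e + 1 ≤ e := by exact_mod_cast h2
    omega
  have hD : DimLe (Ideal.span {(p : R)}) e := DimLe.of_ne_zero hX.1.le _ hp0
  obtain ⟨w, hw, hw'⟩ := DimLe.extend e _ hD
  obtain ⟨s, hs⟩ := DimLe.pow_le _ hw'
  obtain ⟨A, _, _, _, ev, Z, hinj, hint, hZ, -, hnice, -, -, κ, _, _, t, hα, hβ⟩ :=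
    core R p hp hk w hw s hs (by rw [hX.1, Fintype.card_fin])
  obtain ⟨S, _, _, _, i, ϖ, hS⟩ := exists_PS' R p hp
  have hN : Nice p (⊥ : Ideal A) := by simpa using hnice ∅
  have hjinj : Function.Injective ((algebraMap R (RPlus R)).comp ev) := (RPlus.inj R).comp hinj
  have hjint : ((algebraMap R (RPlus R)).comp ev).IsIntegral := hint.trans _ _ (RPlus.integral R)
  obtain ⟨Xs, φ, hG⟩ := tower_good hS ((algebraMap R (RPlus R)).comp ev) hjinj hjint (by simpa using hN.pr) t hα hβ
  have hz : ∃ z : A, z ≠ 0 ∧ x ∣ ev z := by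
    let _ : Algebra A R := ev.toAlgebra
    have h1 := Ideal.comap_ne_bot_of_integral_mem (R := A) (I := Ideal.span {x}) hx0 (Ideal.mem_span_singleton_self x) (hint x)
    obtain ⟨z, hz, hz0⟩ := Submodule.exists_mem_ne_zero_of_ne_bot h1
    exact ⟨z, hz0, Ideal.mem_span_singleton.1 hz⟩
  obtain ⟨z, hz0, a, ha⟩ := hz
  obtain ⟨b, hb⟩ := exch0 _ hjinj hjint hG z hz0 hN
  refine ⟨b, fun N u hu => epf_out R hS ⊥ b N u ?_⟩
  rw [bot_sup_eq]
  refine hb N u ?_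
  have : ((algebraMap R (RPlus R)).comp ev) z * u = algebraMap R (RPlus R) a * (algebraMap R (RPlus R) x * u) := by
    rw [RingHom.comp_apply, ha, map_mul]; ring
  rw [this]
  exact Ideal.mul_mem_left _ _ hu

theorem capture1 (R : Type) [CommRing R] [IsDomain R] [IsNoetherianRing R] [IsLocalRing R]
    [IsAdicComplete (maximalIdeal R) R]
    (p : ℕ) [Fact p.Prime] [CharZero R] (hp : (p : R) ∈ maximalIdeal R)
    (hk : FFinite p (ResidueField R)) (m : ℕ) (f : Fin (m+1) → R) (x : R) (d : ℕ) (hd : m + 2 ≤ d) (X : Fin d → R) (hX : IsSOP R X)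
    (hf : ∀ i : Fin (m+1), X ⟨i, by omega⟩ = f i) (hx : X ⟨m+1, hd⟩ = x) :
    ∃ b : ℕ, ∀ (N : ℕ) (u : RPlus R), algebraMap R (RPlus R) x * u ∈
        (Ideal.span (Set.range f)).map (algebraMap R (RPlus R)) ⊔ Ideal.span {(p : RPlus R) ^ N} →
      u ∈ epfPlus p R ((Ideal.span (Set.range f)).map (algebraMap R (RPlus R)) ⊔ Ideal.span {(p : RPlus R) ^ (N - (b+1))}) := by
  classical
  have hp0 : (p : R) ≠ 0 := Nat.cast_ne_zero.2 (Fact.out : p.Prime).ne_zero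
  obtain ⟨e, rfl⟩ : ∃ e, d = e + (m + 2) := ⟨d - (m+2), by omega⟩
  have hXm : ∀ i, X i ∈ maximalIdeal R := fun i => by
    rw [← hX.2]; exact Ideal.le_radical (Ideal.subset_span ⟨i, rfl⟩)
  have hfm : Ideal.span (Set.range f) ≤ maximalIdeal R := by
    rw [Ideal.span_le]; rintro _ ⟨i, rfl⟩; rw [← hf i]; exact hXm _
  have hfI : ∀ i : Fin (e + (m+2)), (i : ℕ) < m + 1 → X i ∈ Ideal.span (Set.range f) := by
    intro i hi
    exact Ideal.subset_span ⟨⟨i, hi⟩, (hf ⟨i, hi⟩).symm⟩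
  have hD : DimLe (Ideal.span {(p : R)}) (e + 1 + m) := DimLe.of_ne_zero (by rw [hX.1]; exact le_of_eq (by congr 1; omega)) _ hp0
  have hD1 : DimLe (Ideal.span (Set.range f)) (e + 1) := by
    have := hX.dimLe (m+1) _ hfI
    exact this.mono le_rfl (by omega)
  have hD2 : ∀ I : Ideal R, Ideal.span (Set.range f) ≤ I → x ∈ I → DimLe I e := by
    intro I hI hxI
    have := hX.dimLe (m+2) I (fun i hi => by
      rcases Nat.lt_succ_iff_lt_or_eq.1 hi with h | h
      · exact hI (hfI i h)
      · have : i = ⟨m+1, hd⟩ := Fin.ext h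
        rw [this, hx]; exact hxI)
    exact this.mono le_rfl (by omega)
  obtain ⟨Y, ξ, hY, hDY⟩ := DimLe.chain (e+1) m (Ideal.span {(p:R)}) f hD (hD1.mono le_sup_right le_rfl)
  obtain ⟨a, ha, hDa⟩ := hDY.step x (Ideal.span (Set.range f)) (hD2 _ (le_sup_right.trans le_sup_right)
    (Ideal.mem_sup_right (Ideal.mem_sup_left (Ideal.mem_span_singleton_self x))))
  obtain ⟨w, hw, hw'⟩ := DimLe.extend e _ hDa
  obtain ⟨s, hs⟩ := DimLe.pow_le _ hw'
  let y : Fin m ⊕ (Unit ⊕ Fin e) → R := Sum.elim Y (Sum.elim (fun _ => x + a) w)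
  have hxm : x ∈ maximalIdeal R := hx ▸ hXm _
  have hy : ∀ s, y s ∈ maximalIdeal R := by
    rintro (i | i | i)
    · exact hfm (hY ▸ Ideal.mem_sup_left (Ideal.subset_span ⟨i, rfl⟩))
    · exact add_mem hxm (hfm ha)
    · exact hw i
  have hs' : maximalIdeal R ^ s ≤ Ideal.span {(p : R)} ⊔ Ideal.span (Set.range y) := by
    refine hs.trans ?_
    refine sup_le (sup_le (sup_le le_sup_left ?_) ?_) ?_
    · refine le_trans (Ideal.span_mono ?_) le_sup_right
      rintro _ ⟨i, rfl⟩; exact ⟨Sum.inl i, rfl⟩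
    · refine le_trans (Ideal.span_mono ?_) le_sup_right
      rintro _ rfl; exact ⟨Sum.inr (Sum.inl ()), rfl⟩
    · refine le_trans (Ideal.span_mono ?_) le_sup_right
      rintro _ ⟨i, rfl⟩; exact ⟨Sum.inr (Sum.inr i), rfl⟩
  obtain ⟨A, _, _, _, ev, Z, hinj, hint, hZ, hprime, hnice, hnot, hcoh, κ, _, _, t, hα, hβ⟩ :=
    core R p hp hk y hy s hs' (by rw [hX.1]; congr 1; simp; omega)
  obtain ⟨S, _, _, _, i, ϖ, hS⟩ := exists_PS' R p hp
  have hN : Nice p (⊥ : Ideal A) := by simpa using hnice ∅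
  have hjinj : Function.Injective ((algebraMap R (RPlus R)).comp ev) := (RPlus.inj R).comp hinj
  have hjint : ((algebraMap R (RPlus R)).comp ev).IsIntegral := hint.trans _ _ (RPlus.integral R)
  obtain ⟨Xs, φ, hG⟩ := tower_good hS ((algebraMap R (RPlus R)).comp ev) hjinj hjint (by simpa using hN.pr) t hα hβ
  let T0 : Finset (Fin m ⊕ (Unit ⊕ Fin e)) := Finset.univ.image Sum.inl
  let T1 : Finset (Fin m ⊕ (Unit ⊕ Fin e)) := insert (Sum.inr (Sum.inl ())) T0
  let YA : Fin m → A := fun i => Z (Sum.inl i)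
  let yA : A := Z (Sum.inr (Sum.inl ()))
  have hT0 : Ideal.span (Z '' T0) = Ideal.span (Set.range YA) := by
    congr 1; ext a; simp [T0, YA]
  have hT1 : Ideal.span (Z '' T1) = Ideal.span (Set.range YA) ⊔ Ideal.span {yA} := by
    rw [← hT0, ← Ideal.span_union]
    congr 1
    simp only [T1, Finset.coe_insert, Set.image_insert_eq, Set.union_singleton]; rfl
  have hT1c : T1ᶜ.card = e := by
    have h1 := Finset.card_add_card_compl T1
    have h2 : T1.card = m + 1 := by
      rw [Finset.card_insert_of_notMem (by simp [T0]), Finset.card_image_of_injective _ Sum.inl_injective]; simp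
    rw [h2] at h1
    simp at h1
    omega
  have hYA : (Ideal.span (Set.range YA)).map ev = Ideal.span (Set.range Y) := by
    rw [Ideal.map_span, ← Set.range_comp]
    congr 2; funext i; exact hZ (Sum.inl i)
  have hyA : ev yA = x + a := hZ _
  have hz : ∃ z : A, ev z ∈ Ideal.span (Set.range f) ∧ z ∉ Ideal.span (Z '' T1) := by
    by_contra hc
    push Not at hc
    let _ : Algebra A R := ev.toAlgebra
    have _ : Algebra.IsIntegral A R := ⟨hint⟩
    have _ := hprime T1
    obtain ⟨Q, hQ, hQp, hQc⟩ := Ideal.exists_ideal_over_prime_of_isIntegral (Ideal.span (Z '' T1)) (Ideal.span (Set.range f))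
      (fun z hz => hc z hz)
    have h1 := hcoh T1 ⟨_, hprime T1⟩ rfl
    have h2 := coheight_up ev hint _ ⟨_, hprime T1⟩ ⟨Q, hQp⟩ hQc h1
    have hxQ : x ∈ Q := by
      have h3 : yA ∈ Q.comap (algebraMap A R) := by
        rw [hQc, hT1]; exact Ideal.mem_sup_right (Ideal.mem_span_singleton_self _)
      have h4 : ev yA ∈ Q := h3
      rw [hyA] at h4
      exact (Ideal.add_mem_iff_left Q (hQ ha)).1 h4
    have h3 := h2.trans (hD2 Q hQ hxQ ⟨Q, hQp⟩ le_rfl)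
    rw [hT1c] at h3
    have : e + 1 ≤ e := by exact_mod_cast h3
    omega
  obtain ⟨z, hz1, hz2⟩ := hz
  have hJ : (Ideal.span (Set.range f)).map (algebraMap R (RPlus R)) =
      (Ideal.span (Set.range YA)).map ((algebraMap R (RPlus R)).comp ev) ⊔ Ideal.span {algebraMap R (RPlus R) ξ} := by
    rw [← Ideal.map_map, hYA, ← hY, Ideal.map_sup, Ideal.map_span _ {ξ}, Set.image_singleton]
  obtain ⟨b, hb⟩ := exch _ hjinj hjint hG YA yA z (hT0 ▸ hnice T0) (hT1 ▸ hnice T1) (hT1 ▸ hz2)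
    (hT0 ▸ hnot T0 _ (by simp [T0])) (algebraMap R (RPlus R) ξ) (hJ ▸ Ideal.mem_map_of_mem _ hz1)
  refine ⟨b, fun N u hu => epf_out R hS _ b N u ?_⟩
  rw [hJ]
  refine hb N u ?_
  rw [← hJ]
  have : ((algebraMap R (RPlus R)).comp ev) yA * u = algebraMap R (RPlus R) x * u + u * algebraMap R (RPlus R) a := by
    rw [RingHom.comp_apply, hyA, map_add]; ring
  rw [this]
  exact add_mem hu (Ideal.mem_sup_left (Ideal.mul_mem_left _ _ (Ideal.mem_map_of_mem _ ha)))
end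

theorem stmt1 (R : Type) [CommRing R] [IsDomain R] [IsNoetherianRing R] [IsLocalRing R]
    [IsAdicComplete (maximalIdeal R) R]
    (p : ℕ) [Fact p.Prime] [CharZero R] (hp : (p : R) ∈ maximalIdeal R)
    (hk : FFinite p (ResidueField R))
    (n : ℕ) (x : Fin (n + 1) → R) (hx : IsPartialSOP R x) :
    ∃ N₀ : ℕ, 0 < N₀ ∧ ∀ N : ℕ, N₀ ≤ N → ∀ u : RPlus R,
      algebraMap R (RPlus R) (x (Fin.last n)) * u ∈
          Ideal.span (⇑(algebraMap R (RPlus R)) '' (x '' {i | (i : ℕ) < n})) ⊔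
            Ideal.span {(p : RPlus R) ^ N} →
        u ∈ epfPlus p R
          (Ideal.span (⇑(algebraMap R (RPlus R)) '' (x '' {i | (i : ℕ) < n})) ⊔
            Ideal.span {(p : RPlus R) ^ (N - N₀)}) := by
  obtain ⟨d, hd, X, hX, hxX⟩ := hx
  cases n with
  | zero =>
    obtain ⟨b, hb⟩ := capture0 R p hp hk (x (Fin.last 0)) d hd X hX (hxX (Fin.last 0))
    refine ⟨b + 1, Nat.succ_pos b, fun N _ u hu => ?_⟩
    have h0 : Ideal.span (⇑(algebraMap R (RPlus R)) '' (x '' {i | (i : ℕ) < 0})) = ⊥ := by simp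
    rw [h0] at hu ⊢
    rw [bot_sup_eq] at hu
    exact hb N u hu
  | succ m =>
    obtain ⟨b, hb⟩ := capture1 R p hp hk m (fun i => x i.castSucc) (x (Fin.last (m+1))) d hd X hX
      (fun i => hxX i.castSucc) (hxX (Fin.last (m+1)))
    refine ⟨b + 1, Nat.succ_pos b, fun N _ u hu => ?_⟩
    have h0 : Ideal.span (⇑(algebraMap R (RPlus R)) '' (x '' {i | (i : ℕ) < m + 1})) =
        (Ideal.span (Set.range fun i : Fin (m+1) => x i.castSucc)).map (algebraMap R (RPlus R)) := by
      rw [Ideal.map_span]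
      congr 2
      ext a
      constructor
      · rintro ⟨i, hi, rfl⟩
        exact ⟨⟨i, hi⟩, rfl⟩
      · rintro ⟨i, rfl⟩
        exact ⟨i.castSucc, i.2, rfl⟩
    rw [h0] at hu ⊢
    exact hb N u hu
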